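/- arXiv:math/0303386 — 2 statements merged into one kernel-verified Lean document; each statement's English description precedes it below -/
import Mathlib

section
/- The set TS is exponentially generic in the set C of all cyclically reduced words, and the set TS' is exponentially generic in F_k. -/
/-! Common definitions: free group `FG k = F(a_1,…,a_k)`, reduced and cyclically
reduced words, Whitehead automorphisms, strict minimality, counting functions and
exponential genericity, following Kapovich–Schupp–Shpilrain. -/

/-- The free group of rank `k` on the basis `a_1,…,a_k`. -/
abbrev FG (k : ℕ) := FreeGroup (Fin k)

/-- The alphabet `Σ = {a_1,…,a_k}^{±1}`: a letter is a basis index together with a sign. -/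
abbrev Letter (k : ℕ) := Fin k × Bool

/-- The inverse of a letter. -/
def linv {k : ℕ} (x : Letter k) : Letter k := (x.1, !x.2)

/-- The length `|g|` of the reduced word representing `g`. -/
def wordLength {k : ℕ} (g : FG k) : ℕ := (FreeGroup.toWord g).length

/-- A word is (freely) reduced if it equals its free reduction. -/
def ReducedWord {k : ℕ} (w : List (Letter k)) : Prop := FreeGroup.reduce w = w

/-- A word is cyclically reduced if all of its cyclic permutations are reduced;
equivalently, `w ++ w` is reduced. -/
def CyclicallyReducedWord {k : ℕ} (w : List (Letter k)) : Prop :=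
  FreeGroup.reduce (w ++ w) = w ++ w

/-- An element of `FG k` is cyclically reduced if its reduced word is. -/
def IsCyclicallyReduced {k : ℕ} (g : FG k) : Prop :=
  CyclicallyReducedWord (FreeGroup.toWord g)

/-- `C`, the set of all cyclically reduced elements of `FG k`. -/
def Cset (k : ℕ) : Set (FG k) := {g | IsCyclicallyReduced g}

/-- The cyclic length `‖g‖`: the length of the cyclically reduced form of `g`
(the unique cyclically reduced `u` with `g = x u x⁻¹`). -/
noncomputable def cyclicLength {k : ℕ} (g : FG k) : ℕ :=
  sInf {n | ∃ x u : FG k, IsCyclicallyReduced u ∧ g = x * u * x⁻¹ ∧ wordLength u = n}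

/-- The set `Σ = {a_1,…,a_k}^{±1}` inside the free group. -/
def letterSet (k : ℕ) : Set (FG k) :=
  {g | ∃ i : Fin k, g = FreeGroup.of i ∨ g = (FreeGroup.of i)⁻¹}

/-- A Whitehead automorphism of the first kind: a relabeling automorphism,
i.e. one whose restriction to `Σ` is a permutation of `Σ`. -/
def IsRelabeling {k : ℕ} (τ : MulAut (FG k)) : Prop :=
  (⇑τ) '' letterSet k = letterSet k

/-- A Whitehead automorphism of the second kind, with multiplier `a ∈ Σ`:
`τ a = a` and `τ x ∈ {x, xa, a⁻¹x, a⁻¹xa}` for all `x ∈ Σ`. -/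
def IsWhitehead2 {k : ℕ} (τ : MulAut (FG k)) : Prop :=
  ∃ a ∈ letterSet k, τ a = a ∧
    ∀ x ∈ letterSet k, τ x = x ∨ τ x = x * a ∨ τ x = a⁻¹ * x ∨ τ x = a⁻¹ * x * a

/-- An automorphism is inner if it is conjugation by some element. -/
def IsInner {k : ℕ} (α : MulAut (FG k)) : Prop := ∃ g : FG k, α = MulAut.conj g

/-- `SM`: the set of strictly minimal cyclically reduced elements, those `w` with
`‖τ w‖ > |w|` for every non-inner Whitehead automorphism `τ` of the second kind. -/
def SM (k : ℕ) : Set (FG k) :=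
  {w | IsCyclicallyReduced w ∧
    ∀ τ : MulAut (FG k), IsWhitehead2 τ → ¬ IsInner τ → wordLength w < cyclicLength (τ w)}

/-- `SM'`: elements whose cyclically reduced form lies in `SM`. -/
def SM' (k : ℕ) : Set (FG k) := {g | ∃ x u : FG k, u ∈ SM k ∧ g = x * u * x⁻¹}

/-- `γ(n,S)`: the number of elements of `S` of length `n`. -/
noncomputable def gammaC {k : ℕ} (S : Set (FG k)) (n : ℕ) : ℕ :=
  {g ∈ S | wordLength g = n}.ncard

/-- `ρ(n,S)`: the number of elements of `S` of length at most `n`. -/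
noncomputable def rhoC {k : ℕ} (S : Set (FG k)) (n : ℕ) : ℕ :=
  {g ∈ S | wordLength g ≤ n}.ncard

/-- `B ⊆ S` is exponentially generic in `S` if `ρ(n,B)/ρ(n,S) → 1`
exponentially fast. -/
def ExpGenericIn {k : ℕ} (B S : Set (FG k)) : Prop :=
  B ⊆ S ∧ ∃ K : ℝ, 0 < K ∧ ∃ σ : ℝ, 0 < σ ∧ σ < 1 ∧
    ∀ n : ℕ, |1 - (rhoC B n : ℝ) / (rhoC S n : ℝ)| ≤ K * σ ^ n

/-- `B` is exponentially negligible in `S` if `S \ B` is exponentially generic in `S`. -/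
def ExpNegligibleIn {k : ℕ} (B S : Set (FG k)) : Prop := ExpGenericIn (S \ B) S

/-- The orbit `Aut(F_k) w`. -/
def autOrbit {k : ℕ} (w : FG k) : Set (FG k) := {g | ∃ α : MulAut (FG k), α w = g}

/-- `u` is a cyclic permutation of `v`: the reduced word of `u` is a rotation of
the reduced word of `v`. -/
def IsCyclicPerm {k : ℕ} (u v : FG k) : Prop :=
  ∃ n : ℕ, FreeGroup.toWord u = (FreeGroup.toWord v).rotate n

/-- `w` is a proper power: `w = uⁿ` for some `n ≥ 2`. -/
def IsProperPower {k : ℕ} (w : FG k) : Prop := ∃ (u : FG k) (n : ℕ), 2 ≤ n ∧ w = u ^ n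

/-- `TS`: strictly minimal cyclically reduced `w` which are not proper powers and
are not conjugate to `τ w` for any nontrivial relabeling automorphism `τ`. -/
def TS (k : ℕ) : Set (FG k) :=
  {w | w ∈ SM k ∧ ¬ IsProperPower w ∧
    ∀ τ : MulAut (FG k), IsRelabeling τ → τ ≠ 1 → ¬ IsConj (τ w) w}

/-- `TS'`: elements whose cyclically reduced form lies in `TS`. -/
def TS' (k : ℕ) : Set (FG k) := {g | ∃ x u : FG k, u ∈ TS k ∧ g = x * u * x⁻¹}

/-- `Z`: elements of `TS` such that no relabeling automorphism sends `w` to a cyclic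
permutation of `w⁻¹`. -/
def Zset (k : ℕ) : Set (FG k) :=
  {w | w ∈ TS k ∧ ¬ ∃ τ : MulAut (FG k), IsRelabeling τ ∧ IsCyclicPerm (τ w) w⁻¹}

/-- Growth entropy `H(S) = limsup ρ(n,S)^{1/n}`. -/
noncomputable def entropyH {k : ℕ} (S : Set (FG k)) : ℝ :=
  Filter.limsup (fun n : ℕ => (rhoC S n : ℝ) ^ ((n : ℝ)⁻¹)) Filter.atTop

/-- Number of occurrences of the two-letter word `xy` as a subword of `w`. -/
def countPair {k : ℕ} (w : List (Letter k)) (x y : Letter k) : ℕ :=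
  (w.zip w.tail).count (x, y)

/-- The label `ŵ_{xy}` of the edge `[x⁻¹, y]` in the weighted Whitehead graph of the
cyclically reduced word `w`: occurrences of `xy` and of `y⁻¹x⁻¹` in `wc`, where `c` is
the first letter of `w`. -/
def whLabel {k : ℕ} (w : List (Letter k)) (x y : Letter k) : ℕ :=
  countPair (w ++ w.take 1) x y + countPair (w ++ w.take 1) (linv y) (linv x)

/-- The one-relator group `G_u = ⟨a_1,…,a_k ∣ u = 1⟩`. -/
abbrev OneRel (k : ℕ) (u : FG k) := FG k ⧸ Subgroup.normalClosure ({u} : Set (FG k))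

/-- `u` is primitive: it belongs to some free basis of `FG k`, equivalently it is the
image of a basis element under an automorphism. -/
def IsPrimitive {k : ℕ} (u : FG k) : Prop :=
  ∃ (α : MulAut (FG k)) (i : Fin k), α (FreeGroup.of i) = u

open FreeGroup in
theorem isRed_iff {k : ℕ} (w : List (Letter k)) : CyclicallyReducedWord w ↔ IsReduced (w ++ w) := by
  unfold CyclicallyReducedWord; exact isReduced_iff_reduce_eq.symm

theorem linv_linv {k : ℕ} (x : Letter k) : linv (linv x) = x := by simp [linv]

theorem linv_ne {k : ℕ} (x : Letter k) : linv x ≠ x := by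
  intro h; have := congrArg Prod.snd h; simp [linv] at this

theorem rel_iff {k : ℕ} (x y : Letter k) : (x.1 = y.1 → x.2 = y.2) ↔ y ≠ linv x := by
  obtain ⟨i, b⟩ := x; obtain ⟨j, c⟩ := y
  simp only [linv, ne_eq, Prod.mk.injEq, not_and]
  cases b <;> cases c <;> simp [eq_comm]

theorem mk_linv {k : ℕ} (x : Letter k) : FreeGroup.mk [linv x] = (FreeGroup.mk [x])⁻¹ := by
  simp [linv, FreeGroup.inv_mk, FreeGroup.invRev]

theorem mk_cons' {k : ℕ} (x : Letter k) (l : List (Letter k)) :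
    FreeGroup.mk (x :: l) = FreeGroup.mk [x] * FreeGroup.mk l := by
  rw [FreeGroup.mul_mk]; rfl

theorem red_triple {k : ℕ} {w : List (Letter k)} (h : FreeGroup.IsReduced (w ++ w)) :
    FreeGroup.IsReduced (w ++ w ++ w) := by
  by_cases hw : w = []
  · subst hw; simp
  · exact FreeGroup.IsReduced.append_overlap h h hw

theorem red_rot {k : ℕ} {u v : List (Letter k)} (h : FreeGroup.IsReduced ((u ++ v) ++ (u ++ v))) :
    FreeGroup.IsReduced ((v ++ u) ++ (v ++ u)) := by
  refine (red_triple h).infix ⟨u, v, ?_⟩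
  simp

theorem red_eq {k : ℕ} {u v : List (Letter k)} (hu : FreeGroup.IsReduced u)
    (hv : FreeGroup.IsReduced v) (h : FreeGroup.mk u = FreeGroup.mk v) : u = v := by
  rw [← hu.reduce_eq, ← hv.reduce_eq]; exact FreeGroup.reduce.sound h

theorem invRev_cons {k : ℕ} (e : Letter k) (x : List (Letter k)) :
    FreeGroup.invRev (e :: x) = FreeGroup.invRev x ++ [linv e] := by
  simp [FreeGroup.invRev, linv]

theorem invRev_snoc {k : ℕ} (e : Letter k) (x : List (Letter k)) :
    FreeGroup.invRev (x ++ [e]) = linv e :: FreeGroup.invRev x := by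
  simp [FreeGroup.invRev, linv]

theorem red_invRev {k : ℕ} {u : List (Letter k)} (hu : FreeGroup.IsReduced u) :
    FreeGroup.IsReduced (FreeGroup.invRev u) := by
  rw [FreeGroup.isReduced_iff_reduce_eq, FreeGroup.reduce_invRev, hu.reduce_eq]

theorem red_cons_cons {k : ℕ} (x y : Letter k) (l : List (Letter k)) :
    FreeGroup.IsReduced (x :: y :: l) ↔ y ≠ linv x ∧ FreeGroup.IsReduced (y :: l) := by
  rw [FreeGroup.isReduced_cons_cons, rel_iff]

theorem red_glue {k : ℕ} {u v : List (Letter k)} {x y : Letter k}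
    (hu : FreeGroup.IsReduced (u ++ [x])) (hv : FreeGroup.IsReduced (y :: v)) (h : y ≠ linv x) :
    FreeGroup.IsReduced (u ++ [x] ++ y :: v) := by
  have h1 : FreeGroup.IsReduced ([x] ++ y :: v) := by
    simp only [List.singleton_append]; rw [red_cons_cons]; exact ⟨h, hv⟩
  exact FreeGroup.IsReduced.append_overlap hu h1 (by simp)

theorem red_mid {k : ℕ} {u v : List (Letter k)} {x y : Letter k}
    (h : FreeGroup.IsReduced (u ++ [x] ++ y :: v)) : y ≠ linv x := by
  have : FreeGroup.IsReduced [x, y] := h.infix ⟨u, v, by simp⟩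
  rw [red_cons_cons] at this; exact this.1

theorem conj_aux {k : ℕ} (u : List (Letter k)) (hu : FreeGroup.IsReduced (u ++ u))
    (x : List (Letter k)) : ∀ v : List (Letter k), FreeGroup.IsReduced x →
      FreeGroup.IsReduced (v ++ v) →
      FreeGroup.mk u = FreeGroup.mk x * FreeGroup.mk v * (FreeGroup.mk x)⁻¹ → u ~r v := by
  have hu1 : FreeGroup.IsReduced u := hu.infix ⟨[], u, by simp⟩
  induction x using List.reverseRecOn with
  | nil =>
    intro v _ hv h
    have hv1 : FreeGroup.IsReduced v := hv.infix ⟨[], v, by simp⟩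
    have h' : FreeGroup.mk u = FreeGroup.mk v := by
      rw [h, ← FreeGroup.one_eq_mk]; simp
    rw [red_eq hu1 hv1 h']
  | append_singleton y c ih =>
    intro v hx hv h
    have hv1 : FreeGroup.IsReduced v := hv.infix ⟨[], v, by simp⟩
    have hy : FreeGroup.IsReduced y := hx.infix ⟨[], [c], by simp⟩
    rcases List.eq_nil_or_concat v with hv0 | ⟨v', d, rfl⟩
    · subst hv0
      have h' : FreeGroup.mk u = FreeGroup.mk [] := by
        rw [h, ← FreeGroup.one_eq_mk, mul_one, mul_inv_cancel]
      rw [red_eq hu1 FreeGroup.IsReduced.nil h']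
    rw [← FreeGroup.mul_mk] at h
    rw [List.concat_eq_append] at *
    by_cases hdc : d = c
    · subst hdc
      have := ih (d :: v') hy (red_rot hv) (by
        rw [h, ← FreeGroup.mul_mk, mk_cons' d v']; group)
      refine this.trans ?_
      exact (List.isRotated_append (l := v') (l' := [d])).symm
    obtain ⟨e, t, het⟩ : ∃ e t, v' ++ [d] = e :: t := by
      cases v' with
      | nil => exact ⟨d, [], rfl⟩
      | cons e t => exact ⟨e, t ++ [d], rfl⟩
    by_cases hec : e = linv c
    · rw [het] at hv h ⊢
      have hv' : FreeGroup.IsReduced ((t ++ [e]) ++ (t ++ [e])) := by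
        apply red_rot (u := [e]) (v := t); simpa using hv
      have := ih (t ++ [e]) hy hv' (by
        rw [h, ← FreeGroup.mul_mk, mk_cons' e t, hec, mk_linv]
        group)
      refine this.trans ?_
      exact (List.isRotated_append (l := t) (l' := [e]))
    · exfalso
      have h1 : FreeGroup.IsReduced (y ++ [c] ++ (v' ++ [d])) := by
        rw [het]
        exact red_glue hx (het ▸ hv1) hec
      have h2 : FreeGroup.IsReduced ((y ++ [c] ++ v') ++ [d] ++ linv c :: FreeGroup.invRev y) := by
        apply red_glue
        · simpa using h1
        · rw [← invRev_snoc]; exact red_invRev hx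
        · intro hh; apply hdc; have := congrArg linv hh; rw [linv_linv, linv_linv] at this
          exact this.symm
      have h3 : u = (y ++ [c] ++ v') ++ [d] ++ linv c :: FreeGroup.invRev y := by
        apply red_eq hu1 h2
        rw [h, ← invRev_snoc]
        simp only [← FreeGroup.mul_mk, ← FreeGroup.inv_mk]
        group
      rw [← invRev_snoc] at h3
      obtain ⟨f, z, hfz⟩ : ∃ f z, y ++ [c] = f :: z := by
        cases y with
        | nil => exact ⟨c, [], rfl⟩
        | cons e t => exact ⟨e, t ++ [c], rfl⟩
      rw [hfz, invRev_cons] at h3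
      have h4 : u ++ u = (f :: z ++ v' ++ [d] ++ FreeGroup.invRev z) ++ [linv f] ++
          f :: (z ++ v' ++ [d] ++ FreeGroup.invRev z ++ [linv f]) := by
        rw [h3]; simp
      rw [h4] at hu
      exact red_mid hu (linv_linv f).symm

theorem conj_rot {k : ℕ} {u v : List (Letter k)} (hu : FreeGroup.IsReduced (u ++ u))
    (hv : FreeGroup.IsReduced (v ++ v)) (h : IsConj (FreeGroup.mk u) (FreeGroup.mk v)) : u ~r v := by
  obtain ⟨c, hc⟩ := isConj_iff.mp h.symm
  refine conj_aux u hu (FreeGroup.toWord c) v FreeGroup.isReduced_toWord hv ?_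
  rw [FreeGroup.mk_toWord]; exact hc.symm

def wcore {k : ℕ} (a y : Letter k) : List (Letter k) := if y = a ∨ y = linv a then [] else [y]

def wjn {k : ℕ} (a : Letter k) (χ : Letter k → Bool) (x y : Letter k) : List (Letter k) :=
  if χ (linv x) = χ y then [] else if χ (linv x) then [a] else [linv a]

def wLL {k : ℕ} (a : Letter k) (χ : Letter k → Bool) : List (Letter k) → List (Letter k)
  | [] => []
  | [_] => []
  | (y :: z :: r) => wcore a y ++ wjn a χ y z ++ wLL a χ (z :: r)

def gsum {k : ℕ} (g : Letter k → Letter k → ℤ) : List (Letter k) → ℤ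
  | [] => 0
  | [_] => 0
  | (y :: z :: r) => g y z + gsum g (z :: r)

def wg0 {k : ℕ} (a : Letter k) (χ : Letter k → Bool) (x y : Letter k) : ℤ :=
  ((wcore a x).length : ℤ) + (wjn a χ x y).length

theorem wLL_length {k : ℕ} (a : Letter k) (χ : Letter k → Bool) (w : List (Letter k)) :
    ((wLL a χ w).length : ℤ) = gsum (wg0 a χ) w := by
  induction w with
  | nil => simp [wLL, gsum]
  | cons y r ih =>
    cases r with
    | nil => simp [wLL, gsum]
    | cons z r => simp only [wLL, gsum, wg0, List.length_append]; push_cast; rw [ih]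

theorem wLL_append {k : ℕ} (a : Letter k) (χ : Letter k → Bool) (u : List (Letter k)) (z : Letter k)
    (v : List (Letter k)) : wLL a χ (u ++ z :: v) = wLL a χ (u ++ [z]) ++ wLL a χ (z :: v) := by
  induction u with
  | nil => simp [wLL]
  | cons y r ih =>
    cases r with
    | nil => simp [wLL]
    | cons z' r => 
      simp only [List.cons_append, wLL, List.append_assoc] at ih ⊢
      rw [ih]

def ws {k : ℕ} (a : Letter k) (χ : Letter k → Bool) (x : Letter k) : FG k :=
  if χ x then FreeGroup.mk [a] else 1

theorem wjn_mk {k : ℕ} (a : Letter k) (χ : Letter k → Bool) (x y : Letter k) :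
    FreeGroup.mk (wjn a χ x y) = ws a χ (linv x) * (ws a χ y)⁻¹ := by
  unfold wjn ws
  cases h1 : χ (linv x) <;> cases h2 : χ y <;>
    simp only [if_true, if_false, reduceCtorEq, Bool.false_eq_true, ← FreeGroup.one_eq_mk, mk_linv] <;> group

/-- data of a Whitehead automorphism -/
structure WData {k : ℕ} (τ : MulAut (FG k)) (a : Letter k) (χ : Letter k → Bool) : Prop where
  ha : χ a = false
  hb : χ (linv a) = true
  hτa : τ (FreeGroup.mk [a]) = FreeGroup.mk [a]
  hτ : ∀ x, x ≠ a → x ≠ linv a →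
    τ (FreeGroup.mk [x]) = (ws a χ x)⁻¹ * FreeGroup.mk [x] * ws a χ (linv x)

theorem wcore_mk {k : ℕ} {τ : MulAut (FG k)} {a : Letter k} {χ : Letter k → Bool}
    (W : WData τ a χ) (y : Letter k) :
    FreeGroup.mk (wcore a y) * ws a χ (linv y) = ws a χ y * τ (FreeGroup.mk [y]) := by
  by_cases h1 : y = a
  · subst h1
    simp [wcore, ws, W.ha, W.hb, W.hτa, ← FreeGroup.one_eq_mk]
  by_cases h2 : y = linv a
  · subst h2
    rw [mk_linv, map_inv, W.hτa]
    simp only [wcore, ws, linv_linv, W.ha, W.hb, ← FreeGroup.one_eq_mk, or_true, if_true, Bool.false_eq_true, if_false]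
    group
  rw [W.hτ y h1 h2]
  simp only [wcore, h1, h2, or_self, if_false]
  group

theorem wLL_mk {k : ℕ} {τ : MulAut (FG k)} {a : Letter k} {χ : Letter k → Bool}
    (W : WData τ a χ) (r : List (Letter k)) (z : Letter k) : ∀ y,
    FreeGroup.mk (wLL a χ (y :: r ++ [z])) * ws a χ z = ws a χ y * τ (FreeGroup.mk (y :: r)) := by
  induction r with
  | nil =>
    intro y
    simp only [List.cons_append, List.nil_append, wLL, List.append_nil]
    rw [← FreeGroup.mul_mk, wjn_mk, mul_assoc, mul_assoc, inv_mul_cancel, mul_one, wcore_mk W]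
  | cons x r ih =>
    intro y
    have := ih x
    simp only [List.cons_append, wLL] at this ⊢
    rw [← FreeGroup.mul_mk, ← FreeGroup.mul_mk, mul_assoc, this, wjn_mk, mk_cons' y, map_mul,
      ← mul_assoc (ws a χ y), ← wcore_mk W]
    group

theorem wLL_head {k : ℕ} {a : Letter k} {χ : Letter k → Bool} (ha : χ a = false)
    (hb : χ (linv a) = true) (r : List (Letter k)) : ∀ z, FreeGroup.IsReduced (z :: r) →
    ∀ h ∈ (wLL a χ (z :: r)).head?,
      (z = a → h = a ∨ (h ≠ a ∧ h ≠ linv a ∧ χ h = true)) ∧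
      (z = linv a → h = linv a ∨ (h ≠ a ∧ h ≠ linv a ∧ χ h = false)) ∧
      (z ≠ a → z ≠ linv a → h = z) := by
  induction r with
  | nil => intro z _ h hh; simp [wLL] at hh
  | cons x r ih =>
    intro z hred h hh
    rw [red_cons_cons] at hred
    have ih' := ih x hred.2 h
    have hne := linv_ne a
    have hll := linv_linv a
    simp only [wLL, wcore, wjn] at hh
    by_cases h1 : z = a
    · subst h1
      rw [hb] at hh
      cases hx : χ x <;> simp [hx] at hh
      · grind
      · have hxz : x ≠ z := by rintro rfl; simp [ha] at hx
        grind
    by_cases h2 : z = linv a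
    · subst h2
      rw [hll, ha] at hh
      cases hx : χ x <;> simp [hx] at hh
      · have hxz : x ≠ linv a := by rintro rfl; simp [hb] at hx
        grind
      · grind
    simp [h1, h2] at hh
    grind

theorem red_cons_iff {k : ℕ} (x : Letter k) (l : List (Letter k)) :
    FreeGroup.IsReduced (x :: l) ↔ (∀ h ∈ l.head?, h ≠ linv x) ∧ FreeGroup.IsReduced l := by
  cases l with
  | nil => simp
  | cons y l => rw [red_cons_cons]; simp

theorem wLL_red {k : ℕ} {a : Letter k} {χ : Letter k → Bool} (ha : χ a = false)
    (hb : χ (linv a) = true) (w : List (Letter k)) (hw : FreeGroup.IsReduced w) :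
    FreeGroup.IsReduced (wLL a χ w) := by
  induction w with
  | nil => simp [wLL]
  | cons z r ih =>
    cases r with
    | nil => simp [wLL]
    | cons x r =>
      rw [red_cons_cons] at hw
      have ih' := ih hw.2
      have hd := wLL_head ha hb r x hw.2
      have hne := linv_ne a
      have hll := linv_linv a
      have hzz := linv_linv z
      simp only [wLL, wcore, wjn]
      generalize wLL a χ (x :: r) = l at *
      by_cases h1 : z = a
      · subst h1
        rw [hb]
        cases hx : χ x
        · simp [red_cons_iff, ih']
          grind
        · simpa using ih'
      by_cases h2 : z = linv a
      · subst h2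
        rw [hll, ha]
        cases hx : χ x
        · simpa using ih'
        · simp [red_cons_iff, ih', hll]
          grind
      have h3 : a ≠ linv z := by grind
      have h4 : linv a ≠ linv z := by grind
      cases hx : χ x <;> cases hz : χ (linv z) <;> simp [h1, h2, red_cons_iff, ih', hll, h3, h4, -FreeGroup.isReduced_cons_cons] <;> grind

theorem W_cyclicLength {k : ℕ} {τ : MulAut (FG k)} {a : Letter k} {χ : Letter k → Bool}
    (W : WData τ a χ) (y : Letter k) (r : List (Letter k))
    (hw : FreeGroup.IsReduced ((y :: r) ++ (y :: r))) :
    (cyclicLength (τ (FreeGroup.mk (y :: r))) : ℤ) = gsum (wg0 a χ) (y :: r ++ [y]) := by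
  set Lc := wLL a χ (y :: r ++ [y]) with hLc
  have h1 : FreeGroup.IsReduced (Lc ++ Lc) := by
    have := wLL_red W.ha W.hb (((y :: r) ++ (y :: r)) ++ [y])
      ((red_triple hw).infix ⟨[], r, by simp⟩)
    rw [List.append_assoc, List.cons_append (as := r) (bs := [y]), wLL_append] at this
    exact this
  have h2 : FreeGroup.mk Lc = ws a χ y * τ (FreeGroup.mk (y :: r)) * (ws a χ y)⁻¹ := by
    rw [← wLL_mk W r y y, mul_inv_cancel_right]
  rw [← wLL_length, ← hLc]
  have hmem : cyclicLength (τ (FreeGroup.mk (y :: r))) ∈ {n | ∃ x u : FG k, IsCyclicallyReduced u ∧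
      τ (FreeGroup.mk (y :: r)) = x * u * x⁻¹ ∧ wordLength u = n} := by
    apply Nat.sInf_mem
    refine ⟨_, (ws a χ y)⁻¹, FreeGroup.mk Lc, ?_, ?_, rfl⟩
    · unfold IsCyclicallyReduced
      rw [isRed_iff, FreeGroup.toWord_mk, (h1.infix ⟨[], Lc, by simp⟩ : FreeGroup.IsReduced Lc).reduce_eq]
      exact h1
    · rw [h2]; group
  obtain ⟨x, u, hu, hxu, hn⟩ := hmem
  rw [← hn]
  unfold wordLength
  have : FreeGroup.toWord u ~r Lc := by
    apply conj_rot ((isRed_iff _).1 hu) h1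
    rw [FreeGroup.mk_toWord, h2, isConj_iff]
    exact ⟨ws a χ y * x, by rw [hxu]; group⟩
  rw [this.perm.length_eq]

theorem letter_cases {k : ℕ} {g : FG k} (h : g ∈ letterSet k) : ∃ x : Letter k, g = FreeGroup.mk [x] := by
  obtain ⟨i, h | h⟩ := h
  · exact ⟨(i, true), h⟩
  · exact ⟨(i, false), by rw [h]; rfl⟩

theorem letter_mem {k : ℕ} (x : Letter k) : FreeGroup.mk [x] ∈ letterSet k := by
  obtain ⟨i, b⟩ := x
  cases b
  · exact ⟨i, Or.inr rfl⟩
  · exact ⟨i, Or.inl rfl⟩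

theorem exists_WData {k : ℕ} (τ : MulAut (FG k)) (h : IsWhitehead2 τ) :
    ∃ a χ, WData τ a χ := by
  obtain ⟨g, hg, hτg, H⟩ := h
  obtain ⟨a, rfl⟩ := letter_cases hg
  have H' : ∀ i : Fin k, ∃ p q : Bool, τ (FreeGroup.mk [(i, true)]) =
      (if p then FreeGroup.mk [a] else 1)⁻¹ * FreeGroup.mk [(i, true)] *
      (if q then FreeGroup.mk [a] else 1) := by
    intro i
    rcases H _ (letter_mem (i, true)) with h | h | h | h
    · exact ⟨false, false, by simpa using h⟩
    · exact ⟨false, true, by rw [h]; simp⟩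
    · exact ⟨true, false, by rw [h]; simp⟩
    · exact ⟨true, true, by rw [h]; simp⟩
  choose p q hpq using H'
  refine ⟨a, fun x => if x = a then false else if x = linv a then true else
    if x.2 then p x.1 else q x.1, ?_, ?_, hτg, ?_⟩
  · simp
  · simp [linv_ne]
  · intro x h1 h2
    have h3 : linv x ≠ a := fun h => h2 (by rw [← h, linv_linv])
    have h4 : linv x ≠ linv a := fun h => h1 (by rw [← linv_linv x, h, linv_linv])
    simp only [ws, h1, h2, h3, h4, if_false]
    obtain ⟨i, b⟩ := x
    cases b
    · have : FreeGroup.mk [((i, false) : Letter k)] = (FreeGroup.mk [(i, true)])⁻¹ := rfl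
      rw [this, map_inv, hpq i]
      simp only [linv]
      simp only [Bool.not_false, if_true, Bool.false_eq_true, if_false]
      group
    · rw [hpq i]; simp [linv]

theorem aut_ext {k : ℕ} {σ τ : MulAut (FG k)}
    (h : ∀ i : Fin k, σ (FreeGroup.mk [(i, true)]) = τ (FreeGroup.mk [(i, true)])) : σ = τ := by
  have : σ.toMonoidHom = τ.toMonoidHom := FreeGroup.ext_hom _ _ (fun i => h i)
  ext x
  exact DFunLike.congr_fun this x

theorem WData_noninner {k : ℕ} {τ : MulAut (FG k)} {a : Letter k} {χ : Letter k → Bool}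
    (W : WData τ a χ) (hni : ¬ IsInner τ) :
    (∃ x, x ≠ linv a ∧ χ x = true) ∧ (∃ x, x ≠ a ∧ χ x = false) := by
  have hla : ∀ i : Fin k, (i, true) = linv a → τ (FreeGroup.mk [(i, true)]) = FreeGroup.mk [(i, true)] := by
    intro i h; rw [h, mk_linv, map_inv, W.hτa]
  constructor
  · by_contra! hc
    apply hni
    refine ⟨1, aut_ext fun i => ?_⟩
    rw [map_one, MulAut.one_apply]
    by_cases h1 : (i, true) = a
    · rw [h1, W.hτa]
    by_cases h2 : (i, true) = linv a
    · exact hla i h2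
    rw [W.hτ _ h1 h2]
    have e1 := hc _ h2
    have e2 := hc (linv (i, true)) (fun h => h1 (by rw [← linv_linv (i, true), h, linv_linv]))
    simp only [ne_eq, Bool.not_eq_true] at e1 e2
    simp [ws, e1, e2]
  · by_contra! hc
    apply hni
    refine ⟨(FreeGroup.mk [a])⁻¹, aut_ext fun i => ?_⟩
    rw [MulAut.conj_apply]
    by_cases h1 : (i, true) = a
    · rw [h1, W.hτa]; group
    by_cases h2 : (i, true) = linv a
    · rw [hla i h2, h2, mk_linv]; group
    rw [W.hτ _ h1 h2]
    have e1 := hc _ h1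
    have e2 := hc (linv (i, true)) (fun h => h2 (by rw [← h, linv_linv]))
    simp only [ne_eq, Bool.not_eq_false] at e1 e2
    simp [ws, e1, e2]

def wh {k : ℕ} (a x : Letter k) : ℤ :=
  (2 * k - 1) * (if x = a ∨ x = linv a then 1 else 0) + (if x = linv a then 1 else 0)

def wg1 {k : ℕ} (a : Letter k) (χ : Letter k → Bool) (x y : Letter k) : ℤ :=
  2 * k * (wg0 a χ x y - 1) + wh a x - wh a y

theorem gsum_wg1 {k : ℕ} (a : Letter k) (χ : Letter k → Bool) (z : Letter k) (r : List (Letter k)) :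
    ∀ y, gsum (wg1 a χ) (y :: r ++ [z]) =
      2 * k * (gsum (wg0 a χ) (y :: r ++ [z]) - (r.length + 1)) + wh a y - wh a z := by
  induction r with
  | nil => intro y; simp [gsum, wg1]
  | cons x r ih =>
    intro y
    have := ih x
    simp only [List.cons_append, gsum] at this ⊢
    rw [this, wg1]
    push_cast [List.length_cons]
    ring

def WCond {k : ℕ} (a : Letter k) (χ : Letter k → Bool) : Prop :=
  χ a = false ∧ χ (linv a) = true ∧ (∃ x, x ≠ linv a ∧ χ x = true) ∧ (∃ x, x ≠ a ∧ χ x = false)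

def BadW {k : ℕ} (a : Letter k) (χ : Letter k → Bool) : Set (List (Letter k)) :=
  {w | ∃ y r, w = y :: r ∧ FreeGroup.IsReduced (w ++ w) ∧ gsum (wg1 a χ) (y :: r ++ [y]) ≤ 0}

def PerW (k : ℕ) : Set (List (Letter k)) :=
  {w | FreeGroup.IsReduced w ∧ (w = [] ∨ ∃ π : Equiv.Perm (Letter k), ∃ r, 0 < r ∧ r < w.length ∧
    w.map π = w.rotate r)}

def MissW {k : ℕ} (x : Letter k) : Set (List (Letter k)) := {w | x ∉ w ∧ linv x ∉ w}

def BadAll (k : ℕ) : Set (List (Letter k)) :=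
  (⋃ p : {p : Letter k × (Letter k → Bool) // WCond p.1 p.2}, BadW p.1.1 p.1.2) ∪
    (PerW k ∪ ⋃ x : Letter k, MissW x)

theorem notSM_bad {k : ℕ} (hk : 2 ≤ k) {g : FG k} (hg : IsCyclicallyReduced g) (h : g ∉ SM k) :
    FreeGroup.toWord g ∈ BadAll k := by
  simp only [SM, Set.mem_ofPred_eq, hg, true_and, not_forall] at h
  obtain ⟨τ, hτ, hni, hlt⟩ := h
  obtain ⟨a, χ, W⟩ := exists_WData τ hτ
  have hr := (isRed_iff _).1 hg
  cases hw : FreeGroup.toWord g with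
  | nil => right; left; exact ⟨by simp, Or.inl rfl⟩
  | cons y r =>
    left
    rw [Set.mem_iUnion]
    refine ⟨⟨(a, χ), W.ha, W.hb, WData_noninner W hni⟩, y, r, rfl, by rw [← hw]; exact hr, ?_⟩
    rw [hw] at hr
    have h1 := W_cyclicLength W y r hr
    rw [← hw, FreeGroup.mk_toWord] at h1
    rw [gsum_wg1]
    rw [hw] at h1
    rw [← h1]
    unfold wordLength at hlt
    rw [hw] at hlt
    simp only [List.length_cons, not_lt] at hlt
    have : (cyclicLength (τ g) : ℤ) ≤ r.length + 1 := by exact_mod_cast hlt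
    have : 2 * (k:ℤ) * (cyclicLength (τ g) - (r.length + 1)) ≤ 0 := by
      apply mul_nonpos_of_nonneg_of_nonpos <;> [positivity; linarith]
    linarith

theorem rot_per {k : ℕ} {w : List (Letter k)} (hw : FreeGroup.IsReduced w) (π : Equiv.Perm (Letter k))
    (h : w.map π ~r w) : w ∈ PerW k ∨ w.map π = w := by
  obtain ⟨n, hn⟩ := h.symm
  by_cases h0 : w = []
  · left; exact ⟨hw, Or.inl h0⟩
  have hl : 0 < w.length := List.length_pos_iff.2 h0
  rw [← List.rotate_mod] at hn
  rcases Nat.eq_zero_or_pos (n % w.length) with h1 | h1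
  · right; rw [h1, List.rotate_zero] at hn; exact hn.symm
  · left; exact ⟨hw, Or.inr ⟨π, _, h1, Nat.mod_lt _ hl, hn.symm⟩⟩

theorem flat_rot {α : Type*} (m : ℕ) (v : List α) :
    (List.replicate m v).flatten.rotate v.length = (List.replicate m v).flatten := by
  cases m with
  | zero => simp
  | succ m =>
    rw [List.replicate_succ, List.flatten_cons, List.rotate_append_length_eq]
    rw [← List.flatten_concat, ← List.replicate_succ', List.replicate_succ, List.flatten_cons]

theorem cyc_iff' {k : ℕ} (L : List (Letter k)) (h : FreeGroup.IsCyclicallyReduced L) :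
    FreeGroup.IsReduced (L ++ L) := by
  have := (h.flatten_replicate 2).isReduced
  simpa [List.replicate_succ] using this

theorem power_bad {k : ℕ} {g : FG k} (hg : IsCyclicallyReduced g) (h : IsProperPower g) :
    FreeGroup.toWord g ∈ PerW k := by
  obtain ⟨u, m, hm, rfl⟩ := h
  by_cases h0 : FreeGroup.toWord (u ^ m) = []
  · exact ⟨FreeGroup.isReduced_toWord, Or.inl h0⟩
  set c := FreeGroup.reduceCyclically.conjugator u.toWord
  set v := FreeGroup.reduceCyclically u.toWord with hv
  have hvc : FreeGroup.IsCyclicallyReduced v :=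
    FreeGroup.reduceCyclically.isCyclicallyReduced FreeGroup.isReduced_toWord
  have hw : FreeGroup.toWord (u ^ m) = c ++ (List.replicate m v).flatten ++ FreeGroup.invRev c := by
    rw [FreeGroup.toWord_pow, FreeGroup.reduceCyclically.reduce_flatten_replicate
      FreeGroup.isReduced_toWord, if_neg (by omega)]
  set V := (List.replicate m v).flatten with hV
  have hrot : FreeGroup.toWord (u ^ m) ~r V := by
    apply conj_rot ((isRed_iff _).1 hg) (cyc_iff' _ (hvc.flatten_replicate m))
    rw [hw, ← FreeGroup.mul_mk, ← FreeGroup.mul_mk, ← FreeGroup.inv_mk]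
    rw [isConj_iff]
    exact ⟨(FreeGroup.mk c)⁻¹, by rw [← hV]; group⟩
  have hlen := hrot.perm.length_eq
  have hVl : V.length = m * v.length := by simp [hV]
  have hv0 : 0 < v.length := by
    rcases Nat.eq_zero_or_pos v.length with h | h
    · rw [h, mul_zero] at hVl; rw [hVl] at hlen; exact absurd (List.length_eq_zero_iff.1 hlen) h0
    · exact h
  refine ⟨FreeGroup.isReduced_toWord, Or.inr ⟨1, v.length, hv0, ?_, ?_⟩⟩
  · rw [hlen, hVl]; nlinarith
  · obtain ⟨j, hj⟩ := hrot.symm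
    rw [← hj, List.rotate_rotate, add_comm, ← List.rotate_rotate, flat_rot]
    simp [hV]

theorem mk_single_inj {k : ℕ} {x y : Letter k} (h : FreeGroup.mk [x] = FreeGroup.mk [y]) : x = y := by
  have := red_eq FreeGroup.IsReduced.singleton FreeGroup.IsReduced.singleton h
  simpa using this

theorem relabel_bad {k : ℕ} {g : FG k} (hg : IsCyclicallyReduced g) (τ : MulAut (FG k))
    (hτ : IsRelabeling τ) (h1 : τ ≠ 1) (hc : IsConj (τ g) g) :
    FreeGroup.toWord g ∈ PerW k ∪ ⋃ x : Letter k, MissW x := by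
  have H : ∀ x : Letter k, ∃ y, τ (FreeGroup.mk [x]) = FreeGroup.mk [y] := by
    intro x
    apply letter_cases
    rw [← hτ]
    exact ⟨_, letter_mem x, rfl⟩
  choose f hf using H
  have hinj : Function.Injective f := by
    intro x y hxy
    apply mk_single_inj
    apply τ.injective
    rw [hf, hf, hxy]
  let π : Equiv.Perm (Letter k) := Equiv.ofBijective f (Finite.injective_iff_bijective.1 hinj)
  have hπ : ∀ x, π x = f x := fun x => rfl
  have hlin : ∀ x, f (linv x) = linv (f x) := by
    intro x
    apply mk_single_inj
    rw [← hf, mk_linv, map_inv, hf, mk_linv]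
  have hmap : ∀ l : List (Letter k), τ (FreeGroup.mk l) = FreeGroup.mk (l.map π) := by
    intro l
    induction l with
    | nil => rw [List.map_nil, ← FreeGroup.one_eq_mk, map_one]
    | cons x l ih => rw [mk_cons', map_mul, ih, hf, List.map_cons, mk_cons' (π x), hπ]
  have hred : ∀ l : List (Letter k), FreeGroup.IsReduced l → FreeGroup.IsReduced (l.map π) := by
    intro l
    induction l with
    | nil => simp
    | cons x l ih =>
      cases l with
      | nil => simp
      | cons y l =>
        intro h
        rw [red_cons_cons] at h
        have := ih h.2
        simp only [List.map_cons] at this ⊢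
        rw [red_cons_cons]
        refine ⟨?_, this⟩
        rw [hπ, hπ, ← hlin]
        exact fun h' => h.1 (hinj h')
  have hr := (isRed_iff _).1 hg
  have hrot : (FreeGroup.toWord g).map π ~r FreeGroup.toWord g := by
    apply conj_rot _ hr
    · rw [← hmap, FreeGroup.mk_toWord]; exact hc
    · rw [← List.map_append]; exact hred _ hr
  rcases rot_per FreeGroup.isReduced_toWord π hrot with h | h
  · left; exact h
  · right
    have : ∃ x, f x ≠ x := by
      by_contra! hall
      apply h1
      apply aut_ext
      intro i
      rw [hf, hall]; rfl
    obtain ⟨x, hx⟩ := this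
    rw [Set.mem_iUnion]
    have key : ∀ y ∈ FreeGroup.toWord g, f y = y := by
      intro y hy
      have h' : (FreeGroup.toWord g).map π = (FreeGroup.toWord g).map id := by rw [h, List.map_id]
      exact (List.map_inj_left.1 h') y hy
    refine ⟨x, fun hm => hx (key x hm), fun hm => hx ?_⟩
    have := key _ hm
    rw [hlin] at this
    rw [← linv_linv (f x), this, linv_linv]

theorem notTS_bad {k : ℕ} (hk : 2 ≤ k) {g : FG k} (hg : g ∈ Cset k) (h : g ∉ TS k) :
    FreeGroup.toWord g ∈ BadAll k := by
  by_cases h1 : g ∈ SM k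
  · by_cases h2 : IsProperPower g
    · exact Or.inr (Or.inl (power_bad hg h2))
    · simp only [TS, Set.mem_ofPred_eq, h1, h2, not_false_eq_true, true_and, not_forall, not_not] at h
      obtain ⟨τ, hτ, hne, hc⟩ := h
      exact Or.inr (relabel_bad hg τ hτ hne hc)
  · exact notSM_bad hk hg h1

theorem card_letter (k : ℕ) : Fintype.card (Letter k) = 2 * k := by
  simp [mul_comm]

theorem jn_sum {k : ℕ} {a : Letter k} {χ : Letter k → Bool} (h : WCond a χ) (x : Letter k) :
    (2 : ℤ) ≤ ∑ y ∈ Finset.univ.erase (linv x), ((wjn a χ x y).length : ℤ) := by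
  obtain ⟨ha, hb, ⟨x1, h1, h1'⟩, ⟨x2, h2, h2'⟩⟩ := h
  have key : ∀ u v : Letter k, u ≠ v → χ u ≠ χ (linv x) → χ v ≠ χ (linv x) →
      (2 : ℤ) ≤ ∑ y ∈ Finset.univ.erase (linv x), ((wjn a χ x y).length : ℤ) := by
    intro u v huv hu hv
    have hsub : ({u, v} : Finset (Letter k)) ⊆ Finset.univ.erase (linv x) := by
      intro z hz
      simp only [Finset.mem_insert, Finset.mem_singleton] at hz
      rw [Finset.mem_erase]
      refine ⟨?_, Finset.mem_univ _⟩
      rintro rfl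
      rcases hz with rfl | rfl <;> simp_all
    have h3 : ∀ z, χ z ≠ χ (linv x) → (wjn a χ x z).length = 1 := by
      intro z hz
      unfold wjn
      rw [if_neg (Ne.symm hz)]
      split <;> simp
    calc (2:ℤ) = ∑ y ∈ ({u, v} : Finset (Letter k)), ((wjn a χ x y).length : ℤ) := by
          rw [Finset.sum_pair huv, h3 u hu, h3 v hv]; norm_num
      _ ≤ _ := Finset.sum_le_sum_of_subset_of_nonneg hsub (by intros; positivity)
  cases hx : χ (linv x)
  · exact key (linv a) x1 (Ne.symm h1) (by rw [hb, hx]; simp) (by rw [h1', hx]; simp)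
  · exact key a x2 (Ne.symm h2) (by rw [ha, hx]; simp) (by rw [h2', hx]; simp)

theorem wh_sum {k : ℕ} (a : Letter k) : ∑ y : Letter k, wh a y = 4 * k - 1 := by
  have hne := linv_ne a
  unfold wh
  rw [Finset.sum_add_distrib, ← Finset.mul_sum]
  have h1 : ∑ y : Letter k, (if y = a ∨ y = linv a then (1:ℤ) else 0) = 2 := by
    rw [Finset.sum_boole]
    have : (Finset.univ.filter (fun y : Letter k => y = a ∨ y = linv a)) = {a, linv a} := by
      ext; simp
    rw [this, Finset.card_pair (Ne.symm hne)]; norm_num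
  rw [h1, Finset.sum_ite_eq' ]
  simp; ring

theorem drift {k : ℕ} (hk : 2 ≤ k) {a : Letter k} {χ : Letter k → Bool} (h : WCond a χ) (x : Letter k) :
    (1 : ℤ) ≤ ∑ y ∈ Finset.univ.erase (linv x), wg1 a χ x y := by
  have hJ := jn_sum h x
  have hH := wh_sum a
  have hH' := Finset.sum_erase_eq_sub (f := wh a) (Finset.mem_univ (linv x))
  rw [hH] at hH'
  have hcard : ((Finset.univ.erase (linv x)).card : ℤ) = 2 * k - 1 := by
    rw [Finset.card_erase_of_mem (Finset.mem_univ _), Finset.card_univ, card_letter]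
    push_cast [Nat.cast_sub (show 1 ≤ 2 * k by omega)]; ring
  have e : ∑ y ∈ Finset.univ.erase (linv x), wg1 a χ x y =
      (2 * k - 1) * (2 * k * ((wcore a x).length - 1) + wh a x) +
      2 * k * ∑ y ∈ Finset.univ.erase (linv x), ((wjn a χ x y).length : ℤ)
      - ∑ y ∈ Finset.univ.erase (linv x), wh a y := by
    rw [← hcard, Finset.mul_sum, ← nsmul_eq_mul, ← Finset.sum_const, ← Finset.sum_add_distrib,
      ← Finset.sum_sub_distrib]
    apply Finset.sum_congr rfl
    intro y _
    unfold wg1 wg0; ring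
  rw [e, hH']
  have hk' : (2:ℤ) ≤ k := by exact_mod_cast hk
  set J := ∑ y ∈ Finset.univ.erase (linv x), ((wjn a χ x y).length : ℤ)
  have hJ' : 2 * (k:ℤ) * 2 ≤ 2 * k * J := by
    apply mul_le_mul_of_nonneg_left hJ; positivity
  have hne := linv_ne a
  have hll := linv_linv a
  by_cases h1 : x = a
  · subst h1
    simp [wcore, wh, Ne.symm hne]
    nlinarith
  by_cases h2 : x = linv a
  · subst h2
    simp [wcore, wh, hll, hne, Ne.symm hne]
    nlinarith
  have h3 : linv x ≠ a := fun h => h2 (by rw [← h, linv_linv])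
  have h4 : linv x ≠ linv a := fun h => h1 (by rw [← linv_linv x, h, linv_linv])
  simp [wcore, wh, h1, h2, h3, h4]
  nlinarith

theorem wg1_bound {k : ℕ} (hk : 2 ≤ k) (a : Letter k) (χ : Letter k → Bool) (x y : Letter k) :
    |wg1 a χ x y| ≤ 5 * k := by
  have hk' : (2:ℤ) ≤ k := by exact_mod_cast hk
  have hc : (wcore a x).length = if x = a ∨ x = linv a then 0 else 1 := by
    unfold wcore; split <;> simp
  have hj : (wjn a χ x y).length = 0 ∨ (wjn a χ x y).length = 1 := by
    unfold wjn; split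
    · simp
    · split <;> simp
  have hne := linv_ne a
  rw [abs_le]
  unfold wg1 wg0 wh
  rw [hc]
  rcases hj with hj | hj <;> rw [hj] <;> constructor <;> split_ifs <;> push_cast <;>
    linarith

noncomputable def wlam (k : ℕ) : ℝ := 2 * k - 1 - 1 / (200 * (k:ℝ) ^ 3)
noncomputable def wt (k : ℕ) : ℝ := 1 / (100 * (k:ℝ) ^ 3)

theorem row_bound {k : ℕ} (hk : 2 ≤ k) {a : Letter k} {χ : Letter k → Bool} (h : WCond a χ) (x : Letter k) :
    ∑ y ∈ Finset.univ.erase (linv x), Real.exp (-(wt k) * (wg1 a χ x y : ℝ)) ≤ wlam k := by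
  have hk' : (2:ℝ) ≤ k := by exact_mod_cast hk
  have hcard : ((Finset.univ.erase (linv x)).card : ℝ) = 2 * k - 1 := by
    rw [Finset.card_erase_of_mem (Finset.mem_univ _), Finset.card_univ, card_letter]
    push_cast [Nat.cast_sub (show 1 ≤ 2 * k by omega)]; ring
  have ht : 0 < wt k := by unfold wt; positivity
  have htk : wt k * (100 * (k:ℝ)^3) = 1 := by unfold wt; field_simp
  have hlam : wlam k = 2 * k - 1 - wt k / 2 := by unfold wlam wt; field_simp; ring
  have hk2 : (4:ℝ) ≤ (k:ℝ)^2 := by nlinarith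
  have b1 : ∀ y, Real.exp (-(wt k) * (wg1 a χ x y : ℝ)) ≤
      1 - wt k * (wg1 a χ x y : ℝ) + (wt k)^2 * (25 * (k:ℝ)^2) := by
    intro y
    have hb : |(wg1 a χ x y : ℝ)| ≤ 5 * k := by exact_mod_cast wg1_bound hk a χ x y
    set G := (wg1 a χ x y : ℝ)
    have h1 : |-(wt k) * G| ≤ 1 := by
      rw [abs_mul, abs_neg, abs_of_pos ht]
      calc wt k * |G| ≤ wt k * (5 * k) := by gcongr
        _ ≤ wt k * (100 * (k:ℝ)^3) := by
          apply mul_le_mul_of_nonneg_left _ ht.le; nlinarith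
        _ = 1 := htk
    have h2 := (abs_le.1 (Real.abs_exp_sub_one_sub_id_le h1)).2
    have h3 : G ^ 2 ≤ 25 * (k:ℝ)^2 := by
      rw [← sq_abs]; calc |G|^2 ≤ (5 * k)^2 := by gcongr
        _ = _ := by ring
    have h4 : (-(wt k) * G)^2 ≤ (wt k)^2 * (25 * (k:ℝ)^2) := by
      rw [mul_pow, neg_sq]; gcongr
    linarith
  have hd : (1:ℝ) ≤ ∑ y ∈ Finset.univ.erase (linv x), (wg1 a χ x y : ℝ) := by
    exact_mod_cast drift hk h x
  calc _ ≤ ∑ y ∈ Finset.univ.erase (linv x), (1 - wt k * (wg1 a χ x y : ℝ) + (wt k)^2 * (25 * (k:ℝ)^2)) :=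
        Finset.sum_le_sum (fun y _ => b1 y)
    _ = (2 * k - 1) * (1 + (wt k)^2 * (25 * (k:ℝ)^2)) -
        wt k * ∑ y ∈ Finset.univ.erase (linv x), (wg1 a χ x y : ℝ) := by
        rw [← hcard, ← nsmul_eq_mul, ← Finset.sum_const, Finset.mul_sum, ← Finset.sum_sub_distrib]
        apply Finset.sum_congr rfl; intros; ring
    _ ≤ (2 * k - 1) * (1 + (wt k)^2 * (25 * (k:ℝ)^2)) - wt k * 1 := by gcongr
    _ ≤ wlam k := by
        rw [hlam]
        have : wt k * (wt k * (100 * (k:ℝ)^3)) = wt k := by rw [htk, mul_one]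
        have h5 : 0 ≤ (wt k)^2 * (25 * (k:ℝ)^2) := by positivity
        nlinarith

def wf {k : ℕ} : ℕ → Letter k → Finset (List (Letter k))
  | 0, x => {[x]}
  | n + 1, x => (Finset.univ.erase (linv x)).biUnion fun y => (wf n y).image (List.cons x)

theorem mem_wf {k : ℕ} (n : ℕ) : ∀ (x : Letter k) (w : List (Letter k)), w ∈ wf n x ↔
    ∃ r, w = x :: r ∧ r.length = n ∧ FreeGroup.IsReduced w := by
  induction n with
  | zero =>
    intro x w
    simp only [wf, Finset.mem_singleton]
    constructor
    · rintro rfl; exact ⟨[], rfl, rfl, by simp⟩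
    · rintro ⟨r, rfl, hr, _⟩; rw [List.length_eq_zero_iff.1 hr]
  | succ n ih =>
    intro x w
    simp only [wf, Finset.mem_biUnion, Finset.mem_image, Finset.mem_erase, Finset.mem_univ, and_true]
    constructor
    · rintro ⟨y, hy, v, hv, rfl⟩
      obtain ⟨r, rfl, hr, hred⟩ := (ih y v).1 hv
      exact ⟨y :: r, rfl, by simp [hr], (red_cons_cons _ _ _).2 ⟨hy, hred⟩⟩
    · rintro ⟨r, rfl, hr, hred⟩
      cases r with
      | nil => simp at hr
      | cons y r =>
        rw [red_cons_cons] at hred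
        exact ⟨y, hred.1, y :: r, (ih y _).2 ⟨r, rfl, by simpa using hr, hred.2⟩, rfl⟩

theorem wf_sum_succ {k : ℕ} (n : ℕ) (x : Letter k) (f : List (Letter k) → ℝ) :
    ∑ w ∈ wf (n + 1) x, f w = ∑ y ∈ Finset.univ.erase (linv x), ∑ v ∈ wf n y, f (x :: v) := by
  simp only [wf]
  rw [Finset.sum_biUnion]
  · apply Finset.sum_congr rfl
    intro y _
    rw [Finset.sum_image]
    intro u _ v _ h
    simpa using h
  · intro y _ z _ hyz
    simp only [Function.onFun]
    rw [Finset.disjoint_left]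
    intro w h1 h2
    obtain ⟨u, hu, rfl⟩ := Finset.mem_image.1 h1
    obtain ⟨v, hv, h⟩ := Finset.mem_image.1 h2
    obtain ⟨r, rfl, _⟩ := (mem_wf n y u).1 hu
    obtain ⟨r', rfl, _⟩ := (mem_wf n z v).1 hv
    simp at h
    exact hyz h.1.symm

theorem wf_sum_bound {k : ℕ} (g : Letter k → Letter k → ℤ) (t lam : ℝ)
    (h : ∀ x, ∑ y ∈ Finset.univ.erase (linv x), Real.exp (-t * (g x y : ℝ)) ≤ lam) (hl : 0 ≤ lam)
    (n : ℕ) : ∀ x, ∑ w ∈ wf n x, Real.exp (-t * (gsum g w : ℝ)) ≤ lam ^ n := by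
  induction n with
  | zero => intro x; simp [wf, gsum]
  | succ n ih =>
    intro x
    rw [wf_sum_succ, pow_succ']
    calc _ = ∑ y ∈ Finset.univ.erase (linv x), Real.exp (-t * (g x y : ℝ)) *
            ∑ v ∈ wf n y, Real.exp (-t * (gsum g v : ℝ)) := by
          apply Finset.sum_congr rfl
          intro y _
          rw [Finset.mul_sum]
          apply Finset.sum_congr rfl
          intro v hv
          obtain ⟨r, rfl, _⟩ := (mem_wf n y v).1 hv
          rw [← Real.exp_add]
          simp only [gsum]
          push_cast
          ring_nf
      _ ≤ ∑ y ∈ Finset.univ.erase (linv x), Real.exp (-t * (g x y : ℝ)) * lam ^ n := by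
          apply Finset.sum_le_sum
          intro y _
          exact mul_le_mul_of_nonneg_left (ih y) (Real.exp_pos _).le
      _ = (∑ y ∈ Finset.univ.erase (linv x), Real.exp (-t * (g x y : ℝ))) * lam ^ n := by
          rw [Finset.sum_mul]
      _ ≤ _ := mul_le_mul_of_nonneg_right (h x) (by positivity)

theorem card_erase_letter {k : ℕ} (hk : 2 ≤ k) (x : Letter k) :
    (Finset.univ.erase x).card = 2 * k - 1 := by
  rw [Finset.card_erase_of_mem (Finset.mem_univ _), Finset.card_univ, card_letter]

theorem card_wf {k : ℕ} (hk : 2 ≤ k) (n : ℕ) : ∀ x : Letter k, ((wf n x).card : ℝ) = (2 * k - 1 : ℝ) ^ n := by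
  induction n with
  | zero => intro x; simp [wf]
  | succ n ih =>
    intro x
    have := wf_sum_succ n x (fun _ => 1)
    simp only [Finset.sum_const, nsmul_eq_mul, mul_one] at this
    rw [this, Finset.sum_congr rfl (fun y _ => ih y), Finset.sum_const, card_erase_letter hk,
      nsmul_eq_mul, pow_succ']
    push_cast [Nat.cast_sub (show 1 ≤ 2 * k by omega)]; ring

/-- reduced words of length n as a set -/
def RedN (k n : ℕ) : Set (List (Letter k)) := {w | FreeGroup.IsReduced w ∧ w.length = n}

theorem RedN_finite (k n : ℕ) : (RedN k n).Finite :=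
  (List.finite_length_eq (Letter k) n).subset (fun _ h => h.2)

theorem RedN_card_le {k : ℕ} (hk : 2 ≤ k) (n : ℕ) : ((RedN k n).ncard : ℝ) ≤ 2 * k * (2 * k - 1 : ℝ) ^ n := by
  have hk' : (2:ℝ) ≤ k := by exact_mod_cast hk
  cases n with
  | zero =>
    have : RedN k 0 ⊆ {[]} := by
      rintro w ⟨_, h⟩; simpa using h
    have h1 := Set.ncard_le_ncard this (by simp)
    rw [Set.ncard_singleton] at h1
    have : ((RedN k 0).ncard : ℝ) ≤ 1 := by exact_mod_cast h1
    rw [pow_zero]; linarith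
  | succ n =>
    have hsub : RedN k (n+1) ⊆ ((Finset.univ.biUnion (fun x : Letter k => wf n x) : Finset (List (Letter k))) : Set (List (Letter k))) := by
      rintro w ⟨h1, h2⟩
      cases w with
      | nil => simp at h2
      | cons x r =>
        rw [Finset.mem_coe, Finset.mem_biUnion]
        exact ⟨x, Finset.mem_univ _, (mem_wf n x _).2 ⟨r, rfl, by simpa using h2, h1⟩⟩
    have h1 := Set.ncard_le_ncard hsub (Finset.finite_toSet _)
    rw [Set.ncard_coe_finset] at h1
    have h2 := h1.trans Finset.card_biUnion_le
    have h3 : ((RedN k (n+1)).ncard : ℝ) ≤ ∑ x : Letter k, ((wf n x).card : ℝ) := by exact_mod_cast h2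
    rw [Finset.sum_congr rfl (fun y _ => card_wf hk n y), Finset.sum_const, Finset.card_univ, card_letter,
      nsmul_eq_mul] at h3
    push_cast at h3
    refine h3.trans ?_
    gcongr
    · linarith
    · omega

noncomputable def cntL {k : ℕ} (B : Set (List (Letter k))) (n : ℕ) : ℕ := {w ∈ B | w.length = n}.ncard

theorem cntL_fin {k : ℕ} (B : Set (List (Letter k))) (n : ℕ) : {w ∈ B | w.length = n}.Finite :=
  (List.finite_length_eq (Letter k) n).subset (fun _ h => h.2)

def NegL {k : ℕ} (B : Set (List (Letter k))) : Prop :=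
  ∃ K lam : ℝ, 0 ≤ K ∧ 0 ≤ lam ∧ lam < 2 * k - 1 ∧ ∀ n, (cntL B n : ℝ) ≤ K * lam ^ n

theorem cntL_mono {k : ℕ} {A B : Set (List (Letter k))} (h : A ⊆ B) (n : ℕ) : cntL A n ≤ cntL B n :=
  Set.ncard_le_ncard (fun _ hw => ⟨h hw.1, hw.2⟩) (cntL_fin B n)

theorem NegL.mono {k : ℕ} {A B : Set (List (Letter k))} (h : A ⊆ B) (hB : NegL B) : NegL A := by
  obtain ⟨K, l, h1, h2, h3, h4⟩ := hB
  exact ⟨K, l, h1, h2, h3, fun n => le_trans (by exact_mod_cast cntL_mono h n) (h4 n)⟩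

theorem NegL.union {k : ℕ} {A B : Set (List (Letter k))} (hA : NegL A) (hB : NegL B) : NegL (A ∪ B) := by
  obtain ⟨K, l, h1, h2, h3, h4⟩ := hA
  obtain ⟨K', l', h1', h2', h3', h4'⟩ := hB
  refine ⟨K + K', max l l', by positivity, le_max_of_le_left h2, max_lt h3 h3', fun n => ?_⟩
  have e : {w ∈ A ∪ B | w.length = n} = {w ∈ A | w.length = n} ∪ {w ∈ B | w.length = n} := by
    ext w; simp only [Set.mem_union, Set.mem_ofPred_eq]; tauto
  have : (cntL (A ∪ B) n : ℝ) ≤ cntL A n + cntL B n := by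
    unfold cntL; rw [e]; exact_mod_cast Set.ncard_union_le _ _
  have i1 : K * l ^ n ≤ K * (max l l') ^ n := by gcongr; exact le_max_left _ _
  have i2 : K' * l' ^ n ≤ K' * (max l l') ^ n := by gcongr; exact le_max_right _ _
  linarith [h4 n, h4' n]

theorem NegL.empty {k : ℕ} (hk : 2 ≤ k) : NegL (∅ : Set (List (Letter k))) := by
  have hk' : (2:ℝ) ≤ k := by exact_mod_cast hk
  exact ⟨0, 0, le_rfl, le_rfl, by linarith, fun n => by simp [cntL]⟩

theorem NegL.iUnion {k : ℕ} (hk : 2 ≤ k) {ι : Type*} [Finite ι] {B : ι → Set (List (Letter k))}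
    (h : ∀ i, NegL (B i)) : NegL (⋃ i, B i) := by
  have := Fintype.ofFinite ι
  have key : ∀ s : Finset ι, NegL (⋃ i ∈ s, B i) := by
    classical
    intro s
    induction s using Finset.induction_on with
    | empty => simpa using NegL.empty hk
    | insert a s _ ih => rw [Finset.set_biUnion_insert]; exact (h a).union ih
  simpa using key Finset.univ

theorem BadW_neg {k : ℕ} (hk : 2 ≤ k) {a : Letter k} {χ : Letter k → Bool} (h : WCond a χ) :
    NegL (BadW a χ) := by
  have hk' : (2:ℝ) ≤ k := by exact_mod_cast hk
  have hl : 0 ≤ wlam k := by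
    refine le_trans ?_ (row_bound hk h a)
    exact Finset.sum_nonneg (fun _ _ => (Real.exp_pos _).le)
  have ht : 0 < wt k := by unfold wt; positivity
  refine ⟨2 * k, wlam k, by positivity, hl, ?_, fun n => ?_⟩
  · unfold wlam
    have : 0 < 1 / (200 * (k:ℝ)^3) := by positivity
    linarith
  classical
  set T : Finset (List (Letter k)) := Finset.univ.biUnion
    (fun x : Letter k => (wf n x).filter (fun w => gsum (wg1 a χ) w ≤ 0)) with hT
  have h1 : cntL (BadW a χ) n ≤ T.card := by
    rw [← Set.ncard_coe_finset]
    apply Set.ncard_le_ncard_of_injOn (fun w => w ++ w.take 1)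
    · rintro w ⟨⟨y, r, rfl, hred, hg⟩, hlen⟩
      rw [Finset.mem_coe, hT, Finset.mem_biUnion]
      refine ⟨y, Finset.mem_univ _, ?_⟩
      rw [Finset.mem_filter, mem_wf]
      refine ⟨⟨r ++ [y], by simp, by simpa using hlen, ?_⟩, by simpa using hg⟩
      exact hred.infix ⟨[], r, by simp⟩
    · rintro w ⟨_, hw⟩ v ⟨_, hv⟩ hwv
      exact (List.append_inj hwv (hw.trans hv.symm)).1
  have h2 : (T.card : ℝ) ≤ ∑ x : Letter k, (((wf n x).filter (fun w => gsum (wg1 a χ) w ≤ 0)).card : ℝ) := by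
    exact_mod_cast Finset.card_biUnion_le
  have h3 : ∀ x : Letter k, (((wf n x).filter (fun w => gsum (wg1 a χ) w ≤ 0)).card : ℝ) ≤ wlam k ^ n := by
    intro x
    refine le_trans ?_ (wf_sum_bound (wg1 a χ) (wt k) (wlam k) (row_bound hk h) hl n x)
    rw [Finset.card_eq_sum_ones, Nat.cast_sum]
    calc _ ≤ ∑ w ∈ (wf n x).filter (fun w => gsum (wg1 a χ) w ≤ 0), Real.exp (-wt k * (gsum (wg1 a χ) w : ℝ)) := by
          apply Finset.sum_le_sum
          intro w hw
          have hw' : (gsum (wg1 a χ) w : ℝ) ≤ 0 := by exact_mod_cast (Finset.mem_filter.1 hw).2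
          rw [Nat.cast_one]
          apply Real.one_le_exp
          nlinarith
      _ ≤ _ := Finset.sum_le_sum_of_subset_of_nonneg (Finset.filter_subset _ _)
          (fun _ _ _ => (Real.exp_pos _).le)
  calc (cntL (BadW a χ) n : ℝ) ≤ T.card := by exact_mod_cast h1
    _ ≤ _ := h2
    _ ≤ ∑ x : Letter k, wlam k ^ n := Finset.sum_le_sum (fun x _ => h3 x)
    _ = 2 * k * wlam k ^ n := by
      rw [Finset.sum_const, Finset.card_univ, card_letter, nsmul_eq_mul]; push_cast; ring

theorem MissW_neg {k : ℕ} (hk : 2 ≤ k) (x : Letter k) : NegL (MissW x) := by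
  have hk' : (2:ℝ) ≤ k := by exact_mod_cast hk
  refine ⟨1, 2 * k - 2, by norm_num, by linarith, by linarith, fun n => ?_⟩
  let S := {y : Letter k // y ≠ x ∧ y ≠ linv x}
  have hS : Fintype.card S = 2 * k - 2 := by
    have : Fintype.card S = ((Finset.univ.erase x).erase (linv x)).card := by
      apply Fintype.card_of_subtype
      intro y; simp only [Finset.mem_erase, Finset.mem_univ, and_true]; tauto
    rw [this, Finset.card_erase_of_mem (by simp [linv_ne]), card_erase_letter hk]; omega
  have h1 : cntL (MissW x) n ≤ Nat.card (List.Vector S n) := by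
    rw [← Set.ncard_univ]
    unfold cntL
    have hsub : {w ∈ MissW x | w.length = n} ⊆ (fun v : List.Vector S n => v.1.map Subtype.val) '' Set.univ := by
      rintro w ⟨⟨h1, h2⟩, h3⟩
      refine ⟨⟨w.attach.map (fun y => ⟨y.1, fun h => h1 (h ▸ y.2), fun h => h2 (h ▸ y.2)⟩), by simp [h3]⟩, trivial, ?_⟩
      show List.map Subtype.val (List.map _ w.attach) = w
      rw [List.map_map]
      exact List.attach_map_subtype_val w
    exact (Set.ncard_le_ncard hsub (Set.toFinite _)).trans (Set.ncard_image_le (Set.toFinite _))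
  rw [Nat.card_eq_fintype_card, card_vector, hS] at h1
  rw [one_mul]
  calc (cntL (MissW x) n : ℝ) ≤ (((2 * k - 2) ^ n : ℕ) : ℝ) := by exact_mod_cast h1
    _ = _ := by push_cast [Nat.cast_sub (show 2 ≤ 2 * k by omega)]; ring


theorem absorb {m l : ℝ} (hm : 0 < m) (hl : m < l) :
    ∃ K : ℝ, 0 < K ∧ ∀ n : ℕ, (n + 1 : ℝ) * m ^ n ≤ K * l ^ n := by
  have hd : 0 < l / m - 1 := by
    have : 1 < l / m := (one_lt_div hm).2 hl
    linarith
  refine ⟨1 + 1 / (l / m - 1), by positivity, fun n => ?_⟩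
  set d := l / m - 1 with hdd
  have hb := one_add_mul_le_pow (show (-2:ℝ) ≤ d by linarith) n
  have e : (1 + d) ^ n * m ^ n = l ^ n := by
    rw [← mul_pow]; congr 1; rw [hdd]; field_simp; ring
  have h1 : (n + 1 : ℝ) ≤ (1 + 1 / d) * (1 + d) ^ n := by
    calc (n + 1 : ℝ) ≤ (1 + 1 / d) * (1 + n * d) := by
          have e2 : (1 + 1 / d) * (1 + n * d) = (n + 1 : ℝ) + n * d + 1 / d := by field_simp; ring
          rw [e2]
          have : 0 ≤ n * d := by positivity
          have : 0 ≤ 1 / d := by positivity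
          linarith
      _ ≤ _ := by gcongr
  calc (n + 1 : ℝ) * m ^ n ≤ ((1 + 1 / d) * (1 + d) ^ n) * m ^ n := by gcongr
    _ = _ := by rw [mul_assoc, e]

def PerPS {k : ℕ} (n : ℕ) (π : Equiv.Perm (Letter k)) (s : ℕ) : Set (List (Letter k)) :=
  {w | FreeGroup.IsReduced w ∧ w.length = n ∧ 0 < s ∧ s ≤ n / 2 ∧
    ∀ i, i + s < n → w[i + s]? = (w[i]?).map π}

theorem PerPS_card {k : ℕ} (n : ℕ) (π : Equiv.Perm (Letter k)) (s : ℕ) :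
    (PerPS n π s).ncard ≤ (RedN k (n / 2)).ncard := by
  apply Set.ncard_le_ncard_of_injOn (fun w => w.take (n / 2)) _ _ (RedN_finite k _)
  · rintro w ⟨h1, h2, -⟩
    exact ⟨h1.infix (List.take_prefix _ _).isInfix, by rw [List.length_take]; omega⟩
  · rintro w ⟨-, hw, hs, hs2, hw2⟩ v ⟨-, hv, -, -, hv2⟩ he
    apply List.ext_getElem?
    intro i
    induction i using Nat.strong_induction_on with
    | _ i ih =>
      by_cases h1 : i < n / 2
      · have := congrArg (fun l => l[i]?) he
        simpa [List.getElem?_take, h1] using this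
      · by_cases h2 : i < n
        · have e : i = (i - s) + s := by omega
          rw [e, hw2 _ (by omega), hv2 _ (by omega), ih _ (by omega)]
        · rw [List.getElem?_eq_none (by omega), List.getElem?_eq_none (by omega)]

theorem PerW_sub {k : ℕ} {n : ℕ} {w : List (Letter k)} (h : w ∈ PerW k) (hn : w.length = n)
    (hn0 : 0 < n) : ∃ π : Equiv.Perm (Letter k), ∃ s ∈ Finset.range (n + 1), w ∈ PerPS n π s := by
  obtain ⟨hr, h⟩ := h
  rcases h with h | ⟨π, r, h0, h1, h2⟩
  · subst h; simp at hn; omega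
  · have key : ∀ i, i < n → w[(i + r) % n]? = (w[i]?).map π := by
      intro i hi
      have := congrArg (fun l => l[i]?) h2
      simp only [List.getElem?_map] at this
      rw [List.getElem?_rotate (by omega), hn] at this
      exact this.symm
    by_cases hh : r ≤ n / 2
    · refine ⟨π, r, by simp; omega, hr, hn, h0, hh, fun i hi => ?_⟩
      rw [← key i (by omega), Nat.mod_eq_of_lt hi]
    · refine ⟨π⁻¹, n - r, by simp, hr, hn, by omega, by omega, fun i hi => ?_⟩
      have := key (i + (n - r)) hi
      rw [show i + (n - r) + r = i + n by omega, Nat.add_mod_right, Nat.mod_eq_of_lt (by omega)] at this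
      rw [this, Option.map_map]
      have : (⇑π⁻¹ ∘ ⇑π) = id := by ext1 x; simp
      rw [this]; simp

theorem sqrt_facts {k : ℕ} (hk : 2 ≤ k) : 1 < √(2 * k - 1 : ℝ) ∧ √(2 * k - 1 : ℝ) < 2 * k - 1 ∧
    √(2 * k - 1 : ℝ) ^ 2 = 2 * k - 1 := by
  have hk' : (2:ℝ) ≤ k := by exact_mod_cast hk
  have h2 : √(2 * k - 1 : ℝ) ^ 2 = 2 * k - 1 := Real.sq_sqrt (by linarith)
  have h1 : 1 < √(2 * k - 1 : ℝ) := by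
    rw [Real.lt_sqrt (by norm_num)]; linarith
  refine ⟨h1, ?_, h2⟩
  nlinarith

theorem PerW_neg {k : ℕ} (hk : 2 ≤ k) : NegL (PerW k) := by
  have hk' : (2:ℝ) ≤ k := by exact_mod_cast hk
  obtain ⟨hs1, hs2, hs3⟩ := sqrt_facts hk
  set q : ℝ := 2 * k - 1 with hq
  set t := √q with ht
  obtain ⟨K, hK, hK2⟩ := absorb (m := t) (l := (t + q) / 2) (by linarith) (by linarith)
  set P : ℝ := ((Fintype.card (Equiv.Perm (Letter k)) : ℕ) : ℝ) with hP
  have hP0 : 1 ≤ P := by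
    rw [hP]; exact_mod_cast Fintype.card_pos
  have hmain : ∀ n, (cntL (PerW k) n : ℝ) ≤ P * ((n + 1) * (2 * k * t ^ n)) := by
    intro n
    rcases Nat.eq_zero_or_pos n with rfl | hn
    · have : {w ∈ PerW k | w.length = 0} ⊆ {[]} := by
        rintro w ⟨_, h⟩; simpa using h
      have h1 := Set.ncard_le_ncard this (by simp)
      rw [Set.ncard_singleton] at h1
      have : (cntL (PerW k) 0 : ℝ) ≤ 1 := by exact_mod_cast h1
      refine this.trans ?_
      simp only [pow_zero, Nat.cast_zero]
      nlinarith
    · have hsub : {w ∈ PerW k | w.length = n} ⊆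
          ⋃ π : Equiv.Perm (Letter k), ⋃ s ∈ Finset.range (n + 1), PerPS n π s := by
        rintro w ⟨h1, h2⟩
        obtain ⟨π, s, hs, h⟩ := PerW_sub h1 h2 hn
        simp only [Set.mem_iUnion]
        exact ⟨π, s, hs, h⟩
      have hfin : (⋃ π : Equiv.Perm (Letter k), ⋃ s ∈ Finset.range (n + 1), PerPS n π s).Finite := by
        refine (List.finite_length_eq (Letter k) n).subset ?_
        intro w hw
        simp only [Set.mem_iUnion] at hw
        obtain ⟨π, s, hs, h⟩ := hw
        exact h.2.1
      have h1 := Set.ncard_le_ncard hsub hfin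
      have h2 := h1.trans (Set.ncard_iUnion_le_of_fintype _)
      have h3 : ∀ π : Equiv.Perm (Letter k), (⋃ s ∈ Finset.range (n + 1), PerPS n π s).ncard ≤
          (n + 1) * (RedN k (n / 2)).ncard := by
        intro π
        refine (Finset.set_ncard_biUnion_le _ _).trans ?_
        refine (Finset.sum_le_sum (fun s _ => PerPS_card n π s)).trans ?_
        simp
      have h4 := h2.trans (Finset.sum_le_sum (fun π _ => h3 π))
      rw [Finset.sum_const, Finset.card_univ, smul_eq_mul] at h4
      have h5 : (cntL (PerW k) n : ℝ) ≤ P * ((n + 1) * (RedN k (n / 2)).ncard) := by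
        rw [hP]; unfold cntL; exact_mod_cast h4
      refine h5.trans ?_
      have h6 : ((RedN k (n / 2)).ncard : ℝ) ≤ 2 * k * t ^ n := by
        refine (RedN_card_le hk _).trans ?_
        rw [← hq, ← hs3, ← pow_mul]
        gcongr
        · exact hs1.le
        · omega
      gcongr
  refine ⟨P * (2 * k) * K, (t + q) / 2, by positivity, by linarith, by linarith, fun n => ?_⟩
  calc (cntL (PerW k) n : ℝ) ≤ P * ((n + 1) * (2 * k * t ^ n)) := hmain n
    _ = P * (2 * k) * ((n + 1) * t ^ n) := by ring
    _ ≤ P * (2 * k) * (K * ((t + q) / 2) ^ n) := mul_le_mul_of_nonneg_left (hK2 n) (by positivity)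
    _ = _ := by ring

theorem BadAll_neg {k : ℕ} (hk : 2 ≤ k) : NegL (BadAll k) :=
  (NegL.iUnion hk (fun p => BadW_neg hk p.2)).union
    ((PerW_neg hk).union (NegL.iUnion hk (fun x => MissW_neg hk x)))

theorem NegL.raise {k : ℕ} (hk : 2 ≤ k) {B : Set (List (Letter k))} (h : NegL B) :
    ∃ K lam : ℝ, 0 ≤ K ∧ √(2 * k - 1 : ℝ) ≤ lam ∧ lam < 2 * k - 1 ∧
      ∀ n, (cntL B n : ℝ) ≤ K * lam ^ n := by
  obtain ⟨K, l, h1, h2, h3, h4⟩ := h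
  obtain ⟨hs1, hs2, hs3⟩ := sqrt_facts hk
  refine ⟨K, max (√(2 * k - 1 : ℝ)) l, h1, le_max_left _ _, max_lt hs2 h3, fun n => (h4 n).trans ?_⟩
  gcongr
  exact le_max_right _ _

def ConjW {k : ℕ} (B : Set (List (Letter k))) : Set (List (Letter k)) :=
  {w | ∃ v u, FreeGroup.IsReduced v ∧ u ∈ B ∧ w = v ++ u ++ FreeGroup.invRev v}

theorem ConjW_neg {k : ℕ} (hk : 2 ≤ k) {B : Set (List (Letter k))} (h : NegL B) :
    NegL (ConjW B) := by
  have hk' : (2:ℝ) ≤ k := by exact_mod_cast hk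
  obtain ⟨K, l, h1, h2, h3, h4⟩ := h.raise hk
  obtain ⟨hs1, hs2, hs3⟩ := sqrt_facts hk
  have hl2 : (2 * k - 1 : ℝ) ≤ l ^ 2 := by rw [← hs3]; gcongr
  have hl0 : 0 < l := by linarith
  obtain ⟨K2, hK2, hK3⟩ := absorb (m := l) (l := (l + (2 * k - 1)) / 2) hl0 (by linarith)
  have hmain : ∀ n, (cntL (ConjW B) n : ℝ) ≤ (n + 1) * (2 * k * K * l ^ n) := by
    intro n
    set G : ℕ → Set (List (Letter k)) := fun m =>
      (fun p : List (Letter k) × List (Letter k) => p.1 ++ p.2 ++ FreeGroup.invRev p.1) ''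
        (if 2 * m ≤ n then RedN k m ×ˢ {u ∈ B | u.length = n - 2 * m} else ∅) with hG
    have hfin : ∀ m, (if 2 * m ≤ n then RedN k m ×ˢ {u ∈ B | u.length = n - 2 * m} else ∅).Finite := by
      intro m
      split_ifs
      · exact (RedN_finite k m).prod (cntL_fin B _)
      · exact Set.finite_empty
    have hsub : {w ∈ ConjW B | w.length = n} ⊆ ⋃ m ∈ Finset.range (n + 1), G m := by
      rintro w ⟨⟨v, u, hv, hu, rfl⟩, hlen⟩
      simp only [List.length_append, FreeGroup.invRev_length] at hlen
      simp only [Set.mem_iUnion]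
      refine ⟨v.length, by simp; omega, (v, u), ?_, rfl⟩
      rw [if_pos (by omega)]
      exact ⟨⟨hv, rfl⟩, hu, by show u.length = _; omega⟩
    have hb : ∀ m ∈ Finset.range (n + 1), ((G m).ncard : ℝ) ≤ 2 * k * K * l ^ n := by
      intro m _
      have : (G m).ncard ≤ _ := Set.ncard_image_le (hfin m)
      refine (Nat.cast_le.2 this).trans ?_
      split_ifs with hm
      · rw [Set.ncard_prod]
        push_cast
        have i1 := RedN_card_le hk m
        have i2 := h4 (n - 2 * m)
        unfold cntL at i2
        calc _ ≤ (2 * k * (2 * k - 1 : ℝ) ^ m) * (K * l ^ (n - 2 * m)) :=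
            mul_le_mul i1 i2 (by positivity)
              (mul_nonneg (by positivity) (pow_nonneg (by linarith) _))
          _ ≤ (2 * k * (l ^ 2) ^ m) * (K * l ^ (n - 2 * m)) := by
            gcongr
            linarith
          _ = 2 * k * K * (l ^ (2 * m) * l ^ (n - 2 * m)) := by rw [← pow_mul]; ring
          _ = _ := by rw [← pow_add]; congr 2; omega
      · simp only [Set.ncard_empty, Nat.cast_zero]; positivity
    have hfU : (⋃ m ∈ Finset.range (n + 1), G m).Finite :=
      Set.Finite.biUnion (Finset.finite_toSet _) (fun m _ => (hfin m).image _)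
    have e1 := (Set.ncard_le_ncard hsub hfU).trans (Finset.set_ncard_biUnion_le _ _)
    have e2 : (cntL (ConjW B) n : ℝ) ≤ ∑ m ∈ Finset.range (n + 1), ((G m).ncard : ℝ) := by
      unfold cntL; exact_mod_cast e1
    refine e2.trans ((Finset.sum_le_sum hb).trans ?_)
    simp
  refine ⟨2 * k * K * K2, (l + (2 * k - 1)) / 2, by positivity, by linarith, by linarith, fun n => ?_⟩
  calc (cntL (ConjW B) n : ℝ) ≤ (n + 1) * (2 * k * K * l ^ n) := hmain n
    _ = 2 * k * K * ((n + 1) * l ^ n) := by ring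
    _ ≤ 2 * k * K * (K2 * ((l + (2 * k - 1)) / 2) ^ n) := mul_le_mul_of_nonneg_left (hK3 n) (by positivity)
    _ = _ := by ring

theorem ball_fin {k : ℕ} (S : Set (FG k)) (n : ℕ) : {g ∈ S | wordLength g ≤ n}.Finite := by
  have := (List.finite_length_le (Letter k) n).preimage
    (FreeGroup.toWord_injective (α := Fin k)).injOn
  exact this.subset (fun g hg => hg.2)

theorem rho_neg {k : ℕ} {D : Set (FG k)} {B : Set (List (Letter k))}
    (hD : ∀ g ∈ D, FreeGroup.toWord g ∈ B) (n : ℕ) :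
    rhoC D n ≤ ∑ m ∈ Finset.range (n + 1), cntL B m := by
  unfold rhoC
  have h : {g ∈ D | wordLength g ≤ n}.ncard ≤
      (⋃ m ∈ Finset.range (n + 1), {w ∈ B | w.length = m}).ncard := by
    apply Set.ncard_le_ncard_of_injOn FreeGroup.toWord _ FreeGroup.toWord_injective.injOn
      (Set.Finite.biUnion (Finset.finite_toSet _) (fun m _ => cntL_fin B m))
    rintro g ⟨h1, h2⟩
    simp only [Set.mem_iUnion]
    exact ⟨wordLength g, Finset.mem_range.2 (by omega), hD g h1, rfl⟩
  exact h.trans (Finset.set_ncard_biUnion_le _ _)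

theorem rhoC_mono {k : ℕ} {A B : Set (FG k)} (h : A ⊆ B) (n : ℕ) : rhoC A n ≤ rhoC B n :=
  Set.ncard_le_ncard (fun _ hg => ⟨h hg.1, hg.2⟩) (ball_fin B n)

theorem exists_letter {k : ℕ} (hk : 2 ≤ k) (x y : Letter k) : ∃ z : Letter k, z ≠ x ∧ z ≠ y := by
  have : 0 < ((Finset.univ.erase x).erase y).card := by
    have h1 := Finset.pred_card_le_card_erase (s := Finset.univ.erase x) (a := y)
    rw [card_erase_letter hk] at h1
    omega
  obtain ⟨z, hz⟩ := Finset.card_pos.1 this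
  simp only [Finset.mem_erase, Finset.mem_univ, and_true] at hz
  exact ⟨z, hz.2, hz.1⟩

theorem cyc_ext {k : ℕ} (hk : 2 ≤ k) (x : Letter k) (n : ℕ) (w : List (Letter k)) (hw : w ∈ wf n x) :
    ∃ y, FreeGroup.IsReduced ((w ++ [y]) ++ (w ++ [y])) := by
  obtain ⟨r, hr, _, hred⟩ := (mem_wf n x w).1 hw
  have hne : w ≠ [] := by rw [hr]; simp
  obtain ⟨y, hy1, hy2⟩ := exists_letter hk (linv (w.getLast hne)) (linv x)
  refine ⟨y, ?_⟩
  have e := List.dropLast_append_getLast hne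
  have h1 : FreeGroup.IsReduced (w ++ [y]) := by
    have := red_glue (u := w.dropLast) (v := []) (x := w.getLast hne) (y := y)
      (by rw [e]; exact hred) (by simp) hy1
    rwa [e] at this
  have e2 : w ++ [y] = x :: (r ++ [y]) := by rw [hr]; simp
  have := red_glue (u := w) (v := r ++ [y]) (x := y) (y := x) h1 (by rw [← e2]; exact h1)
    (fun h => hy2 (by rw [h, linv_linv]))
  rwa [← e2] at this

theorem rho_C_lower {k : ℕ} (hk : 2 ≤ k) (n : ℕ) :
    (2 * k - 1 : ℝ) ^ n ≤ (2 * k - 1 : ℝ) ^ 2 * rhoC (Cset k) n := by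
  have hk' : (2:ℝ) ≤ k := by exact_mod_cast hk
  have hq : (1:ℝ) ≤ 2 * k - 1 := by linarith
  by_cases hn : n < 2
  · have h1 : 1 ≤ rhoC (Cset k) n := by
      unfold rhoC
      rw [Nat.one_le_iff_ne_zero, ← Nat.pos_iff_ne_zero, Set.ncard_pos (ball_fin _ _)]
      refine ⟨1, ?_, by simp [wordLength]⟩
      show CyclicallyReducedWord _
      rw [isRed_iff]; simp
    have h2 : (1:ℝ) ≤ rhoC (Cset k) n := by exact_mod_cast h1
    calc (2 * k - 1 : ℝ) ^ n ≤ (2 * k - 1 : ℝ) ^ 2 := pow_le_pow_right₀ hq (by omega)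
      _ ≤ _ := le_mul_of_one_le_right (by positivity) h2
  · obtain ⟨m, rfl⟩ : ∃ m, n = m + 2 := ⟨n - 2, by omega⟩
    let x : Letter k := (⟨0, by omega⟩, true)
    have hc : ∀ w : List (Letter k), ∃ y, w ∈ wf m x → FreeGroup.IsReduced ((w ++ [y]) ++ (w ++ [y])) := by
      intro w
      by_cases h : w ∈ wf m x
      · obtain ⟨y, hy⟩ := cyc_ext hk x m w h
        exact ⟨y, fun _ => hy⟩
      · exact ⟨x, fun h' => absurd h' h⟩
    choose Y hY using hc
    have hword : ∀ w ∈ wf m x, FreeGroup.toWord (FreeGroup.mk (w ++ [Y w])) = w ++ [Y w] := by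
      intro w hw
      have : FreeGroup.IsReduced (w ++ [Y w]) := (hY w hw).infix ⟨[], _, by simp; rfl⟩
      rw [FreeGroup.toWord_mk]; exact this.reduce_eq
    have h1 : ((wf m x : Finset (List (Letter k))) : Set (List (Letter k))).ncard ≤ rhoC (Cset k) (m + 2) := by
      unfold rhoC
      apply Set.ncard_le_ncard_of_injOn (fun w => FreeGroup.mk (w ++ [Y w])) _ _ (ball_fin _ _)
      · intro w hw
        refine ⟨?_, ?_⟩
        · show CyclicallyReducedWord _
          rw [hword w hw, isRed_iff]; exact hY w hw
        · show (FreeGroup.toWord _).length ≤ _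
          rw [hword w hw]
          obtain ⟨r, hr, hl, _⟩ := (mem_wf m x w).1 hw
          subst hr; simp; omega
      · intro w hw v hv he
        have := congrArg FreeGroup.toWord he
        simp only at this
        rw [hword w hw, hword v hv] at this
        have := congrArg List.dropLast this
        simpa using this
    rw [Set.ncard_coe_finset] at h1
    have h2 : ((wf m x).card : ℝ) ≤ rhoC (Cset k) (m + 2) := by exact_mod_cast h1
    rw [card_wf hk] at h2
    rw [pow_add, mul_comm]
    gcongr

theorem expGeneric_of_neg {k : ℕ} (hk : 2 ≤ k) {T S : Set (FG k)} (hTS : T ⊆ S) (hC : Cset k ⊆ S)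
    {B : Set (List (Letter k))} (hB : NegL B) (hD : ∀ g ∈ S \ T, FreeGroup.toWord g ∈ B) :
    ExpGenericIn T S := by
  have hk' : (2:ℝ) ≤ k := by exact_mod_cast hk
  obtain ⟨K, l, h1, h2, h3, h4⟩ := hB.raise hk
  obtain ⟨hs1, hs2, hs3⟩ := sqrt_facts hk
  have hl1 : 1 < l := by linarith
  obtain ⟨K2, hK2, hK3⟩ := absorb (m := l) (l := (l + (2 * k - 1)) / 2) (by linarith) (by linarith)
  set q : ℝ := 2 * k - 1 with hq
  have hq0 : 0 < q := by linarith
  refine ⟨hTS, (K + 1) * K2 * q ^ 2, by positivity, (l + q) / 2 / q, by positivity, ?_, fun n => ?_⟩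
  · rw [div_lt_one hq0]; linarith
  have hR : (rhoC (S \ T) n : ℝ) ≤ (K + 1) * K2 * ((l + q) / 2) ^ n := by
    have := rho_neg hD n
    have h5 : (rhoC (S \ T) n : ℝ) ≤ ∑ m ∈ Finset.range (n + 1), (cntL B m : ℝ) := by exact_mod_cast this
    calc (rhoC (S \ T) n : ℝ) ≤ _ := h5
      _ ≤ ∑ m ∈ Finset.range (n + 1), K * l ^ n := by
        apply Finset.sum_le_sum
        intro m hm
        refine (h4 m).trans ?_
        gcongr
        · exact hl1.le
        · have := Finset.mem_range.1 hm; omega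
      _ = K * ((n + 1) * l ^ n) := by simp; ring
      _ ≤ (K + 1) * (K2 * ((l + q) / 2) ^ n) := 
        mul_le_mul (by linarith) (hK3 n) (by positivity) (by linarith)
      _ = _ := by ring
  have hlow : q ^ n ≤ q ^ 2 * rhoC S n := by
    refine (rho_C_lower hk n).trans ?_
    gcongr
    exact rhoC_mono hC n
  have hS0 : (0:ℝ) < rhoC S n := by
    have : 0 < q ^ 2 * rhoC S n := lt_of_lt_of_le (by positivity) hlow
    exact (pos_iff_pos_of_mul_pos this).1 (by positivity)
  have hsplit : (rhoC S n : ℝ) = rhoC T n + rhoC (S \ T) n := by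
    have e : {g ∈ S | wordLength g ≤ n} = {g ∈ T | wordLength g ≤ n} ∪ {g ∈ S \ T | wordLength g ≤ n} := by
      ext g
      simp only [Set.mem_union, Set.mem_ofPred_eq, Set.mem_sdiff]
      have := @hTS g
      tauto
    have := Set.ncard_union_eq (s := {g ∈ T | wordLength g ≤ n}) (t := {g ∈ S \ T | wordLength g ≤ n})
      (Set.disjoint_left.2 (fun g h h' => h'.1.2 h.1)) (ball_fin _ _) (ball_fin _ _)
    rw [← e] at this
    unfold rhoC
    exact_mod_cast this
  have e : 1 - (rhoC T n : ℝ) / rhoC S n = rhoC (S \ T) n / rhoC S n := by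
    rw [eq_div_iff hS0.ne', sub_mul, div_mul_cancel₀ _ hS0.ne']; linarith
  rw [e, abs_of_nonneg (by positivity), div_le_iff₀ hS0, div_pow]
  calc (rhoC (S \ T) n : ℝ) ≤ (K + 1) * K2 * ((l + q) / 2) ^ n := hR
    _ = (K + 1) * K2 * (((l + q) / 2) ^ n / q ^ n) * q ^ n := by field_simp
    _ ≤ (K + 1) * K2 * (((l + q) / 2) ^ n / q ^ n) * (q ^ 2 * rhoC S n) := by gcongr
    _ = _ := by ring

theorem notTS'_bad {k : ℕ} (hk : 2 ≤ k) (g : FG k) (h : g ∉ TS' k) :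
    FreeGroup.toWord g ∈ ConjW (BadAll k) := by
  set L := FreeGroup.toWord g with hL
  have hred : FreeGroup.IsReduced L := FreeGroup.isReduced_toWord
  set u := FreeGroup.reduceCyclically L with hu
  set v := FreeGroup.reduceCyclically.conjugator L with hv
  have e : v ++ u ++ FreeGroup.invRev v = L := FreeGroup.reduceCyclically.conj_conjugator_reduceCyclically L
  have hcyc := FreeGroup.reduceCyclically.isCyclicallyReduced hred
  have hur : FreeGroup.toWord (FreeGroup.mk u) = u := by
    rw [FreeGroup.toWord_mk]; exact hcyc.isReduced.reduce_eq
  refine ⟨v, u, hred.infix ⟨[], u ++ FreeGroup.invRev v, by rw [← e]; simp⟩, ?_, e.symm⟩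
  have hC : FreeGroup.mk u ∈ Cset k := by
    show CyclicallyReducedWord _
    rw [hur, isRed_iff]; exact cyc_iff' _ hcyc
  have hn : FreeGroup.mk u ∉ TS k := by
    intro hT
    apply h
    refine ⟨FreeGroup.mk v, FreeGroup.mk u, hT, ?_⟩
    rw [FreeGroup.inv_mk, FreeGroup.mul_mk, FreeGroup.mul_mk, e, hL, FreeGroup.mk_toWord]
  have := notTS_bad hk hC hn
  rwa [hur] at this

/-- `TS` is exponentially generic in `C` and `TS'` is exponentially
generic in `F_k`. -/
theorem TS_expGeneric (k : ℕ) (hk : 2 ≤ k) :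
    ExpGenericIn (TS k) (Cset k) ∧ ExpGenericIn (TS' k) (Set.univ : Set (FG k)) := by
  refine ⟨expGeneric_of_neg hk (fun g hg => hg.1.1) le_rfl (BadAll_neg hk)
    (fun g hg => notTS_bad hk hg.1 hg.2),
    expGeneric_of_neg hk (Set.subset_univ _) (Set.subset_univ _) (ConjW_neg hk (BadAll_neg hk))
      (fun g hg => notTS'_bad hk g hg.2)⟩
end

section
/- For every nontrivial element w ∈ TS', the stabilizer Aut(F_k)_w = {α ∈ Aut(F_k) : α(w) = w} is the infinite cyclic group generated by the inner automorphism ad(w), where ad(w): u ↦ w u w^{-1}. -/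
namespace WH
open Filter Topology
variable {k : ℕ}

def L (z : Letter k) : FG k := FreeGroup.mk [z]

lemma linv_linv (z : Letter k) : linv (linv z) = z := by simp [linv]
lemma linv_ne (z : Letter k) : linv z ≠ z := by
  rcases z with ⟨i, b⟩; cases b <;> simp [linv]
lemma ne_linv (z : Letter k) : z ≠ linv z := (linv_ne z).symm
lemma linv_inj {x y : Letter k} : linv x = linv y ↔ x = y :=
  ⟨fun h => by rw [← linv_linv x, h, linv_linv], fun h => by rw [h]⟩
lemma linv_eq_iff {x y : Letter k} : linv x = y ↔ x = linv y :=
  ⟨fun h => by rw [← h, linv_linv], fun h => by rw [h, linv_linv]⟩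
lemma L_linv (z : Letter k) : L (linv z) = (L z)⁻¹ := by
  simp [L, linv, FreeGroup.invRev]
lemma toWord_L (z : Letter k) : (L z).toWord = [z] := by
  simp [L]
lemma L_inj {x y : Letter k} : L x = L y ↔ x = y := by
  constructor
  · intro h
    have := congrArg FreeGroup.toWord h
    simpa [toWord_L] using this
  · rintro rfl; rfl
lemma L_ne_one (z : Letter k) : L z ≠ 1 := by
  intro h
  have := congrArg FreeGroup.toWord h
  simp [toWord_L] at this

def U (z : Letter k) : Set (FG k) := {g | g.toWord.head? = some z}

lemma mem_U {g : FG k} {z : Letter k} : g ∈ U z ↔ g.toWord.head? = some z := Iff.rfl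
lemma one_not_mem_U (z : Letter k) : (1 : FG k) ∉ U z := by simp [mem_U]
lemma L_mem_U {x z : Letter k} : L x ∈ U z ↔ x = z := by simp [mem_U, toWord_L]
lemma U_disj {g : FG k} {x z : Letter k} (h : g ∈ U x) (h' : g ∈ U z) : x = z := by
  rw [mem_U] at h h'; rw [h] at h'; exact Option.some.inj h'
lemma exists_U {g : FG k} (h : g ≠ 1) : ∃ z, g ∈ U z := by
  rcases hw : g.toWord with _ | ⟨z, t⟩
  · exact absurd (FreeGroup.toWord_eq_nil_iff.1 hw) h
  · exact ⟨z, by simp [mem_U, hw]⟩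

lemma toWord_L_mul (z : Letter k) (g : FG k) :
    (g ∈ U (linv z) ∧ g.toWord = linv z :: (L z * g).toWord) ∨
    (g ∉ U (linv z) ∧ (L z * g).toWord = z :: g.toWord) := by
  have h1 : (L z * g).toWord = FreeGroup.reduce (z :: g.toWord) := by
    rw [FreeGroup.toWord_mul, toWord_L]; rfl
  rw [FreeGroup.reduce.cons, FreeGroup.reduce_toWord] at h1
  rcases hw : g.toWord with _ | ⟨y, t⟩
  · right; rw [hw] at h1
    simpa [mem_U, hw] using h1
  · rw [hw] at h1
    simp only at h1
    by_cases hc : z.1 = y.1 ∧ z.2 = !y.2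
    · left
      rw [if_pos hc] at h1
      have : linv z = y := by
        rcases z with ⟨a, b⟩; rcases y with ⟨c, d⟩
        simp [linv] at hc ⊢; exact ⟨hc.1, by rw [hc.2]⟩
      simp [mem_U, hw, this, h1]
    · right
      rw [if_neg hc] at h1
      refine ⟨?_, h1⟩
      rw [mem_U, hw]
      simp only [List.head?_cons, Option.some.injEq]
      intro h; apply hc; rw [h]; simp [linv]

lemma mem_U_flip (g : FG k) (z : Letter k) : g ∈ U z ↔ L (linv z) * g ∉ U (linv z) := by
  rcases toWord_L_mul (linv z) g with ⟨h1, h2⟩ | ⟨h1, h2⟩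
  · rw [linv_linv] at h1 h2
    refine ⟨fun _ h3 => ?_, fun _ => h1⟩
    rcases toWord_L_mul z (L (linv z) * g) with ⟨_, h5⟩ | ⟨h4, _⟩
    · rw [h5] at h2
      rw [L_linv, mul_inv_cancel_left] at h2
      have := congrArg List.length h2
      simp at this
      omega
    · exact h4 h3
  · rw [linv_linv] at h1
    refine ⟨fun h => absurd h h1, fun h => absurd ?_ h⟩
    simp [mem_U, h2]

lemma toWord_mul_L (s : Letter k) (g : FG k) :
    (g.toWord = (g * L s).toWord ++ [linv s]) ∨ ((g * L s).toWord = g.toWord ++ [s]) := by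
  have key : ∀ x : FG k, x.toWord = FreeGroup.invRev (x⁻¹).toWord := by
    intro x; rw [FreeGroup.toWord_inv, FreeGroup.invRev_invRev]
  have e : (g * L s)⁻¹ = L (linv s) * g⁻¹ := by rw [mul_inv_rev, L_linv]
  rcases toWord_L_mul (linv s) g⁻¹ with ⟨_, h2⟩ | ⟨_, h2⟩
  · left
    rw [key g, key (g * L s), e, h2]
    simp [FreeGroup.invRev, linv]
  · right
    rw [key g, key (g * L s), e, h2]
    simp [FreeGroup.invRev, linv]

lemma U_change (g : FG k) (s z : Letter k) :
    (g ∈ U z ↔ g * L s ∈ U z) ∨ (g = 1 ∧ s = z) ∨ (g = L z ∧ s = linv z) := by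
  rcases toWord_mul_L s g with h | h
  · rcases h2 : (g * L s).toWord with _ | ⟨y, t⟩
    · have h3 : g * L s = 1 := FreeGroup.toWord_eq_nil_iff.1 h2
      have h4 : g = L (linv s) := by rw [L_linv]; exact eq_inv_of_mul_eq_one_left h3
      by_cases h5 : linv s = z
      · right; right; rw [h4, h5, ← h5, linv_linv]; simp
      · left; rw [h3, h4, L_mem_U]; simp [h5, one_not_mem_U]
    · left; rw [mem_U, mem_U, h, h2]; simp
  · rcases h2 : g.toWord with _ | ⟨y, t⟩
    · have h3 : g = 1 := FreeGroup.toWord_eq_nil_iff.1 h2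
      by_cases h5 : s = z
      · right; left; exact ⟨h3, h5⟩
      · left; rw [h3, one_mul, L_mem_U]; simp [h5, one_not_mem_U]
    · left; rw [mem_U, mem_U, h, h2]; simp

lemma nocancel {g u : FG k} {z : Letter k} (hu : u ∈ U z) (hg : g⁻¹ ∉ U z) :
    (g * u).toWord = g.toWord ++ u.toWord := by
  rw [FreeGroup.toWord_mul]
  apply FreeGroup.IsReduced.reduce_eq
  unfold FreeGroup.IsReduced
  rw [List.isChain_append]
  refine ⟨FreeGroup.isReduced_toWord, FreeGroup.isReduced_toWord, ?_⟩
  intro x hx y hy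
  rw [mem_U] at hu hg
  rw [hu] at hy
  have : z = y := by simpa using hy
  subst this
  intro h1
  by_contra h2
  apply hg
  rw [FreeGroup.toWord_inv]
  simp only [FreeGroup.invRev, List.head?_reverse, List.getLast?_map]
  simp only [Option.mem_def] at hx
  rw [hx]
  rcases x with ⟨a, b⟩; rcases z with ⟨c, d⟩
  simp at h1 h2 ⊢
  refine ⟨h1, ?_⟩
  cases b <;> cases d <;> simp_all

/-- translate -/
def tr (g : FG k) (V : Set (FG k)) : Set (FG k) := {u | g⁻¹ * u ∈ V}
lemma mem_tr {g u : FG k} {V : Set (FG k)} : u ∈ tr g V ↔ g⁻¹ * u ∈ V := Iff.rfl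
lemma tr_tr (g h : FG k) (V : Set (FG k)) : tr g (tr h V) = tr (g * h) V := by
  ext u; simp [mem_tr, mul_assoc]
lemma tr_one (V : Set (FG k)) : tr 1 V = V := by ext u; simp [mem_tr]
lemma tr_compl (g : FG k) (V : Set (FG k)) : tr g Vᶜ = (tr g V)ᶜ := rfl

lemma U_compl (z : Letter k) : (U z)ᶜ = tr (L z) (U (linv z)) := by
  ext g
  rw [mem_tr, Set.mem_compl_iff, mem_U_flip, not_not, L_linv]

/-- half-space dichotomy -/
lemma HS_aux {g : FG k} {z : Letter k} (h : g⁻¹ ∉ U z) (h1 : g ≠ 1) :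
    ∃ s, g ∈ U s ∧ tr g (U z) ⊆ U s := by
  obtain ⟨s, hs⟩ := exists_U h1
  refine ⟨s, hs, fun u hu => ?_⟩
  rw [mem_tr] at hu
  have := nocancel hu h
  rw [mul_inv_cancel_left] at this
  rw [mem_U, this, List.head?_append, mem_U.1 hs]; rfl

lemma HS (g : FG k) (z : Letter k) :
    ∃ s, tr g (U z) ⊆ U s ∨ (tr g (U z))ᶜ ⊆ U s := by
  by_cases h : g⁻¹ ∈ U z
  · have e : (tr g (U z))ᶜ = tr (g * L z) (U (linv z)) := by
      rw [← tr_compl, U_compl, tr_tr]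
    rw [e]
    by_cases h1 : g * L z = 1
    · exact ⟨linv z, Or.inr (by rw [h1, tr_one])⟩
    · have h2 : (g * L z)⁻¹ ∉ U (linv z) := by
        rw [mul_inv_rev, ← L_linv]; exact (mem_U_flip _ _).1 h
      obtain ⟨s, _, hs⟩ := HS_aux h2 h1
      exact ⟨s, Or.inr hs⟩
  · by_cases h1 : g = 1
    · exact ⟨z, Or.inl (by rw [h1, tr_one])⟩
    · obtain ⟨s, _, hs⟩ := HS_aux h h1
      exact ⟨s, Or.inl hs⟩

lemma L_pow_toWord (z : Letter k) (n : ℕ) : (L z ^ n).toWord = List.replicate n z := by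
  induction n with
  | zero => simp
  | succ n ih =>
    rw [pow_succ']
    rcases toWord_L_mul z (L z ^ n) with ⟨h1, _⟩ | ⟨_, h2⟩
    · exfalso
      rw [mem_U, ih] at h1
      rcases n with _ | n
      · simp at h1
      · simp [List.replicate_succ] at h1; exact ne_linv z h1
    · rw [h2, ih, List.replicate_succ]

lemma L_pow_mem {z : Letter k} {n : ℕ} (hn : n ≠ 0) : L z ^ n ∈ U z := by
  obtain ⟨m, rfl⟩ := Nat.exists_eq_succ_of_ne_zero hn
  rw [mem_U, L_pow_toWord, List.replicate_succ]; rfl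

lemma pow_inj {g : FG k} (hg : g ≠ 1) : Function.Injective (fun n : ℕ => g ^ n) :=
  IsMulTorsionFree.pow_right_injective hg

lemma U_infinite (z : Letter k) : ∃ᶠ g in cofinite, g ∈ U z := by
  rw [frequently_cofinite_iff_infinite]
  have : Function.Injective (fun n : ℕ => (L z) ^ (n + 1)) := by
    intro m n h
    have := pow_inj (L_ne_one z) h
    omega
  refine (Set.infinite_range_of_injective this).mono ?_
  rintro _ ⟨n, rfl⟩
  exact L_pow_mem (by omega)

lemma tr_cof {g : FG k} {P : FG k → Prop} (h : ∀ᶠ u in cofinite, P u) :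
    ∀ᶠ u in cofinite, P (g⁻¹ * u) :=
  (mul_right_injective g⁻¹).tendsto_cofinite.eventually h

lemma tr_freq {g : FG k} {V : Set (FG k)} (h : ∃ᶠ u in cofinite, u ∈ V) :
    ∃ᶠ u in cofinite, u ∈ tr g V := by
  intro h2
  apply h
  have := tr_cof (g := g⁻¹) h2
  filter_upwards [this] with u hu
  simpa [mem_tr] using hu

/-- equality up to finite sets -/
def FE (V W : Set (FG k)) : Prop := ∀ᶠ u in cofinite, (u ∈ V ↔ u ∈ W)

lemma FE.symm {V W : Set (FG k)} (h : FE V W) : FE W V := by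
  filter_upwards [h] with u hu using hu.symm
lemma FE.refl (V : Set (FG k)) : FE V V := Eventually.of_forall fun _ => Iff.rfl
lemma FE.trans {V W X : Set (FG k)} (h : FE V W) (h' : FE W X) : FE V X := by
  filter_upwards [h, h'] with u hu hu' using hu.trans hu'
lemma FE.compl {V W : Set (FG k)} (h : FE V W) : FE Vᶜ Wᶜ := by
  filter_upwards [h] with u hu using not_congr hu
lemma FE.tr {V W : Set (FG k)} (h : FE V W) (g : FG k) : FE (tr g V) (tr g W) := tr_cof h
lemma FE.map {V W : Set (FG k)} (h : FE V W) (α : MulAut (FG k)) : FE (α ⁻¹' V) (α ⁻¹' W) :=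
  α.injective.tendsto_cofinite.eventually h
lemma FE_off_one {V W : Set (FG k)} (h : ∀ u, u ≠ 1 → (u ∈ V ↔ u ∈ W)) : FE V W := by
  have : ∀ᶠ u : FG k in cofinite, u ≠ 1 := by
    have := (Set.finite_singleton (1 : FG k)).compl_mem_cofinite
    filter_upwards [this] with u hu using hu
  filter_upwards [this] with u hu using h u hu

end WH

namespace WH
open Filter Topology
variable {k : ℕ}

def Dl (V : Set (FG k)) (h : FG k) : Set (FG k) := {g | ¬ (g ∈ V ↔ g * h ∈ V)}
def AI (V : Set (FG k)) : Prop := ∀ h, (Dl V h).Finite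
noncomputable def f (V : Set (FG k)) (h : FG k) : ℕ := (Dl V h).ncard

lemma mem_Dl {V : Set (FG k)} {h g : FG k} : g ∈ Dl V h ↔ ¬ (g ∈ V ↔ g * h ∈ V) := Iff.rfl

lemma Dl_mul (V : Set (FG k)) (a b : FG k) :
    Dl V (a * b) ⊆ Dl V a ∪ (fun g => g * a⁻¹) '' Dl V b := by
  intro g hg
  by_cases h : g ∈ Dl V a
  · exact Or.inl h
  · right
    refine ⟨g * a, ?_, by simp⟩
    simp only [mem_Dl, not_not, mul_assoc] at *
    tauto

lemma Dl_inv (V : Set (FG k)) (a : FG k) : Dl V a⁻¹ ⊆ (fun g => g * a) '' Dl V a := by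
  intro g hg
  refine ⟨g * a⁻¹, ?_, by simp⟩
  simp only [mem_Dl] at *
  simp only [inv_mul_cancel_right]
  tauto

lemma Dl_one (V : Set (FG k)) : Dl V 1 = ∅ := by ext g; simp [mem_Dl]

lemma L_true (i : Fin k) : L (i, true) = FreeGroup.of i := rfl
lemma L_false (i : Fin k) : L (i, false) = (FreeGroup.of i)⁻¹ := by
  rw [← L_true, ← L_linv]; rfl

lemma AI_of_letters {V : Set (FG k)} (h : ∀ z : Letter k, (Dl V (L z)).Finite) : AI V := by
  intro g
  induction g using FreeGroup.induction_on with
  | C1 => rw [Dl_one]; exact Set.finite_empty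
  | of i => exact h (i, true)
  | inv_of i _ => rw [← L_false]; exact h (i, false)
  | mul x y hx hy => exact (hx.union (hy.image _)).subset (Dl_mul V x y)

lemma AI_U (z : Letter k) : AI (U z) := by
  apply AI_of_letters
  intro s
  refine (Set.toFinite {1, L z}).subset ?_
  intro g hg
  rcases U_change g s z with h | h | h
  · exact absurd h hg
  · simp [h.1]
  · simp [h.1]

lemma AI.compl {V : Set (FG k)} (h : AI V) : AI Vᶜ := by
  intro g
  refine (h g).subset ?_
  intro u hu
  simp only [mem_Dl, Set.mem_compl_iff] at *
  tauto

lemma AI.inter {V W : Set (FG k)} (h : AI V) (h' : AI W) : AI (V ∩ W) := by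
  intro g
  refine ((h g).union (h' g)).subset ?_
  intro u hu
  simp only [mem_Dl, Set.mem_inter_iff, Set.mem_union] at *
  tauto

lemma AI.union {V W : Set (FG k)} (h : AI V) (h' : AI W) : AI (V ∪ W) := by
  intro g
  refine ((h g).union (h' g)).subset ?_
  intro u hu
  simp only [mem_Dl, Set.mem_union] at *
  tauto

lemma AI.tr {V : Set (FG k)} (h : AI V) (g : FG k) : AI (tr g V) := by
  intro a
  refine ((h a).image (fun u => g * u)).subset ?_
  intro u hu
  refine ⟨g⁻¹ * u, ?_, by simp⟩
  simpa [mem_Dl, mem_tr, mul_assoc] using hu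

lemma AI.map {V : Set (FG k)} (h : AI V) (α : MulAut (FG k)) : AI (α ⁻¹' V) := by
  intro a
  refine ((h (α a)).preimage (α.injective.injOn)).subset ?_
  intro u hu
  simpa [mem_Dl] using hu

lemma f_mul_le {V : Set (FG k)} (hV : AI V) (a b : FG k) : f V (a * b) ≤ f V a + f V b := by
  unfold f
  calc _ ≤ (Dl V a ∪ (fun g => g * a⁻¹) '' Dl V b).ncard :=
        Set.ncard_le_ncard (Dl_mul V a b) ((hV a).union ((hV b).image _))
    _ ≤ _ := (Set.ncard_union_le _ _).trans
        (Nat.add_le_add_left (Set.ncard_image_le (hV b)) _)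

lemma f_one (V : Set (FG k)) : f V 1 = 0 := by simp [f, Dl_one]

lemma f_compl (V : Set (FG k)) (h : FG k) : f Vᶜ h = f V h := by
  unfold f; congr 1; ext u
  simp only [mem_Dl, Set.mem_compl_iff]; tauto

lemma f_tr (V : Set (FG k)) (g h : FG k) : f (tr g V) h = f V h := by
  unfold f
  have : Dl (tr g V) h = (fun u => g * u) '' Dl V h := by
    ext u
    constructor
    · intro hu
      exact ⟨g⁻¹ * u, by simpa [mem_Dl, mem_tr, mul_assoc] using hu, by simp⟩
    · rintro ⟨u, hu, rfl⟩
      simpa [mem_Dl, mem_tr, mul_assoc] using hu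
  rw [this, Set.ncard_image_of_injective _ (mul_right_injective g)]

lemma f_map (V : Set (FG k)) (α : MulAut (FG k)) (h : FG k) : f (α ⁻¹' V) h = f V (α h) := by
  unfold f
  have : Dl V (α h) = α '' Dl (α ⁻¹' V) h := by
    ext u
    constructor
    · intro hu
      exact ⟨α.symm u, by simpa [mem_Dl] using hu, by simp⟩
    · rintro ⟨u, hu, rfl⟩
      simpa [mem_Dl] using hu
  rw [this, Set.ncard_image_of_injective _ α.injective]

lemma f_submod {V W : Set (FG k)} (hV : AI V) (hW : AI W) (h : FG k) :
    f (V ∪ W) h + f (V ∩ W) h ≤ f V h + f W h := by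
  unfold f
  rw [← Set.ncard_union_add_ncard_inter (Dl V h) (Dl W h) (hV h) (hW h),
    ← Set.ncard_union_add_ncard_inter (Dl (V ∪ W) h) (Dl (V ∩ W) h)
      (hV.union hW h) (hV.inter hW h)]
  apply add_le_add
  · apply Set.ncard_le_ncard _ ((hV h).union (hW h))
    intro u hu
    simp only [mem_Dl, Set.mem_union, Set.mem_inter_iff] at *
    tauto
  · apply Set.ncard_le_ncard _ ((hV h).inter_of_left _)
    intro u hu
    simp only [mem_Dl, Set.mem_union, Set.mem_inter_iff] at *
    tauto

lemma f_FE_le {V W : Set (FG k)} (hV : AI V) (h : FE V W) :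
    ∃ C : ℕ, ∀ g, f W g ≤ f V g + C := by
  have hf : {u | ¬ (u ∈ V ↔ u ∈ W)}.Finite := h
  refine ⟨2 * {u | ¬ (u ∈ V ↔ u ∈ W)}.ncard, fun g => ?_⟩
  set S := {u | ¬ (u ∈ V ↔ u ∈ W)} with hS
  unfold f
  have : Dl W g ⊆ Dl V g ∪ (S ∪ (fun u => u * g⁻¹) '' S) := by
    intro u hu
    by_cases h1 : u ∈ Dl V g
    · exact Or.inl h1
    right
    by_cases h2 : u ∈ S
    · exact Or.inl h2
    right
    refine ⟨u * g, ?_, by simp⟩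
    simp only [mem_Dl, hS, Set.mem_ofPred_eq] at *
    tauto
  calc _ ≤ _ := Set.ncard_le_ncard this ((hV g).union (hf.union (hf.image _)))
    _ ≤ _ := Set.ncard_union_le _ _
    _ ≤ (Dl V g).ncard + (S.ncard + ((fun u => u * g⁻¹) '' S).ncard) := by
        gcongr; exact Set.ncard_union_le _ _
    _ ≤ (Dl V g).ncard + (S.ncard + S.ncard) := by
        exact Nat.add_le_add_left (Nat.add_le_add_left (Set.ncard_image_le hf) _) _
    _ = _ := by ring

lemma AI.FE {V W : Set (FG k)} (hV : AI V) (h : FE V W) : AI W := by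
  have hf : {u | ¬ (u ∈ V ↔ u ∈ W)}.Finite := h
  intro g
  set S := {u | ¬ (u ∈ V ↔ u ∈ W)} with hS
  refine ((hV g).union (hf.union (hf.image (fun u => u * g⁻¹)))).subset ?_
  intro u hu
  by_cases h1 : u ∈ Dl V g
  · exact Or.inl h1
  right
  by_cases h2 : u ∈ S
  · exact Or.inl h2
  right
  refine ⟨u * g, ?_, by simp⟩
  simp only [mem_Dl, hS, Set.mem_ofPred_eq] at *
  tauto

/-- stable crossing number -/
noncomputable def c (w : FG k) (V : Set (FG k)) : ℝ :=
  sInf ((fun n : ℕ => (f V (w ^ n) : ℝ) / n) '' Set.Ici 1)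

lemma c_tendsto (w : FG k) {V : Set (FG k)} (hV : AI V) :
    Tendsto (fun n : ℕ => (f V (w ^ n) : ℝ) / n) atTop (𝓝 (c w V)) := by
  have hs : Subadditive (fun n : ℕ => (f V (w ^ n) : ℝ)) := by
    intro m n
    show ((f V (w ^ (m + n)) : ℕ) : ℝ) ≤ (f V (w ^ m) : ℕ) + (f V (w ^ n) : ℕ)
    rw [pow_add]
    exact_mod_cast f_mul_le hV _ _
  have hl : c w V = hs.lim := by rw [Subadditive.lim]; rfl
  rw [hl]
  refine hs.tendsto_lim ⟨0, ?_⟩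
  rintro _ ⟨n, rfl⟩
  positivity

lemma c_le_of {w w' : FG k} {V W : Set (FG k)} (hV : AI V) (hW : AI W) (C : ℕ)
    (h : ∀ n, f W (w' ^ n) ≤ f V (w ^ n) + C) : c w' W ≤ c w V := by
  have h1 := (c_tendsto w hV).add (tendsto_const_div_atTop_nhds_zero_nat (C : ℝ))
  rw [add_zero] at h1
  refine le_of_tendsto_of_tendsto' (c_tendsto w' hW) h1 ?_
  intro n
  rw [← add_div]
  gcongr
  exact_mod_cast h n

lemma c_FE (w : FG k) {V W : Set (FG k)} (hV : AI V) (h : FE V W) : c w V = c w W := by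
  obtain ⟨C, hC⟩ := f_FE_le hV h
  obtain ⟨C', hC'⟩ := f_FE_le (hV.FE h) h.symm
  exact le_antisymm (c_le_of (hV.FE h) hV C' fun n => hC' _) (c_le_of hV (hV.FE h) C fun n => hC _)

lemma c_compl (w : FG k) (V : Set (FG k)) : c w Vᶜ = c w V := by
  simp only [c, f_compl]
lemma c_tr (w g : FG k) (V : Set (FG k)) : c w (tr g V) = c w V := by
  simp only [c, f_tr]
lemma c_map (w : FG k) (α : MulAut (FG k)) (V : Set (FG k)) : c w (α ⁻¹' V) = c (α w) V := by
  simp only [c, f_map, map_pow]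
lemma c_submod (w : FG k) {V W : Set (FG k)} (hV : AI V) (hW : AI W) :
    c w (V ∪ W) + c w (V ∩ W) ≤ c w V + c w W := by
  refine le_of_tendsto_of_tendsto' ((c_tendsto w (hV.union hW)).add (c_tendsto w (hV.inter hW)))
    ((c_tendsto w hV).add (c_tendsto w hW)) ?_
  intro n
  rw [← add_div, ← add_div]
  exact div_le_div_of_nonneg_right (by exact_mod_cast f_submod hV hW _) (Nat.cast_nonneg n)

lemma c_U_linv (w : FG k) (z : Letter k) : c w (U (linv z)) = c w (U z) := by
  rw [← c_compl w (U z), U_compl, c_tr]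

lemma f_U_cons (s : Letter k) (h : FG k) (hs : h ∉ U (linv s)) (j : Fin k) :
    f (U (j, true)) (L s * h) = f (U (j, true)) h + if s.1 = j then 1 else 0 := by
  set V := U (j, true) with hV
  have hf : (Dl V h).Finite := AI_U _ h
  have inj : Function.Injective (fun u : FG k => u * (L s)⁻¹) := mul_left_injective _
  have himg : ∀ u, u ∈ (fun u : FG k => u * (L s)⁻¹) '' Dl V h ↔
      ¬ (u * L s ∈ V ↔ u * (L s * h) ∈ V) := by
    intro u
    constructor
    · rintro ⟨u, hu, rfl⟩
      simpa [mem_Dl, mul_assoc] using hu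
    · intro hu
      exact ⟨u * L s, by simpa [mem_Dl, mul_assoc] using hu, by simp⟩
  have hsh : L s * h ∈ U s := by
    rcases toWord_L_mul s h with ⟨h1, _⟩ | ⟨_, h1⟩
    · exact absurd h1 hs
    · simp [mem_U, h1]
  unfold f
  split_ifs with hj
  · -- distinguished point
    obtain ⟨p, hp1, hp2, hp3⟩ : ∃ p : FG k, p ∈ Dl V (L s * h) ∧ ¬ (p ∈ V ↔ p * L s ∈ V) ∧
        ∀ q, ¬ (q ∈ V ↔ q * L s ∈ V) → q = p := by
      rcases s with ⟨i, b⟩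
      simp only at hj; subst hj
      cases b
      · refine ⟨L (i, true), ?_, ?_, ?_⟩
        · rw [mem_Dl]
          have e : L (i, true) * (L (i, false) * h) = h := by
            rw [L_true, L_false]; simp
          rw [e]
          have : h ∉ V := hs
          have h2 : L (i, true) ∈ V := L_mem_U.2 rfl
          tauto
        · have e : L (i, true) * L (i, false) = 1 := by rw [L_true, L_false]; simp
          rw [e]
          have h2 : L (i, true) ∈ V := L_mem_U.2 rfl
          have := one_not_mem_U (k := k) (i, true)
          tauto
        · intro q hq
          rcases U_change q (i, false) (i, true) with h | h | h
          · exact absurd h hq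
          · simp at h
          · exact h.1
      · refine ⟨1, ?_, ?_, ?_⟩
        · rw [mem_Dl, one_mul]
          have := one_not_mem_U (k := k) (i, true)
          tauto
        · rw [one_mul]
          have h2 : L (i, true) ∈ V := L_mem_U.2 rfl
          have := one_not_mem_U (k := k) (i, true)
          tauto
        · intro q hq
          rcases U_change q (i, true) (i, true) with h | h | h
          · exact absurd h hq
          · exact h.1
          · simp [linv] at h
    have hnot : p ∉ (fun u : FG k => u * (L s)⁻¹) '' Dl V h := by
      rw [himg]; rw [mem_Dl] at hp1; tauto
    have : Dl V (L s * h) = insert p ((fun u : FG k => u * (L s)⁻¹) '' Dl V h) := by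
      ext u
      rw [Set.mem_insert_iff]
      by_cases hu : u = p
      · subst hu; simp [hp1]
      · have h1 := mt (hp3 u) hu
        rw [himg, mem_Dl]
        tauto
    rw [this, Set.ncard_insert_of_notMem hnot (hf.image _), Set.ncard_image_of_injective _ inj]
  · have : Dl V (L s * h) = (fun u : FG k => u * (L s)⁻¹) '' Dl V h := by
      ext u
      rw [himg, mem_Dl]
      rcases U_change u s (j, true) with h1 | h1 | h1
      · rw [← hV] at h1; tauto
      · exact absurd (by rw [h1.2]) hj
      · exact absurd (by rw [h1.2]; rfl) hj
    rw [this, Set.ncard_image_of_injective _ inj, add_zero]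

lemma sum_f_U (h : FG k) : ∑ j, f (U (j, true)) h = wordLength h := by
  obtain ⟨n, hn⟩ : ∃ n, n = h.toWord.length := ⟨_, rfl⟩
  induction n generalizing h with
  | zero =>
    have : h = 1 := FreeGroup.toWord_eq_nil_iff.1 (List.length_eq_zero_iff.1 hn.symm)
    subst this
    simp [f_one, wordLength]
  | succ n ih =>
    rcases hw : h.toWord with _ | ⟨s, t⟩
    · simp [hw] at hn
    · have hs : h ∈ U s := by simp [mem_U, hw]
      have h1 : L (linv s) * h ∉ U (linv s) := (mem_U_flip _ _).1 hs
      have e : h = L s * (L (linv s) * h) := by rw [L_linv]; simp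
      have h2 : (L s * (L (linv s) * h)).toWord = s :: (L (linv s) * h).toWord := by
        rcases toWord_L_mul s (L (linv s) * h) with ⟨h1', _⟩ | ⟨_, h1'⟩
        · exact absurd h1' h1
        · exact h1'
      rw [← e] at h2
      have h3 := ih (L (linv s) * h) (by rw [h2] at hn; simpa using hn)
      have h4 : ∀ j, f (U (j, true)) h = f (U (j, true)) (L (linv s) * h)
          + if s.1 = j then 1 else 0 := by
        intro j
        conv_lhs => rw [e]
        exact f_U_cons s _ h1 j
      simp only [h4, Finset.sum_add_distrib, h3]
      simp [wordLength, h2]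

lemma sum_c_tendsto (g : FG k) : Tendsto (fun n : ℕ => (wordLength (g ^ n) : ℝ) / n) atTop
    (𝓝 (∑ j, c g (U (j, true)))) := by
  have := tendsto_finsetSum Finset.univ (fun (j : Fin k) _ => c_tendsto g (AI_U (j, true)))
  refine this.congr fun n => ?_
  rw [← Finset.sum_div, ← sum_f_U]
  push_cast; rfl

lemma cyc_pow {u : FG k} (hu : IsCyclicallyReduced u) (n : ℕ) :
    (u ^ n).toWord = (List.replicate n u.toWord).flatten := by
  rw [FreeGroup.toWord_pow]
  apply FreeGroup.IsReduced.reduce_eq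
  have h1 : FreeGroup.IsReduced (u.toWord ++ u.toWord) := FreeGroup.isReduced_iff_reduce_eq.2 hu
  unfold FreeGroup.IsReduced at h1
  rw [List.isChain_append] at h1
  exact (FreeGroup.IsCyclicallyReduced.flatten_replicate ⟨FreeGroup.isReduced_toWord, h1.2.2⟩ n).1

lemma cyc_pow_length {u : FG k} (hu : IsCyclicallyReduced u) (n : ℕ) :
    wordLength (u ^ n) = n * wordLength u := by
  simp [wordLength, cyc_pow hu]

lemma sum_c_cyc {u : FG k} (hu : IsCyclicallyReduced u) :
    ∑ j, c u (U (j, true)) = wordLength u := by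
  refine tendsto_nhds_unique (sum_c_tendsto u) ?_
  refine (tendsto_const_nhds (x := (wordLength u : ℝ))).congr' ?_
  filter_upwards [eventually_ge_atTop 1] with n hn
  rw [cyc_pow_length hu]
  have : (n : ℝ) ≠ 0 := by positivity
  push_cast; field_simp

lemma exists_cyc (g : FG k) : ∃ x u : FG k, IsCyclicallyReduced u ∧ g = x * u * x⁻¹ := by
  have h := FreeGroup.reduceCyclically.conj_conjugator_reduceCyclically g.toWord
  have h2 := FreeGroup.reduceCyclically.isCyclicallyReduced (FreeGroup.isReduced_toWord (x := g))
  refine ⟨FreeGroup.mk (FreeGroup.reduceCyclically.conjugator g.toWord),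
    FreeGroup.mk (FreeGroup.reduceCyclically g.toWord), ?_, ?_⟩
  · have h3 := h2.flatten_replicate 2
    unfold IsCyclicallyReduced CyclicallyReducedWord
    rw [FreeGroup.toWord_mk, h2.1.reduce_eq]
    apply FreeGroup.IsReduced.reduce_eq
    simpa [List.replicate] using h3.1
  · rw [FreeGroup.inv_mk, FreeGroup.mul_mk, FreeGroup.mul_mk, h, FreeGroup.mk_toWord]

lemma cyclicLength_le (g : FG k) : (cyclicLength g : ℝ) ≤ ∑ j, c g (U (j, true)) := by
  obtain ⟨x, u, hu, rfl⟩ := exists_cyc g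
  have h1 : cyclicLength (x * u * x⁻¹) ≤ wordLength u := Nat.sInf_le ⟨x, u, hu, rfl, rfl⟩
  have h2 : (cyclicLength (x * u * x⁻¹) : ℝ) ≤ wordLength u := by exact_mod_cast h1
  refine h2.trans ?_
  have h3 := (sum_c_tendsto (x * u * x⁻¹)).add
    (tendsto_const_div_atTop_nhds_zero_nat ((2 * wordLength x : ℕ) : ℝ))
  rw [add_zero] at h3
  refine ge_of_tendsto h3 ?_
  filter_upwards [eventually_ge_atTop 1] with n hn
  have h4 : wordLength (u ^ n) ≤ wordLength ((x * u * x⁻¹) ^ n) + 2 * wordLength x := by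
    have e : u ^ n = x⁻¹ * (x * u * x⁻¹) ^ n * x := by rw [conj_pow]; group
    have a1 := FreeGroup.norm_mul_le (x⁻¹ * (x * u * x⁻¹) ^ n) x
    have a2 := FreeGroup.norm_mul_le x⁻¹ ((x * u * x⁻¹) ^ n)
    rw [FreeGroup.norm_inv_eq] at a2
    rw [← e] at a1
    unfold FreeGroup.norm at a1 a2
    unfold wordLength
    omega
  rw [cyc_pow_length hu] at h4
  rw [← add_div, le_div_iff₀ (by positivity)]
  rw [mul_comm]
  exact_mod_cast h4

lemma c_nonneg (w : FG k) (V : Set (FG k)) : 0 ≤ c w V := by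
  apply Real.sInf_nonneg
  rintro _ ⟨n, _, rfl⟩
  positivity

end WH

namespace WH
open Filter Topology
variable {k : ℕ}

lemma exists_common {g h : FG k} (hc : Commute g h) :
    ∃ (t : FG k) (m n : ℤ), g = t ^ m ∧ h = t ^ n := by
  classical
  set H := Subgroup.closure ({g, h} : Set (FG k)) with hH
  have hcomm : ∀ x ∈ ({g, h} : Set (FG k)), ∀ y ∈ ({g, h} : Set (FG k)), x * y = y * x := by
    intro x hx y hy
    rcases hx with rfl | hx <;> rcases hy with rfl | hy
    · rfl
    · rw [Set.mem_singleton_iff.1 hy]; exact hc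
    · rw [Set.mem_singleton_iff.1 hx]; exact hc.symm
    · rw [Set.mem_singleton_iff.1 hx, Set.mem_singleton_iff.1 hy]
  have hab : ∀ x y : H, x * y = y * x := by
    have := Subgroup.isMulCommutative_closure hcomm
    intro x y
    exact mul_comm' x y
  let e := IsFreeGroup.toFreeGroup H
  have hab' : ∀ x y : FreeGroup (IsFreeGroup.Generators H), x * y = y * x := by
    intro x y
    apply e.symm.injective
    rw [map_mul, map_mul, hab]
  have hsub : Subsingleton (IsFreeGroup.Generators H) := by
    by_contra hns
    rw [not_subsingleton_iff_nontrivial] at hns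
    obtain ⟨x, y, hxy⟩ := hns
    have h1 := hab' (FreeGroup.of x) (FreeGroup.of y)
    have h2 := congrArg (FreeGroup.lift (fun z => if z = x then (Equiv.swap (0 : Fin 3) 1) else Equiv.swap 1 2)) h1
    simp only [map_mul, FreeGroup.lift_apply_of, if_true, if_neg hxy.symm] at h2
    exact absurd h2 (by decide)
  have hgen : ∃ t : FreeGroup (IsFreeGroup.Generators H), ∀ x, ∃ n : ℤ, x = t ^ n := by
    rcases isEmpty_or_nonempty (IsFreeGroup.Generators H) with hE | ⟨⟨z⟩⟩
    · exact ⟨1, fun x => ⟨0, Subsingleton.elim _ _⟩⟩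
    · refine ⟨FreeGroup.of z, fun x => ?_⟩
      induction x using FreeGroup.induction_on with
      | C1 => exact ⟨0, by simp⟩
      | of i => exact ⟨1, by rw [Subsingleton.elim i z]; simp⟩
      | inv_of i _ => exact ⟨-1, by rw [Subsingleton.elim i z]; simp⟩
      | mul x y hx hy =>
        obtain ⟨m, rfl⟩ := hx
        obtain ⟨n, rfl⟩ := hy
        exact ⟨m + n, by rw [zpow_add]⟩
  obtain ⟨t, ht⟩ := hgen
  obtain ⟨m, hm⟩ := ht (e ⟨g, Subgroup.subset_closure (by simp)⟩)
  obtain ⟨n, hn⟩ := ht (e ⟨h, Subgroup.subset_closure (by simp)⟩)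
  refine ⟨(e.symm t : H), m, n, ?_, ?_⟩
  · have := congrArg e.symm hm
    rw [MulEquiv.symm_apply_apply, map_zpow] at this
    have := congrArg (Subtype.val) this
    simpa using this
  · have := congrArg e.symm hn
    rw [MulEquiv.symm_apply_apply, map_zpow] at this
    have := congrArg (Subtype.val) this
    simpa using this

/-- exponent sum -/
def ex (j : Fin k) : FG k →* Multiplicative ℤ :=
  FreeGroup.lift (fun i => Multiplicative.ofAdd (if i = j then 1 else 0))

def ez (j : Fin k) (g : FG k) : ℤ := Multiplicative.toAdd (ex j g)

lemma ez_mul (j : Fin k) (g h : FG k) : ez j (g * h) = ez j g + ez j h := by simp [ez]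
lemma ez_inv (j : Fin k) (g : FG k) : ez j g⁻¹ = - ez j g := by simp [ez]
lemma ez_one (j : Fin k) : ez j 1 = 0 := by simp [ez]
lemma ez_zpow (j : Fin k) (g : FG k) (n : ℤ) : ez j (g ^ n) = n * ez j g := by simp [ez]
lemma ez_pow (j : Fin k) (g : FG k) (n : ℕ) : ez j (g ^ n) = n * ez j g := by simp [ez]
lemma ez_of (j i : Fin k) : ez j (FreeGroup.of i) = if i = j then 1 else 0 := by simp [ez, ex]
lemma ez_L (j : Fin k) (z : Letter k) :
    ez j (L z) = if z.1 = j then (if z.2 then 1 else -1) else 0 := by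
  rcases z with ⟨i, b⟩
  cases b
  · rw [L_false, ez_inv, ez_of]; split_ifs <;> simp_all
  · rw [L_true, ez_of]; simp

lemma ez_L_self (z : Letter k) : ez z.1 (L z) = 1 ∨ ez z.1 (L z) = -1 := by
  rw [ez_L, if_pos rfl]; split_ifs <;> simp

lemma ez_L_ne {j : Fin k} {z : Letter k} (h : z.1 ≠ j) : ez j (L z) = 0 := by
  rw [ez_L, if_neg h]

/-- centralizer of a letter -/
lemma comm_letter {g : FG k} {z : Letter k} (h : Commute g (L z)) : ∃ n : ℤ, g = L z ^ n := by
  obtain ⟨t, m, n, h1, h2⟩ := exists_common h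
  have h3 : ez z.1 (L z) = n * ez z.1 t := by rw [h2, ez_zpow]
  have h4 : n = 1 ∨ n = -1 := by
    rcases ez_L_self z with h5 | h5 <;> rw [h5] at h3
    · exact Int.isUnit_iff.1 (IsUnit.of_mul_eq_one _ h3.symm)
    · refine Int.isUnit_iff.1 (IsUnit.of_mul_eq_one (- ez z.1 t) ?_)
      linarith [mul_neg n (ez z.1 t)]
  rcases h4 with rfl | rfl
  · exact ⟨m, by rw [h2, h1]; simp⟩
  · exact ⟨-m, by rw [h2, h1]; simp⟩

lemma comm_two {g : FG k} {x y : Letter k} (hxy : x.1 ≠ y.1) (h : Commute g (L x))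
    (h' : Commute g (L y)) : g = 1 := by
  obtain ⟨m, rfl⟩ := comm_letter h
  obtain ⟨n, hn⟩ := comm_letter h'
  have := congrArg (ez x.1) hn
  rw [ez_zpow, ez_zpow, ez_L_ne hxy.symm] at this
  have hm : m = 0 := by
    rcases ez_L_self x with h5 | h5 <;> rw [h5] at this <;> linarith
  simp [hm]

lemma not_comm {x y : Letter k} (hxy : x.1 ≠ y.1) : ¬ Commute (L x) (L y) := fun h =>
  L_ne_one x (comm_two hxy (Commute.refl _) h)

/-- union of cylinders -/
def VA (A : Set (Letter k)) : Set (FG k) := {g | ∃ z ∈ A, g ∈ U z}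

lemma mem_VA {A : Set (Letter k)} {g : FG k} : g ∈ VA A ↔ ∃ z ∈ A, g ∈ U z := Iff.rfl
lemma one_not_mem_VA (A : Set (Letter k)) : (1 : FG k) ∉ VA A := by
  rintro ⟨z, _, h⟩; exact one_not_mem_U z h
lemma L_mem_VA {A : Set (Letter k)} {z : Letter k} : L z ∈ VA A ↔ z ∈ A := by
  constructor
  · rintro ⟨y, hy, h⟩; rw [L_mem_U] at h; rwa [h]
  · intro h; exact ⟨z, h, L_mem_U.2 rfl⟩
lemma mem_VA_of_U {A : Set (Letter k)} {g : FG k} {z : Letter k} (h : g ∈ U z) :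
    g ∈ VA A ↔ z ∈ A := by
  constructor
  · rintro ⟨y, hy, h'⟩; rwa [U_disj h h']
  · intro hz; exact ⟨z, hz, h⟩

lemma U_change' (g : FG k) (s z : Letter k) :
    (g ∈ U z ↔ g * L s ∈ U z) ↔ ¬ ((g = 1 ∧ s = z) ∨ (g = L z ∧ s = linv z)) := by
  constructor
  · rintro h (⟨rfl, rfl⟩ | ⟨rfl, rfl⟩)
    · rw [one_mul] at h
      exact one_not_mem_U s (h.2 (L_mem_U.2 rfl))
    · rw [L_linv, mul_inv_cancel] at h
      exact one_not_mem_U z (h.1 (L_mem_U.2 rfl))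
  · intro h
    have := U_change g s z
    tauto

lemma VA_change (A : Set (Letter k)) (q : FG k) (t : Letter k) :
    (q ∈ VA A ↔ q * L t ∈ VA A) ↔ ¬ ((q = 1 ∧ t ∈ A) ∨ (q * L t = 1 ∧ linv t ∈ A)) := by
  by_cases h1 : q = 1
  · subst h1
    simp only [one_mul, L_mem_VA, one_not_mem_VA, L_ne_one]
    tauto
  by_cases h2 : q * L t = 1
  · have h3 : q = L (linv t) := by rw [L_linv]; exact eq_inv_of_mul_eq_one_left h2
    rw [h2]
    simp only [one_not_mem_VA, h3, L_mem_VA, L_ne_one]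
    tauto
  · simp only [h1, h2, false_and, or_false, not_false_eq_true, iff_true]
    have : ∀ z, q ∈ U z ↔ q * L t ∈ U z := by
      intro z
      rw [U_change']
      rintro (⟨h, _⟩ | ⟨h, h'⟩)
      · exact h1 h
      · apply h2; rw [h, h', L_linv, mul_inv_cancel]
    simp only [mem_VA, this]

lemma VA_off (A : Set (Letter k)) : AI (VA A) := by
  apply AI_of_letters
  intro t
  refine (Set.toFinite {1, (L t)⁻¹}).subset ?_
  intro g hg
  rw [mem_Dl, VA_change, not_not] at hg
  rcases hg with h | h
  · simp [h.1]
  · right; exact eq_inv_of_mul_eq_one_left h.1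

lemma letter_ind {P Q : FG k → Prop} (h1 : P 1 ↔ Q 1)
    (h : ∀ g s, (P g ↔ P (g * L s)) ↔ (Q g ↔ Q (g * L s))) (g : FG k) : P g ↔ Q g := by
  obtain ⟨l, rfl⟩ : ∃ l, FreeGroup.mk l = g := ⟨g.toWord, FreeGroup.mk_toWord⟩
  induction l using List.reverseRecOn with
  | nil => exact h1
  | append_singleton l s ih =>
    have e : FreeGroup.mk (l ++ [s]) = FreeGroup.mk l * L s := by rw [L, FreeGroup.mul_mk]
    rw [e]
    have := h (FreeGroup.mk l) s
    tauto

section Whitehead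
variable (a : Letter k) (A : Set (Letter k))

open Classical in
noncomputable def ee (x : Letter k) : FG k := if x ∈ A ∧ x.1 ≠ a.1 then L a else 1

noncomputable def psi0 : FG k →* FG k :=
  FreeGroup.lift (fun i => (ee a A (i, true))⁻¹ * L (i, true) * ee a A (i, false))
noncomputable def tau0 : FG k →* FG k :=
  FreeGroup.lift (fun i => (ee a A (i, true)) * L (i, true) * (ee a A (i, false))⁻¹)

lemma psi0_L (x : Letter k) : psi0 a A (L x) = (ee a A x)⁻¹ * L x * ee a A (linv x) := by
  rcases x with ⟨i, b⟩
  cases b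
  · rw [L_false, map_inv]
    simp only [psi0, FreeGroup.lift_apply_of]
    simp [linv, L_true, mul_assoc]
  · rw [L_true]
    simp only [psi0, FreeGroup.lift_apply_of]
    simp [linv, L_true]

lemma tau0_L (x : Letter k) : tau0 a A (L x) = (ee a A x) * L x * (ee a A (linv x))⁻¹ := by
  rcases x with ⟨i, b⟩
  cases b
  · rw [L_false, map_inv]
    simp only [tau0, FreeGroup.lift_apply_of]
    simp [linv, L_true, mul_assoc]
  · rw [L_true]
    simp only [tau0, FreeGroup.lift_apply_of]
    simp [linv, L_true]

lemma ee_cases (x : Letter k) : ee a A x = 1 ∨ ee a A x = L a := by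
  unfold ee; split_ifs <;> simp
lemma ee_same {x : Letter k} (h : x.1 = a.1) : ee a A x = 1 := by
  unfold ee; simp [h]
lemma ee_mem {x : Letter k} (h : x.1 ≠ a.1) (h' : x ∈ A) : ee a A x = L a := by
  unfold ee; simp [h, h']
lemma ee_not_mem {x : Letter k} (h' : x ∉ A) : ee a A x = 1 := by
  unfold ee; simp [h']
lemma psi0_a : psi0 a A (L a) = L a := by
  rw [psi0_L, ee_same a A rfl, ee_same a A (show (linv a).1 = a.1 from rfl)]; simp
lemma tau0_a : tau0 a A (L a) = L a := by
  rw [tau0_L, ee_same a A rfl, ee_same a A (show (linv a).1 = a.1 from rfl)]; simp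
lemma psi0_ee (x : Letter k) : psi0 a A (ee a A x) = ee a A x := by
  rcases ee_cases a A x with h | h <;> rw [h]
  · simp
  · exact psi0_a a A
lemma tau0_ee (x : Letter k) : tau0 a A (ee a A x) = ee a A x := by
  rcases ee_cases a A x with h | h <;> rw [h]
  · simp
  · exact tau0_a a A

noncomputable def psi : MulAut (FG k) :=
  MonoidHom.toMulEquiv (psi0 a A) (tau0 a A)
    (by
      ext i
      rw [← L_true]
      simp only [MonoidHom.comp_apply, psi0_L, map_mul, map_inv, tau0_L, tau0_ee, MonoidHom.id_apply]
      group)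
    (by
      ext i
      rw [← L_true]
      simp only [MonoidHom.comp_apply, psi0_L, map_mul, map_inv, tau0_L, psi0_ee, MonoidHom.id_apply]
      group)

lemma psi_L (x : Letter k) : psi a A (L x) = (ee a A x)⁻¹ * L x * ee a A (linv x) := psi0_L a A x
lemma tau_L (x : Letter k) : (psi a A)⁻¹ (L x) = ee a A x * L x * (ee a A (linv x))⁻¹ := tau0_L a A x
lemma psi_a : psi a A (L a) = L a := psi0_a a A
lemma tau_a : (psi a A)⁻¹ (L a) = L a := tau0_a a A

variable {a A}
lemma VA_ee (ha : a ∈ A) (ha' : linv a ∉ A) (q : FG k) {s : Letter k} (hs : s.1 ≠ a.1) :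
    (q * ee a A s ∈ VA A) ↔ ¬ (q ∈ VA A ↔ (q = 1 ∧ s ∈ A)) := by
  by_cases h : s ∈ A
  · rw [ee_mem a A hs h]
    have := VA_change A q a
    simp only [h, and_true]
    tauto
  · rw [ee_not_mem a A h, mul_one]
    tauto

lemma psi_U_a (ha : a ∈ A) (ha' : linv a ∉ A) (g : FG k) :
    g ∈ U a ↔ psi a A g ∈ VA A := by
  refine letter_ind (P := fun g => g ∈ U a) (Q := fun g => psi a A g ∈ VA A) ?_ ?_ g
  · simp [one_not_mem_U, one_not_mem_VA]
  · intro g s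
    rw [U_change']
    have hinj : ∀ x y, psi a A x = psi a A y ↔ x = y := fun x y => (psi a A).injective.eq_iff
    have h1 : psi a A g = 1 ↔ g = 1 := by rw [← hinj g 1, map_one]
    by_cases hs : s.1 = a.1
    · have e : psi a A (g * L s) = psi a A g * L s := by
        rw [map_mul, psi_L, ee_same a A hs, ee_same a A (show (linv s).1 = a.1 from hs)]; simp
      rw [e, VA_change, h1]
      have hs2 : s = a ∨ s = linv a := by
        rcases s with ⟨i, b⟩; rcases a with ⟨j, d⟩
        simp only at hs; subst hs
        cases b <;> cases d <;> simp [linv]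
      rcases hs2 with rfl | rfl
      · simp [ha, ha', ne_linv]
      · rw [linv_linv]
        have : psi a A g * L (linv a) = 1 ↔ g = L a := by
          rw [L_linv, mul_inv_eq_one, ← hinj g, psi_a]
        rw [this]
        simp [ha, ha', linv_ne]
    · have hsa : s ≠ a := fun h => hs (by rw [h])
      have hsa' : s ≠ linv a := fun h => hs (by rw [h]; rfl)
      set q := psi a A g * (ee a A s)⁻¹ with hq
      have e1 : psi a A g = q * ee a A s := by simp [hq]
      have e2 : psi a A (g * L s) = q * L s * ee a A (linv s) := by
        rw [map_mul, psi_L, hq]; group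
      rw [e2, e1, VA_ee ha ha' q hs, VA_ee ha ha' (q * L s) (show (linv s).1 ≠ a.1 from hs)]
      have h3 := VA_change A q s
      have h4 : ¬ (q = 1 ∧ q * L s = 1) := by
        rintro ⟨h5, h6⟩; rw [h5, one_mul] at h6; exact L_ne_one s h6
      simp only [hsa, hsa', and_false, or_false, not_false_eq_true, true_iff]
      tauto

lemma U_ee (q : FG k) {x : Letter k} (hx : x.1 ≠ a.1) (s : Letter k) :
    (q * ee a A s ∈ U x) ↔ q ∈ U x := by
  rcases ee_cases a A s with h | h <;> rw [h]
  · rw [mul_one]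
  · symm
    rw [U_change']
    rintro (⟨_, h⟩ | ⟨_, h⟩)
    · exact hx (by rw [h])
    · exact hx (by rw [h]; rfl)

lemma psi_U_ne {x : Letter k} (hx : x.1 ≠ a.1) (g : FG k) :
    g ∈ U x ↔ psi a A g ∈ tr (ee a A x)⁻¹ (U x) := by
  refine letter_ind (P := fun g => g ∈ U x)
    (Q := fun g => psi a A g ∈ tr (ee a A x)⁻¹ (U x)) ?_ ?_ g
  · simp only [map_one, mem_tr, inv_inv, one_not_mem_U, false_iff]
    rw [← one_mul (ee a A x), mul_assoc, mul_one, U_ee 1 hx]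
    exact one_not_mem_U x
  · intro g s
    have hinj : ∀ x y, psi a A x = psi a A y ↔ x = y := fun x y => (psi a A).injective.eq_iff
    rw [U_change']
    simp only [mem_tr, inv_inv]
    set q := ee a A x * psi a A g * (ee a A s)⁻¹ with hq
    have e1 : ee a A x * psi a A g = q * ee a A s := by simp [hq]
    have e2 : ee a A x * psi a A (g * L s) = q * L s * ee a A (linv s) := by
      rw [map_mul, psi_L, hq]; group
    rw [e1, e2, U_ee _ hx, U_ee _ hx, U_change']
    have h1 : s = x → (q = 1 ↔ g = 1) := by
      rintro rfl
      rw [hq, mul_inv_eq_one, mul_eq_left, ← hinj g 1, map_one]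
    have h2 : s = linv x → (q = L x ↔ g = L x) := by
      rintro rfl
      rw [hq, ← hinj g, psi_L, mul_inv_eq_iff_eq_mul, ← eq_inv_mul_iff_mul_eq, mul_assoc]
    tauto

end Whitehead

lemma L_mem_letterSet (x : Letter k) : L x ∈ letterSet k := by
  rcases x with ⟨i, b⟩
  cases b
  · exact ⟨i, Or.inr (L_false i)⟩
  · exact ⟨i, Or.inl (L_true i)⟩

lemma letterSet_eq {g : FG k} (h : g ∈ letterSet k) : ∃ x, g = L x := by
  rcases h with ⟨i, h | h⟩
  · exact ⟨(i, true), h⟩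
  · exact ⟨(i, false), by rw [h, L_false]⟩

lemma tau_W2 (a : Letter k) (A : Set (Letter k)) : IsWhitehead2 (psi a A)⁻¹ := by
  refine ⟨L (linv a), L_mem_letterSet _, ?_, ?_⟩
  · rw [L_linv, map_inv, tau_a]
  · intro x hx
    obtain ⟨x, rfl⟩ := letterSet_eq hx
    rw [tau_L]
    rcases ee_cases a A x with h | h <;> rcases ee_cases a A (linv x) with h' | h' <;>
      rw [h, h', L_linv] <;> simp

lemma inner_case {a : Letter k} {A : Set (Letter k)} (ha : a ∈ A) (ha' : linv a ∉ A)
    (hin : IsInner (psi a A)⁻¹) : A = {a} ∨ A = {linv a}ᶜ := by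
  by_contra hcon
  push Not at hcon
  have same : ∀ s : Letter k, s ≠ a → s ≠ linv a → s.1 ≠ a.1 := by
    intro s h1 h2 h
    rcases s with ⟨i, b⟩; rcases a with ⟨j, d⟩
    simp only at h; subst h
    cases b <;> cases d <;> simp [linv] at h1 h2
  obtain ⟨x, hxA, hxa⟩ : ∃ x ∈ A, x ≠ a := by
    by_contra h; push Not at h
    exact hcon.1 (Set.eq_singleton_iff_unique_mem.2 ⟨ha, h⟩)
  obtain ⟨y, hyA, hya⟩ : ∃ y, y ∉ A ∧ y ≠ linv a := by
    by_contra h; push Not at h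
    apply hcon.2
    ext s
    simp only [Set.mem_compl_iff, Set.mem_singleton_iff]
    constructor
    · rintro hs rfl; exact ha' hs
    · intro hs; by_contra h2; exact hs (h s h2)
  have hx1 := same x hxa (fun h => ha' (h ▸ hxA))
  have hy1 := same y (fun h => hyA (h ▸ ha)) hya
  obtain ⟨g, hg⟩ := hin
  have hex : ∀ s : Letter k, ez a.1 (ee a A s) = ez a.1 (ee a A (linv s)) := by
    intro s
    have h1 := tau_L a A s
    rw [hg, MulAut.conj_apply] at h1
    have := congrArg (ez a.1) h1
    simp only [ez_mul, ez_inv] at this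
    linarith
  have hne : ez a.1 (L a) ≠ 0 := by rcases ez_L_self a with h | h <;> rw [h] <;> norm_num
  have hxe : ee a A (linv x) = L a := by
    rcases ee_cases a A (linv x) with h | h
    · have := hex x
      rw [h, ee_mem a A hx1 hxA, ez_one] at this
      exact absurd this hne
    · exact h
  have hye : ee a A (linv y) = 1 := by
    rcases ee_cases a A (linv y) with h | h
    · exact h
    · have := hex y
      rw [h, ee_not_mem a A hyA, ez_one] at this
      exact absurd this.symm hne
  have c1 : Commute g (L a) := by
    have h1 := tau_a a A
    rw [hg, MulAut.conj_apply, mul_inv_eq_iff_eq_mul] at h1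
    exact h1
  have c2 : Commute g (L y) := by
    have h1 := tau_L a A y
    rw [hg, MulAut.conj_apply, hye, ee_not_mem a A hyA, mul_inv_eq_iff_eq_mul] at h1
    simpa [Commute, SemiconjBy] using h1
  have hg1 : g = 1 := comm_two (Ne.symm hy1) c1 c2
  have h1 := tau_L a A x
  rw [hg, MulAut.conj_apply, hxe, ee_mem a A hx1 hxA, hg1] at h1
  refine not_comm (Ne.symm hx1) (x := a) (y := x) ?_
  have h2 : L x = L a * L x * (L a)⁻¹ := by simpa using h1
  rw [eq_mul_inv_iff_mul_eq] at h2
  exact h2.symm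

lemma VA_single (a : Letter k) : VA {a} = U a := by
  ext g; simp [mem_VA]

lemma VA_co (a : Letter k) : FE (VA {linv a}ᶜ) (U (linv a))ᶜ := by
  apply FE_off_one
  intro u hu
  obtain ⟨z, hz⟩ := exists_U hu
  rw [mem_VA_of_U hz]
  simp only [Set.mem_compl_iff, Set.mem_singleton_iff]
  constructor
  · intro h h'; exact h (U_disj hz h')
  · rintro h rfl; exact h hz

theorem MC {w : FG k} (hw : w ∈ SM k) (a : Letter k) (A : Set (Letter k)) (ha : a ∈ A)
    (ha' : linv a ∉ A) : c w (U a) ≤ c w (VA A) ∧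
      (c w (VA A) ≤ c w (U a) → A = {a} ∨ A = {linv a}ᶜ) := by
  by_cases hin : IsInner (psi a A)⁻¹
  · have h := inner_case ha ha' hin
    refine ⟨?_, fun _ => h⟩
    rcases h with h | h
    · rw [h, VA_single]
    · rw [h, c_FE w (VA_off _) (VA_co a), c_compl, c_U_linv]
  · have h1 := hw.2 _ (tau_W2 a A) hin
    have h2 := cyclicLength_le ((psi a A)⁻¹ w)
    have h3 := sum_c_cyc hw.1
    have h4 : (wordLength w : ℝ) < cyclicLength ((psi a A)⁻¹ w) := by exact_mod_cast h1
    have hpt : psi a A ((psi a A)⁻¹ w) = w := by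
      rw [← MulAut.mul_apply, mul_inv_cancel, MulAut.one_apply]
    have hne : ∀ j, j ≠ a.1 → c ((psi a A)⁻¹ w) (U (j, true)) = c w (U (j, true)) := by
      intro j hj
      have : U (j, true) = psi a A ⁻¹' (tr (ee a A (j, true))⁻¹ (U (j, true))) := by
        ext g; exact psi_U_ne hj g
      rw [this, c_map, hpt, c_tr, ← this]
    have haa : ∀ v : FG k, c v (U (a.1, true)) = c v (U a) := by
      intro v
      rcases a with ⟨i, b⟩
      cases b
      · exact c_U_linv v (i, false)
      · rfl
    have he : c ((psi a A)⁻¹ w) (U (a.1, true)) = c w (VA A) := by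
      have : U a = psi a A ⁻¹' VA A := by
        ext g; exact psi_U_a ha ha' g
      rw [haa, this, c_map, hpt]
    rw [← Finset.add_sum_erase _ _ (Finset.mem_univ a.1), he,
      Finset.sum_congr rfl (fun j hj => hne j (Finset.ne_of_mem_erase hj))] at h2
    rw [← Finset.add_sum_erase _ _ (Finset.mem_univ a.1), haa] at h3
    have : c w (U a) < c w (VA A) := by linarith
    exact ⟨this.le, fun h => absurd this (not_lt.2 h)⟩

end WH

namespace WH
open Filter Topology
variable {k : ℕ}

def Supp (V : Set (FG k)) (K : Finset (FG k)) : Prop :=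
  ∀ g z, g ∉ K → g * L z ∉ K → (g ∈ V ↔ g * L z ∈ V)

def Sep (a : Letter k) (V : Set (FG k)) : Prop :=
  ∀ᶠ n : ℕ in atTop, L a ^ n ∈ V ∧ L (linv a) ^ n ∉ V

def Sub (S R : Set (FG k)) : Prop := ∀ᶠ u in cofinite, u ∈ S → u ∈ R
def Nest (V W : Set (FG k)) : Prop := Sub V W ∨ Sub V Wᶜ ∨ Sub Vᶜ W ∨ Sub Vᶜ Wᶜ

lemma Sub.trans {S R Q : Set (FG k)} (h : Sub S R) (h' : Sub R Q) : Sub S Q := by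
  filter_upwards [h, h'] with u hu hu' using fun h => hu' (hu h)
lemma Sub.tr {S R : Set (FG k)} (h : Sub S R) (g : FG k) : Sub (tr g S) (tr g R) := tr_cof h
lemma Sub.of {S R : Set (FG k)} (h : S ⊆ R) : Sub S R := Eventually.of_forall fun _ hu => h hu
lemma Sub.not_compl {S R : Set (FG k)} (h : Sub S R) (h' : Sub S Rᶜ)
    (hi : ∃ᶠ u in cofinite, u ∈ S) : False := by
  apply hi
  filter_upwards [h, h'] with u h1 h2 h3
  exact h2 h3 (h1 h3)
lemma FE.sub {S R : Set (FG k)} (h : FE S R) : Sub S R := by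
  filter_upwards [h] with u hu using hu.1
lemma Sub.FE {S R : Set (FG k)} (h : Sub S R) (h' : Sub R S) : FE S R := by
  filter_upwards [h, h'] with u h1 h2 using ⟨h1, h2⟩

lemma Nest.FE {V V' W W' : Set (FG k)} (h : Nest V W) (h1 : FE V V') (h2 : FE W W') :
    Nest V' W' := by
  rcases h with h | h | h | h
  · exact Or.inl (h1.symm.sub.trans (h.trans h2.sub))
  · exact Or.inr (Or.inl (h1.symm.sub.trans (h.trans h2.compl.sub)))
  · exact Or.inr (Or.inr (Or.inl (h1.compl.symm.sub.trans (h.trans h2.sub))))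
  · exact Or.inr (Or.inr (Or.inr (h1.compl.symm.sub.trans (h.trans h2.compl.sub))))

lemma Nest.tr {V W : Set (FG k)} (h : Nest V W) (g : FG k) : Nest (tr g V) (tr g W) := by
  rcases h with h | h | h | h
  · exact Or.inl (h.tr g)
  · exact Or.inr (Or.inl (h.tr g))
  · exact Or.inr (Or.inr (Or.inl (h.tr g)))
  · exact Or.inr (Or.inr (Or.inr (h.tr g)))

lemma Nest.compl {V W : Set (FG k)} (h : Nest V W) : Nest Vᶜ Wᶜ := by
  unfold Nest at *
  rw [compl_compl, compl_compl]
  tauto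

def NestSelf (V : Set (FG k)) : Prop := ∀ g, Nest V (tr g V)
lemma NestSelf.compl {V : Set (FG k)} (h : NestSelf V) : NestSelf Vᶜ := fun g => by
  rw [tr_compl]; exact (h g).compl
lemma NestSelf.FE {V W : Set (FG k)} (h : NestSelf V) (h' : FE V W) : NestSelf W :=
  fun g => (h g).FE h' (h'.tr g)

lemma Supp.AI {V : Set (FG k)} {K : Finset (FG k)} (h : Supp V K) : AI V := by
  apply AI_of_letters
  intro z
  refine (K.finite_toSet.union (K.finite_toSet.image (fun u => u * (L z)⁻¹))).subset ?_
  intro g hg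
  by_cases h1 : g ∈ K
  · exact Or.inl h1
  · by_cases h2 : g * L z ∈ K
    · exact Or.inr ⟨g * L z, h2, by simp⟩
    · exact absurd (h g z h1 h2) hg

lemma AI.exists_Supp {V : Set (FG k)} (h : AI V) : ∃ K, Supp V K := by
  classical
  have hf : (⋃ z : Letter k, Dl V (L z)).Finite := Set.finite_iUnion fun z => h (L z)
  refine ⟨hf.toFinset, fun g z hg _ => ?_⟩
  rw [Set.Finite.mem_toFinset, Set.mem_iUnion] at hg
  push Not at hg
  have := hg z
  rw [mem_Dl, not_not] at this
  exact this

lemma Supp.compl {V : Set (FG k)} {K : Finset (FG k)} (h : Supp V K) : Supp Vᶜ K := by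
  intro g z h1 h2
  exact not_congr (h g z h1 h2)

lemma Sep.compl {V : Set (FG k)} {a : Letter k} (h : Sep a V) : Sep (linv a) Vᶜ := by
  filter_upwards [h] with n hn
  rw [linv_linv]
  exact ⟨hn.2, fun h => h hn.1⟩

lemma Supp.cone {V : Set (FG k)} {K : Finset (FG k)} (h : Supp V K) {v : FG k} {z : Letter k}
    (hK : ∀ p ∈ U z, v * p ∉ K) {p : FG k} (hp : p ∈ U z) : v * p ∈ V ↔ v * L z ∈ V := by
  obtain ⟨t, ht⟩ : ∃ t, p.toWord = z :: t := by
    rw [mem_U] at hp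
    rcases hw : p.toWord with _ | ⟨y, t⟩
    · rw [hw] at hp; simp at hp
    · rw [hw] at hp; simp at hp; exact ⟨t, by rw [hp]⟩
  induction t using List.reverseRecOn generalizing p with
  | nil =>
    have : p = L z := by rw [← FreeGroup.mk_toWord (x := p), ht]; rfl
    rw [this]
  | append_singleton t s ih =>
    have e : p = FreeGroup.mk (z :: t) * L s := by
      rw [← FreeGroup.mk_toWord (x := p), ht, L, FreeGroup.mul_mk]; rfl
    have hr : FreeGroup.IsReduced (z :: t) := by
      have h1 : FreeGroup.IsReduced (z :: (t ++ [s])) := by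
        rw [← ht]; exact FreeGroup.isReduced_toWord
      unfold FreeGroup.IsReduced at h1 ⊢
      exact List.IsChain.left_of_append (l₂ := [s]) (by simpa using h1)
    have hw : (FreeGroup.mk (z :: t)).toWord = z :: t := by
      rw [FreeGroup.toWord_mk, hr.reduce_eq]
    have hU : FreeGroup.mk (z :: t) ∈ U z := by rw [mem_U, hw]; rfl
    rw [← ih hU hw, e, ← mul_assoc]
    symm
    apply h
    · exact hK _ hU
    · rw [mul_assoc, ← e]; exact hK _ hp

section step
variable {V : Set (FG k)} {K : Finset (FG k)} {v : FG k} {x : Letter k}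

lemma H_word (hx : v⁻¹ ∈ U x) {p : FG k} (hp : p ∉ U x) : (v * p).toWord = v.toWord ++ p.toWord := by
  by_cases h1 : p = 1
  · simp [h1]
  · obtain ⟨z, hz⟩ := exists_U h1
    refine nocancel hz fun h => hp ?_
    rw [U_disj hx h]; exact hz

lemma H_not_K (hmax : ∀ u ∈ K, wordLength u ≤ wordLength v) (hx : v⁻¹ ∈ U x) {z : Letter k}
    (hz : z ≠ x) : ∀ p ∈ U z, v * p ∉ K := by
  intro p hp hK
  have h1 := hmax _ hK
  unfold wordLength at h1
  rw [H_word hx (fun h => hz (U_disj hp h)), List.length_append] at h1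
  have : p.toWord = [] := List.length_eq_zero_iff.1 (by omega)
  rw [mem_U, this] at hp
  simp at hp

lemma pow_H (hx : v⁻¹ ∈ U x) (b : Letter k) {n : ℕ} (hn : wordLength v < n)
    (h : v⁻¹ * L b ^ n ∉ U x) : v⁻¹ * L b ^ n ∈ U (linv x) := by
  have h1 := H_word hx h
  rw [mul_inv_cancel_left, L_pow_toWord] at h1
  have h2 := (List.append_eq_replicate_iff.1 h1.symm)
  obtain ⟨h3, h4, h5⟩ := h2
  have hvn : v.toWord ≠ [] := by
    intro h
    rw [FreeGroup.toWord_eq_nil_iff] at h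
    rw [h, inv_one] at hx
    exact one_not_mem_U x hx
  have hv : v = L b ^ v.toWord.length := by
    apply FreeGroup.toWord_injective
    rw [L_pow_toWord]; exact h4
  have hxb : x = linv b := by
    refine U_disj hx ?_
    rw [hv, ← inv_pow, ← L_linv]
    exact L_pow_mem (by simpa using hvn)
  unfold wordLength at hn
  rw [hxb, linv_linv, mem_U, h5]
  obtain ⟨m, hm⟩ : ∃ m, (v⁻¹ * L b ^ n).toWord.length = m + 1 := ⟨_, (Nat.succ_pred_eq_of_pos (by omega)).symm⟩
  rw [hm, List.replicate_succ]; rfl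

variable (hS : Supp V K) (hv : v ∈ K) (hmax : ∀ u ∈ K, wordLength u ≤ wordLength v)
  (hx : v⁻¹ ∈ U x) (hy : v * L (linv x) ∈ V)

open Classical in
lemma step_supp (hS : Supp V K) :
    Supp (V ∪ tr v (U x)ᶜ) (insert (v * L x) (K.erase v)) := by
  intro g z h1 h2
  simp only [Finset.mem_insert, Finset.mem_erase, not_or, not_and] at h1 h2
  have hH : g ∈ tr v (U x)ᶜ ↔ g * L z ∈ tr v (U x)ᶜ := by
    rw [mem_tr, mem_tr, Set.mem_compl_iff, Set.mem_compl_iff, not_iff_not, ← mul_assoc, U_change']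
    rintro (⟨h, rfl⟩ | ⟨h, rfl⟩)
    · apply h2.1
      rw [inv_mul_eq_one.1 h]
    · apply h1.1; rw [← h]; simp
  have hvH : v ∈ tr v (U x)ᶜ := by
    rw [mem_tr, inv_mul_cancel]; exact one_not_mem_U x
  by_cases hg : g ∈ tr v (U x)ᶜ
  · simp [Set.mem_union, hg, hH.1 hg]
  · have hg' := mt hH.2 hg
    have hV := hS g z (h1.2 fun h => hg (h ▸ hvH)) (h2.2 fun h => hg' (h ▸ hvH))
    simp only [Set.mem_union, hg, hg', or_false, hV]

lemma len_lt (hx : v⁻¹ ∈ U x) : wordLength (v * L x) < wordLength v := by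
  have h1 : wordLength v = wordLength v⁻¹ := (FreeGroup.norm_inv_eq (x := v)).symm
  have h2 : wordLength (v * L x) = wordLength (v * L x)⁻¹ :=
    (FreeGroup.norm_inv_eq (x := v * L x)).symm
  rw [h1, h2, mul_inv_rev, ← L_linv]
  rcases toWord_L_mul (linv x) v⁻¹ with ⟨_, h⟩ | ⟨h, _⟩
  · unfold wordLength; rw [h]; simp
  · rw [linv_linv] at h; exact absurd hx h

open Classical in
lemma step_meas (hv : v ∈ K) (hx : v⁻¹ ∈ U x) :
    ∑ u ∈ insert (v * L x) (K.erase v), wordLength u < ∑ u ∈ K, wordLength u := by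
  have h1 := len_lt hx
  rw [← Finset.add_sum_erase K wordLength hv]
  have h2 : ∑ u ∈ insert (v * L x) (K.erase v), wordLength u
      ≤ wordLength (v * L x) + ∑ u ∈ K.erase v, wordLength u := by
    by_cases h : v * L x ∈ K.erase v
    · rw [Finset.insert_eq_of_mem h]; omega
    · rw [Finset.sum_insert h]
  omega

include hS hmax hx hy in
lemma step_pow (b : Letter k) {n : ℕ} (hn : wordLength v < n) (h : L b ^ n ∈ tr v (U x)ᶜ) :
    L b ^ n ∈ V := by
  have h1 := pow_H hx b hn h
  have h2 := (hS.cone (H_not_K hmax hx (linv_ne x)) h1).2 hy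
  rwa [mul_inv_cancel_left] at h2

include hS hmax hx hy in
lemma step_sep {a : Letter k} (ha : Sep a V) : Sep a (V ∪ tr v (U x)ᶜ) := by
  filter_upwards [ha, eventually_gt_atTop (wordLength v)] with n hn hn2
  refine ⟨Or.inl hn.1, ?_⟩
  rintro (h | h)
  · exact hn.2 h
  · exact hn.2 (step_pow hS hmax hx hy _ hn2 h)

def AA (V : Set (FG k)) (v : FG k) (x : Letter k) : Set (Letter k) := {z | z ≠ x ∧ v * L z ∈ V}

include hS hmax hx in
lemma step_FE : FE (V ∩ tr v (U x)ᶜ) (tr v (VA (AA V v x))) := by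
  have : ∀ᶠ u : FG k in cofinite, u ≠ v := (Set.finite_singleton v).compl_mem_cofinite
  filter_upwards [this] with u hu
  have hp : v⁻¹ * u ≠ 1 := fun h => hu (inv_mul_eq_one.1 h).symm
  obtain ⟨z, hz⟩ := exists_U hp
  rw [mem_tr, mem_VA_of_U hz, Set.mem_inter_iff, mem_tr, Set.mem_compl_iff]
  have e : u = v * (v⁻¹ * u) := by simp
  constructor
  · rintro ⟨h1, h2⟩
    have hzx : z ≠ x := fun h => h2 (h ▸ hz)
    refine ⟨hzx, (hS.cone (H_not_K hmax hx hzx) hz).1 ?_⟩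
    rwa [← e]
  · rintro ⟨hzx, h1⟩
    refine ⟨?_, fun h => hzx (U_disj hz h)⟩
    have := (hS.cone (H_not_K hmax hx hzx) hz).2 h1
    rwa [← e] at this

include hS hmax hx hy in
lemma step_c {w : FG k} (hw : w ∈ SM k) : c w (V ∪ tr v (U x)ᶜ) ≤ c w V ∧
    (c w V ≤ c w (V ∪ tr v (U x)ᶜ) → FE V (V ∪ tr v (U x)ᶜ) ∨
      ∀ᶠ u in cofinite, u ∉ U x → (v * u ∈ V ↔ u ∈ U (linv x))) := by
  have hF := step_FE hS hmax hx
  have hHA : AI (tr v (U x)ᶜ) := (AI_U x).compl.tr v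
  have h1 := c_submod w hS.AI hHA
  rw [c_FE w (hS.AI.inter hHA) hF, c_tr, c_tr, c_compl, ← c_U_linv w x] at h1
  have hyA : linv x ∈ AA V v x := ⟨linv_ne x, hy⟩
  have hxA : linv (linv x) ∉ AA V v x := by rw [linv_linv]; exact fun h => h.1 rfl
  have h2 := MC hw (linv x) (AA V v x) hyA hxA
  refine ⟨by linarith [h2.1], fun h3 => ?_⟩
  rcases h2.2 (by linarith) with h4 | h4
  · right
    rw [h4, VA_single] at hF
    have := tr_cof (g := v⁻¹) hF
    filter_upwards [this] with u hu hux
    simp only [Set.mem_inter_iff, mem_tr, inv_inv, inv_mul_cancel_left, Set.mem_compl_iff] at hu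
    tauto
  · left
    rw [h4] at hF
    have h5 := (VA_co (linv x)).tr v
    rw [linv_linv] at h5 hF
    filter_upwards [hF, h5] with u hu hu'
    rw [Set.mem_union]
    rw [hu', Set.mem_inter_iff] at hu
    tauto
end step

lemma far (K : Finset (FG k)) (v : FG k) (x : Letter k) :
    ∃ N : ℕ, ∀ p ∈ U x, v * L x ^ N * p ∉ K := by
  refine ⟨K.sup (fun u => wordLength (v⁻¹ * u)), fun p hp hK => ?_⟩
  have h1 := Finset.le_sup (f := fun u => wordLength (v⁻¹ * u)) hK
  set N := K.sup (fun u => wordLength (v⁻¹ * u))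
  have e : v⁻¹ * (v * L x ^ N * p) = L x ^ N * p := by group
  have h2 : (L x ^ N)⁻¹ ∉ U x := by
    rw [← inv_pow, ← L_linv]
    rcases Nat.eq_zero_or_pos N with h | h
    · rw [h, pow_zero]; exact one_not_mem_U x
    · exact fun h' => linv_ne x (U_disj (L_pow_mem h.ne') h')
  simp only [e, wordLength, nocancel hp h2, L_pow_toWord, List.length_append,
    List.length_replicate] at h1
  have : p.toWord = [] := List.length_eq_zero_iff.1 (by omega)
  rw [mem_U, this] at hp
  simp at hp

lemma mul_mem_U {z : Letter k} {u : FG k} (h : u ∉ U (linv z)) : L z * u ∈ U z := by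
  rcases toWord_L_mul z u with ⟨h1, _⟩ | ⟨_, h1⟩
  · exact absurd h1 h
  · rw [mem_U, h1]; rfl

lemma pow_mul_mem {z : Letter k} {u : FG k} (h : u ∉ U (linv z)) {n : ℕ} (hn : n ≠ 0) :
    L z ^ n * u ∈ U z := by
  obtain ⟨n, rfl⟩ := Nat.exists_eq_succ_of_ne_zero hn
  induction n with
  | zero => simpa using mul_mem_U h
  | succ n ih =>
    rw [pow_succ', mul_assoc]
    exact mul_mem_U fun h' => ne_linv z (U_disj (ih (by omega)) h')

lemma decomp {x : Letter k} {u : FG k} (hu : u ∈ U x) (n : ℕ) :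
    (∃ i, 1 ≤ i ∧ i ≤ n ∧ u ∈ tr (L x ^ i) {u | u ∉ U x ∧ u ∉ U (linv x)}) ∨
      u ∈ tr (L x ^ n) (U x) := by
  induction n with
  | zero => right; rw [pow_zero, tr_one]; exact hu
  | succ n ih =>
    rcases ih with ⟨i, h1, h2, h3⟩ | h
    · exact Or.inl ⟨i, h1, by omega, h3⟩
    · rw [mem_tr, mem_U_flip, L_linv] at h
      have e : (L x)⁻¹ * ((L x ^ n)⁻¹ * u) = (L x ^ (n + 1))⁻¹ * u := by
        rw [pow_succ]; group
      rw [e] at h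
      by_cases h2 : (L x ^ (n + 1))⁻¹ * u ∈ U x
      · exact Or.inr h2
      · exact Or.inl ⟨n + 1, by omega, le_rfl, h2, h⟩

lemma exists_third (hk : 2 ≤ k) (x : Letter k) : ∃ m : Letter k, m.1 ≠ x.1 := by
  by_cases h : x.1 = ⟨0, by omega⟩
  · exact ⟨(⟨1, by omega⟩, true), by rw [h]; simp⟩
  · exact ⟨(⟨0, by omega⟩, true), fun h' => h h'.symm⟩

lemma final_case (hk : 2 ≤ k) {x : Letter k} {V : Set (FG k)}
    (h1 : ∀ᶠ u in cofinite, u ∉ U x → (u ∈ V ↔ u ∈ U (linv x))) (hn : NestSelf V) {N : ℕ}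
    (hT : (∀ p ∈ U x, L x ^ N * p ∈ V) ∨ (∀ p ∈ U x, L x ^ N * p ∉ V)) :
    FE V (U (linv x)) ∨ Sub (U x) V := by
  set B : Set (FG k) := {u | u ∉ U x ∧ u ∉ U (linv x)} with hB
  obtain ⟨m, hm⟩ := exists_third hk x
  have hmx : m ≠ x := fun h => hm (by rw [h])
  have hmy : m ≠ linv x := fun h => hm (by rw [h]; rfl)
  have hmB : U m ⊆ B := fun u hu => ⟨fun h => hmx (U_disj hu h), fun h => hmy (U_disj hu h)⟩
  have hBinf : ∀ n : ℕ, ∃ᶠ u in cofinite, u ∈ tr (L x ^ n) B := fun n =>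
    tr_freq ((U_infinite m).mono fun u hu => hmB hu)
  have hUy : Sub (U (linv x)) V := by
    filter_upwards [h1] with u hu h2
    exact (hu fun h => ne_linv x (U_disj h h2)).2 h2
  have hBZ : Sub B Vᶜ := by
    filter_upwards [h1] with u hu h2
    exact fun h => h2.2 ((hu h2.1).1 h)
  -- alternatives
  have hinv : ∀ n : ℕ, (L x ^ n)⁻¹ = L (linv x) ^ n := fun n => by rw [L_linv, inv_pow]
  have alt : ∀ n : ℕ, n ≠ 0 → Sub (tr (L x ^ n) Vᶜ) Vᶜ ∨ Sub (tr (L x ^ n) Vᶜ) V := by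
    intro n hn0
    have hW := hUy.tr (L x ^ n)
    have i1 : Sub (U (linv x)) (tr (L x ^ n) V) := by
      refine (Sub.of ?_).trans hW
      intro u hu
      rw [mem_tr, hinv]
      exact pow_mul_mem (fun h => (linv_ne _) (U_disj h hu)) hn0
    have i2 : Sub (U m) (tr (L x ^ n) V) := by
      refine (Sub.of ?_).trans hW
      intro u hu
      rw [mem_tr, hinv]
      refine pow_mul_mem (fun h => ?_) hn0
      rw [linv_linv] at h
      exact hmx (U_disj hu h)
    rcases hn (L x ^ n) with h | h | h | h
    · left
      filter_upwards [h] with u hu h2 h3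
      exact h2 (hu h3)
    · exact ((i1.not_compl (hUy.trans h)) (U_infinite _)).elim
    · right
      filter_upwards [h] with u hu h2
      by_contra h3
      exact h2 (hu h3)
    · exact ((i2.not_compl (((Sub.of hmB).trans hBZ).trans h)) (U_infinite _)).elim
  have hBn : ∀ n, Sub (tr (L x ^ n) B) (tr (L x ^ n) Vᶜ) := fun n => hBZ.tr _
  have iter : ∀ n, Sub (tr (L x ^ n) Vᶜ) Vᶜ → ∀ j, Sub (tr (L x ^ (n * j)) Vᶜ) Vᶜ := by
    intro n h j
    induction j with
    | zero => rw [mul_zero, pow_zero, tr_one]; exact Sub.of subset_rfl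
    | succ j ih =>
      have := ih.tr (L x ^ n)
      rw [tr_tr, ← pow_add] at this
      rw [mul_add, mul_one, add_comm]
      exact this.trans h
  have hTsub : ∀ n, N < n → tr (L x ^ n) B ⊆ tr (L x ^ N) (U x) := by
    intro n hnN u hu
    obtain ⟨d, rfl⟩ := Nat.exists_eq_add_of_lt hnN
    rw [mem_tr] at hu ⊢
    have e : (L x ^ N)⁻¹ * u = L x ^ (d + 1) * ((L x ^ (N + d + 1))⁻¹ * u) := by
      rw [add_assoc, pow_add (L x) N]; group
    rw [e]
    exact pow_mul_mem hu.2 (by omega)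
  have hT' : tr (L x ^ N) (U x) ⊆ V ∨ tr (L x ^ N) (U x) ⊆ Vᶜ := by
    rcases hT with h | h
    · left; intro u hu
      have := h _ hu
      rwa [mul_inv_cancel_left] at this
    · right; intro u hu
      have := h _ hu
      rwa [mul_inv_cancel_left] at this
  have finish : ∀ S : Set (FG k), (tr (L x ^ N) (U x) ⊆ S ∨ tr (L x ^ N) (U x) ⊆ Sᶜ) →
      (∀ n, 1 ≤ n → Sub (tr (L x ^ n) B) S) → Sub (U x) S := by
    intro S hS hall
    have hTS : tr (L x ^ N) (U x) ⊆ S := by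
      rcases hS with h | h
      · exact h
      · exact ((hall (N + 1) (by omega)).not_compl
          (Sub.of ((hTsub (N + 1) (by omega)).trans h)) (hBinf _)).elim
    have hfin : ∀ᶠ u in cofinite, ∀ i ∈ Finset.Icc 1 N, u ∈ tr (L x ^ i) B → u ∈ S := by
      rw [Filter.eventually_all_finset]
      intro i hi
      exact hall i (Finset.mem_Icc.1 hi).1
    filter_upwards [hfin] with u hu hux
    rcases decomp hux N with ⟨i, h2, h3, h4⟩ | h
    · exact hu i (Finset.mem_Icc.2 ⟨h2, h3⟩) h4
    · exact hTS h
  rcases alt 1 one_ne_zero with h | h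
  · left
    have hsub : Sub (U x) Vᶜ := by
      refine finish Vᶜ (by rw [compl_compl]; exact hT'.symm) fun n _ => ?_
      have := iter 1 h n
      rw [one_mul] at this
      exact (hBn n).trans this
    filter_upwards [hsub, h1] with u h2 h3
    by_cases hux : u ∈ U x
    · constructor
      · intro h4; exact absurd h4 (h2 hux)
      · intro h4; exact absurd (U_disj hux h4) (ne_linv x)
    · exact h3 hux
  · right
    refine finish V hT' fun n hn1 => ?_
    rcases alt n (by omega) with h2 | h2
    · exfalso
      have h3 := iter n h2 (N + 1)
      set M := n * (N + 1) with hM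
      have hMN : N < M := by rw [hM]; nlinarith
      have hTZ : tr (L x ^ N) (U x) ⊆ Vᶜ := by
        rcases hT' with h | h
        · exact (Sub.not_compl (Sub.of ((hTsub M hMN).trans h)) ((hBn M).trans h3) (hBinf M)).elim
        · exact h
      have h4 := ((hBn M).trans h3).tr (L x ^ 1)
      rw [tr_tr, ← pow_add] at h4
      exact Sub.not_compl (h4.trans h) (Sub.of ((hTsub _ (by omega)).trans hTZ)) (hBinf _)
    · exact (hBn n).trans h2

lemma pow_cof {g : FG k} (hg : g ≠ 1) {P : FG k → Prop} (h : ∀ᶠ u in cofinite, P u) :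
    ∀ᶠ n : ℕ in atTop, P (g ^ n) := by
  rw [← Nat.cofinite_eq_atTop]
  exact (pow_inj hg).tendsto_cofinite.eventually h

lemma base_case {V : Set (FG k)} {K : Finset (FG k)} (hS : Supp V K) (hK : ∀ u ∈ K, u = 1)
    {a : Letter k} (ha : Sep a V) : ∃ A : Set (Letter k), a ∈ A ∧ linv a ∉ A ∧ FE V (VA A) := by
  have hc : ∀ z, ∀ p ∈ U z, (p ∈ V ↔ L z ∈ V) := by
    intro z p hp
    have := hS.cone (v := 1) (z := z) (fun p hp h => by
      rw [one_mul] at h; rw [hK p h] at hp; exact one_not_mem_U z hp) hp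
    rwa [one_mul, one_mul] at this
  obtain ⟨n, hn, hn1⟩ := (ha.and (eventually_ge_atTop 1)).exists
  refine ⟨{z | L z ∈ V}, ?_, ?_, ?_⟩
  · exact (hc a _ (L_pow_mem (by omega))).1 hn.1
  · exact fun h => hn.2 ((hc _ _ (L_pow_mem (by omega))).2 h)
  · apply FE_off_one
    intro u hu
    obtain ⟨z, hz⟩ := exists_U hu
    rw [mem_VA_of_U hz, hc z u hz]; rfl

lemma pick {K : Finset (FG k)} (hK : ¬ ∀ u ∈ K, u = 1) :
    ∃ v ∈ K, (∀ u ∈ K, wordLength u ≤ wordLength v) ∧ ∃ x, v⁻¹ ∈ U x := by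
  push Not at hK
  obtain ⟨u, hu, hu1⟩ := hK
  obtain ⟨v, hv, hmax⟩ := Finset.exists_max_image K wordLength ⟨u, hu⟩
  refine ⟨v, hv, hmax, exists_U ?_⟩
  intro h
  rw [inv_eq_one] at h
  have := hmax u hu
  rw [h] at this
  simp only [wordLength, FreeGroup.toWord_one, List.length_nil, Nat.le_zero,
    List.length_eq_zero_iff, FreeGroup.toWord_eq_nil_iff] at this
  exact hu1 this

theorem weak {w : FG k} (hw : w ∈ SM k) (n : ℕ) : ∀ (a : Letter k) (V : Set (FG k))
    (K : Finset (FG k)), ∑ u ∈ K, wordLength u = n → Supp V K → Sep a V →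
    c w (U a) ≤ c w V := by
  classical
  induction n using Nat.strong_induction_on with
  | _ n ih =>
  intro a V K hKn hS ha
  by_cases hK : ∀ u ∈ K, u = 1
  · obtain ⟨A, h1, h2, h3⟩ := base_case hS hK ha
    rw [c_FE w hS.AI h3]
    exact (MC hw a A h1 h2).1
  · obtain ⟨v, hv, hmax, x, hx⟩ := pick hK
    by_cases hy : v * L (linv x) ∈ V
    · refine le_trans ?_ (step_c hS hmax hx hy hw).1
      exact ih _ (by rw [← hKn]; exact step_meas hv hx) a _ _ rfl (step_supp hS)
        (step_sep hS hmax hx hy ha)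
    · rw [← c_compl w V, ← c_U_linv]
      have hy' : v * L (linv x) ∈ Vᶜ := hy
      refine le_trans ?_ (step_c hS.compl hmax hx hy' hw).1
      exact ih _ (by rw [← hKn]; exact step_meas hv hx) (linv a) _ _ rfl (step_supp hS.compl)
        (step_sep hS.compl hmax hx hy' ha.compl)

lemma strict_final (hk : 2 ≤ k) {a : Letter k} {V : Set (FG k)} {K : Finset (FG k)}
    {v : FG k} {x : Letter k}
    (hS : Supp V K) (hmax : ∀ u ∈ K, wordLength u ≤ wordLength v)
    (hx : v⁻¹ ∈ U x) (hy : v * L (linv x) ∈ V) (ha : Sep a V) (hn : NestSelf V)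
    (h : ∀ᶠ u in cofinite, u ∉ U x → (v * u ∈ V ↔ u ∈ U (linv x))) :
    FE V (tr v (U (linv x))) := by
  obtain ⟨N, hN⟩ := far K v x
  have hmem : ∀ u, u ∈ tr v⁻¹ V ↔ v * u ∈ V := fun u => by rw [mem_tr, inv_inv]
  have hn' : NestSelf (tr v⁻¹ V) := by
    intro g
    have := (hn (v * g * v⁻¹)).tr v⁻¹
    rw [tr_tr] at this
    rw [tr_tr]
    convert this using 2
    group
  have hc := fun p (hp : p ∈ U x) => hS.cone (v := v * L x ^ N) hN hp
  have hT : (∀ p ∈ U x, L x ^ N * p ∈ tr v⁻¹ V) ∨ (∀ p ∈ U x, L x ^ N * p ∉ tr v⁻¹ V) := by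
    by_cases h2 : v * L x ^ N * L x ∈ V
    · left; intro p hp; rw [hmem, ← mul_assoc]; exact (hc p hp).2 h2
    · right; intro p hp; rw [hmem, ← mul_assoc]; exact fun h => h2 ((hc p hp).1 h)
  rcases final_case hk (V := tr v⁻¹ V) (by simpa only [hmem] using h) hn' hT with h2 | h2
  · have := h2.tr v
    rwa [tr_tr, mul_inv_cancel, tr_one] at this
  · exfalso
    have h3 : ∀ᶠ u in cofinite, u ∈ tr v (U x) → u ∈ V := by
      have := h2.tr v
      rwa [tr_tr, mul_inv_cancel, tr_one] at this
    obtain ⟨n, ⟨hn1, hn2⟩, hn3⟩ := ((ha.and (pow_cof (L_ne_one (linv a)) h3)).and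
      (eventually_gt_atTop (wordLength v))).exists
    by_cases h4 : L (linv a) ^ n ∈ tr v (U x)
    · exact hn1.2 (hn2 h4)
    · exact hn1.2 (step_pow hS hmax hx hy _ hn3 h4)

lemma FE_compl_half {V : Set (FG k)} (h : ∃ g z, FE Vᶜ (tr g (U z))) : ∃ g z, FE V (tr g (U z)) := by
  obtain ⟨g, z, h⟩ := h
  refine ⟨g * L z, linv z, ?_⟩
  have := h.compl
  rwa [compl_compl, ← tr_compl, U_compl, tr_tr] at this

theorem strict (hk : 2 ≤ k) {w : FG k} (hw : w ∈ SM k) (n : ℕ) : ∀ (a : Letter k) (V : Set (FG k))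
    (K : Finset (FG k)), ∑ u ∈ K, wordLength u = n → Supp V K → Sep a V → NestSelf V →
    c w V ≤ c w (U a) → ∃ g z, FE V (tr g (U z)) := by
  classical
  induction n using Nat.strong_induction_on with
  | _ n ih =>
  intro a V K hKn hS ha hN hle
  by_cases hK : ∀ u ∈ K, u = 1
  · obtain ⟨A, h1, h2, h3⟩ := base_case hS hK ha
    rw [c_FE w hS.AI h3] at hle
    rcases (MC hw a A h1 h2).2 hle with h | h
    · rw [h, VA_single] at h3
      exact ⟨1, a, by rwa [tr_one]⟩
    · rw [h] at h3
      have := h3.trans (VA_co a)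
      rw [U_compl] at this
      exact ⟨_, _, this⟩
  · obtain ⟨v, hv, hmax, x, hx⟩ := pick hK
    have key : ∀ (a : Letter k) (V : Set (FG k)), Supp V K → Sep a V → NestSelf V →
        c w V ≤ c w (U a) → v * L (linv x) ∈ V → ∃ g z, FE V (tr g (U z)) := by
      intro a V hS ha hN hle hy
      have hm := step_meas hv hx
      rw [hKn] at hm
      have hs' := step_supp (v := v) (x := x) hS
      have ha' := step_sep hS hmax hx hy ha
      have h1 := weak hw _ a _ _ rfl hs' ha'
      rcases (step_c hS hmax hx hy hw).2 (hle.trans h1) with h2 | h2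
      · obtain ⟨g, z, h3⟩ := ih _ hm a _ _ rfl hs' ha' (hN.FE h2)
          (((step_c hS hmax hx hy hw).1).trans hle)
        exact ⟨g, z, h2.trans h3⟩
      · exact ⟨_, _, strict_final hk hS hmax hx hy ha hN h2⟩
    by_cases hy : v * L (linv x) ∈ V
    · exact key a V hS ha hN hle hy
    · apply FE_compl_half
      exact key (linv a) Vᶜ hS.compl ha.compl hN.compl (by rwa [c_compl, c_U_linv]) hy

end WH

namespace WH
open Filter Topology
variable {k : ℕ}

lemma ez_aut (β : MulAut (FG k)) (j : Fin k) (g : FG k) :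
    ez j (β g) = ∑ i, ez i g * ez j (β (FreeGroup.of i)) := by
  induction g using FreeGroup.induction_on with
  | C1 => simp [ez_one]
  | of i => simp [ez_of]
  | inv_of i h => simp only [map_inv, ez_inv, h, neg_mul, Finset.sum_neg_distrib]
  | mul x y hx hy => simp only [map_mul, ez_mul, hx, hy, add_mul, Finset.sum_add_distrib]

def MM (β : MulAut (FG k)) : Matrix (Fin k) (Fin k) ℤ :=
  Matrix.of fun j i => ez j (β (FreeGroup.of i))

lemma MM_mul (β γ : MulAut (FG k)) : MM β * MM γ = MM (β * γ) := by
  ext j i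
  simp only [Matrix.mul_apply, MM, Matrix.of_apply, MulAut.mul_apply]
  rw [ez_aut β j (γ (FreeGroup.of i))]
  exact Finset.sum_congr rfl fun l _ => mul_comm _ _

lemma MM_one : MM (1 : MulAut (FG k)) = 1 := by
  ext j i
  simp only [MM, Matrix.of_apply, MulAut.one_apply, ez_of, Matrix.one_apply]
  by_cases h : i = j
  · simp [h]
  · simp [h, Ne.symm h]

lemma exists_perm (β : MulAut (FG k)) :
    ∃ σ : Equiv.Perm (Fin k), ∀ i, ez (σ i) (β (FreeGroup.of i)) ≠ 0 := by
  have h1 : (MM β).det ≠ 0 := by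
    intro h
    have := congrArg Matrix.det (MM_mul β β⁻¹)
    rw [Matrix.det_mul, h, mul_inv_cancel, MM_one, Matrix.det_one, zero_mul] at this
    exact zero_ne_one this
  rw [Matrix.det_apply] at h1
  obtain ⟨σ, _, hσ⟩ := Finset.exists_ne_zero_of_sum_ne_zero h1
  refine ⟨σ, fun i hi => hσ ?_⟩
  rw [Finset.prod_eq_zero (Finset.mem_univ i) hi, smul_zero]

lemma cancel_len {g h : FG k} {s : Letter k} (hg : g⁻¹ ∈ U s) (hh : h ∈ U s) :
    wordLength (g * h) < wordLength g + wordLength h := by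
  have h1 := len_lt hg
  have e : g * h = (g * L s) * (L (linv s) * h) := by rw [L_linv]; group
  have h2 : wordLength (L (linv s) * h) < wordLength h := by
    rcases toWord_L_mul (linv s) h with ⟨_, h2⟩ | ⟨h2, _⟩
    · unfold wordLength; rw [h2]; simp
    · rw [linv_linv] at h2; exact absurd hh h2
  have h3 := FreeGroup.norm_mul_le (g * L s) (L (linv s) * h)
  rw [← e] at h3
  unfold FreeGroup.norm at h3
  unfold wordLength at *
  omega

lemma ez_mk_zero {j : Fin k} (l : List (Letter k)) (h : ∀ z ∈ l, z.1 ≠ j) :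
    ez j (FreeGroup.mk l) = 0 := by
  induction l with
  | nil => exact ez_one j
  | cons z l ih =>
    have e : FreeGroup.mk (z :: l) = L z * FreeGroup.mk l := by rw [L, FreeGroup.mul_mk]; rfl
    rw [e, ez_mul, ez_L_ne (h z (by simp)), ih fun y hy => h y (by simp [hy]), add_zero]

lemma axis_cyc {u : FG k} (hu : IsCyclicallyReduced u) {j : Fin k} (hj : ez j u ≠ 0) :
    ∃ (P : FG k) (b : Bool), ∀ n : ℕ, 1 ≤ n →
      u ^ n ∈ tr P (U (j, b)) ∧ (u⁻¹) ^ n ∉ tr P (U (j, b)) := by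
  obtain ⟨z, hz, hzj⟩ : ∃ z ∈ u.toWord, z.1 = j := by
    by_contra h
    push Not at h
    apply hj
    rw [← FreeGroup.mk_toWord (x := u)]
    exact ez_mk_zero _ h
  obtain ⟨p, q, hpq⟩ := List.append_of_mem hz
  have hz' : z = (j, z.2) := by rw [← hzj]
  refine ⟨FreeGroup.mk p, z.2, fun n hn => ?_⟩
  rw [← hz']
  have hR : u = FreeGroup.mk p * FreeGroup.mk (z :: q) := by
    rw [FreeGroup.mul_mk, ← hpq, FreeGroup.mk_toWord]
  have hred : ∀ l : List (Letter k), FreeGroup.IsReduced (p ++ z :: l) →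
      FreeGroup.mk (z :: l) ∈ U z := by
    intro l hl
    have h2 : FreeGroup.IsReduced (z :: l) := by
      unfold FreeGroup.IsReduced at hl ⊢
      exact List.IsChain.right_of_append hl
    rw [mem_U, FreeGroup.toWord_mk, h2.reduce_eq]; rfl
  have hRU : FreeGroup.mk (z :: q) ∈ U z := by
    apply hred; rw [← hpq]; exact FreeGroup.isReduced_toWord
  constructor
  · obtain ⟨m, rfl⟩ : ∃ m, n = m + 1 := ⟨n - 1, by omega⟩
    have h1 := cyc_pow hu (m + 1)
    rw [List.replicate_succ, List.flatten_cons, hpq, List.append_assoc, List.cons_append] at h1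
    have h2 : FreeGroup.IsReduced (p ++ z :: (q ++ (List.replicate m (p ++ z :: q)).flatten)) := by
      rw [← h1]; exact FreeGroup.isReduced_toWord
    have h3 := hred _ h2
    rw [mem_tr]
    convert h3 using 1
    rw [inv_mul_eq_iff_eq_mul, FreeGroup.mul_mk, ← h1, FreeGroup.mk_toWord]
  · intro h
    rw [mem_tr] at h
    have e : (FreeGroup.mk p)⁻¹ * u⁻¹ ^ n = (u ^ n * FreeGroup.mk p)⁻¹ := by
      rw [mul_inv_rev, inv_pow]
    rw [e] at h
    have h1 := cancel_len h hRU
    rw [mul_assoc, ← hR, ← pow_succ, cyc_pow_length hu] at h1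
    have h2 := FreeGroup.norm_mul_le (u ^ n) (FreeGroup.mk p)
    have h3 := FreeGroup.norm_mk_le (L₁ := p)
    have h4 := FreeGroup.norm_mk_le (L₁ := z :: q)
    have h5 := cyc_pow_length hu n
    have h6 : wordLength u = p.length + (z :: q).length := by
      unfold wordLength; rw [hpq, List.length_append]
    unfold FreeGroup.norm at h2 h3 h4
    unfold wordLength at *
    have h7 : (n + 1) * u.toWord.length = n * u.toWord.length + u.toWord.length := by ring
    omega

lemma AI.eventually {V : Set (FG k)} (hV : AI V) {u : FG k} (hu : u ≠ 1) (h : FG k) :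
    ∀ᶠ n : ℕ in atTop, (u ^ n ∈ V ↔ u ^ n * h ∈ V) := by
  refine pow_cof hu (P := fun g => (g ∈ V ↔ g * h ∈ V)) ?_
  exact hV h

lemma axis {z : FG k} {j : Fin k} (hj : ez j z ≠ 0) :
    ∃ (t : FG k) (b : Bool), ∀ᶠ n : ℕ in atTop,
      z ^ n ∈ tr t (U (j, b)) ∧ (z⁻¹) ^ n ∉ tr t (U (j, b)) := by
  obtain ⟨x, u, hu, rfl⟩ := exists_cyc z
  have hju : ez j u ≠ 0 := by
    simp only [ez_mul, ez_inv] at hj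
    intro h; apply hj; rw [h]; ring
  have hu1 : u ≠ 1 := by rintro rfl; exact hju (ez_one j)
  obtain ⟨P, b, h⟩ := axis_cyc hu hju
  refine ⟨x * P, b, ?_⟩
  have hAI : AI (tr P (U (j, b))) := (AI_U _).tr P
  filter_upwards [hAI.eventually hu1 x⁻¹, hAI.eventually (inv_ne_one.2 hu1) x⁻¹,
    eventually_ge_atTop 1] with n h1 h2 h3
  have e1 : (x * u * x⁻¹) ^ n ∈ tr (x * P) (U (j, b)) ↔ u ^ n * x⁻¹ ∈ tr P (U (j, b)) := by
    rw [conj_pow, ← tr_tr, mem_tr]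
    simp [mul_assoc]
  have e2 : (x * u * x⁻¹)⁻¹ ^ n ∈ tr (x * P) (U (j, b)) ↔ u⁻¹ ^ n * x⁻¹ ∈ tr P (U (j, b)) := by
    have : (x * u * x⁻¹)⁻¹ = x * u⁻¹ * x⁻¹ := by group
    rw [this, conj_pow, ← tr_tr, mem_tr]
    simp [mul_assoc]
  rw [e1, e2, ← h1, ← h2]
  exact h n h3

lemma map_tr (β : MulAut (FG k)) (t : FG k) (X : Set (FG k)) :
    β ⁻¹' (tr t X) = tr (β⁻¹ t) (β ⁻¹' X) := by
  ext u
  simp [mem_tr, Set.mem_preimage, MulAut.apply_inv_self]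

lemma Nest.map {V W : Set (FG k)} (h : Nest V W) (β : MulAut (FG k)) :
    Nest (β ⁻¹' V) (β ⁻¹' W) := by
  have hm : ∀ {S R : Set (FG k)}, Sub S R → Sub (β ⁻¹' S) (β ⁻¹' R) := fun h =>
    β.injective.tendsto_cofinite.eventually h
  rcases h with h | h | h | h
  · exact Or.inl (hm h)
  · exact Or.inr (Or.inl (hm h))
  · exact Or.inr (Or.inr (Or.inl (hm h)))
  · exact Or.inr (Or.inr (Or.inr (hm h)))

lemma Nest_U (z : Letter k) : NestSelf (U z) := by
  intro g
  obtain ⟨s, h⟩ := HS g z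
  by_cases hs : s = z
  · subst hs
    rcases h with h | h
    · exact Or.inr (Or.inr (Or.inr (Sub.of (Set.compl_subset_compl.2 h))))
    · exact Or.inr (Or.inr (Or.inl (Sub.of (Set.compl_subset_comm.1 h))))
  · rcases h with h | h
    · exact Or.inr (Or.inl (Sub.of fun u hu hu' => hs (U_disj (h hu') hu)))
    · refine Or.inl (Sub.of fun u hu => ?_)
      by_contra hu'
      exact hs (U_disj (h hu') hu)

lemma NestSelf.tr {V : Set (FG k)} (h : NestSelf V) (t : FG k) : NestSelf (tr t V) := by
  intro g
  have := (h (t⁻¹ * g * t)).tr t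
  rw [tr_tr] at this
  rw [tr_tr]
  convert this using 2
  group

lemma NestSelf.map {V : Set (FG k)} (h : NestSelf V) (β : MulAut (FG k)) :
    NestSelf (β ⁻¹' V) := by
  intro g
  have := (h (β g)).map β
  rw [map_tr, MulAut.inv_apply_self] at this
  exact this

theorem images (hk : 2 ≤ k) {w : FG k} (hw : w ∈ SM k) {β : MulAut (FG k)} (hβ : β w = w)
    (j : Fin k) : ∃ g z, FE (β ⁻¹' U (j, true)) (tr g (U z)) := by
  obtain ⟨σ, hσ⟩ := exists_perm β
  choose t b htb using fun i => axis (hσ i)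
  have hAI : ∀ i, AI (β ⁻¹' (tr (t i) (U (σ i, b i)))) := fun i => ((AI_U _).tr _).map β
  have hb : ∀ j b, c w (U (j, b)) = c w (U (j, true)) := by
    intro j b
    cases b
    · exact c_U_linv w (j, true)
    · rfl
  have hc : ∀ i, c w (β ⁻¹' (tr (t i) (U (σ i, b i)))) = c w (U (σ i, true)) := by
    intro i
    rw [c_map, hβ, c_tr, hb]
  have hsep : ∀ i, Sep (i, true) (β ⁻¹' (tr (t i) (U (σ i, b i)))) := by
    intro i
    filter_upwards [htb i] with n hn
    rw [Set.mem_preimage, Set.mem_preimage, map_pow, map_pow, L_linv, map_inv, L_true]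
    exact hn
  have hle : ∀ i ∈ Finset.univ, c w (U (i, true)) ≤ c w (U (σ i, true)) := by
    intro i _
    obtain ⟨K, hK⟩ := (hAI i).exists_Supp
    rw [← hc i]
    exact weak hw _ _ _ K rfl hK (hsep i)
  have hsum : ∑ i, c w (U (i, true)) = ∑ i, c w (U (σ i, true)) :=
    (Equiv.sum_comp σ fun i => c w (U (i, true))).symm
  have heq := (Finset.sum_eq_sum_iff_of_le hle).1 hsum
  set i := σ.symm j with hi
  have hij : σ i = j := by simp [hi]
  obtain ⟨K, hK⟩ := (hAI i).exists_Supp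
  obtain ⟨g, z, h⟩ := strict hk hw _ (i, true) _ K rfl hK (hsep i) (((Nest_U _).tr _).map β)
    (by rw [hc i, heq i (Finset.mem_univ i)])
  rw [hij, map_tr] at h
  have h2 := h.tr (β⁻¹ (t i))⁻¹
  rw [tr_tr, inv_mul_cancel, tr_one, tr_tr] at h2
  cases hbi : b i
  · rw [hbi] at h2
    apply FE_compl_half
    have e : (U (j, true))ᶜ = tr (L (j, true)) (U (j, false)) := U_compl (j, true)
    rw [← Set.preimage_compl, e, map_tr]
    have h3 := h2.tr (β⁻¹ (L (j, true)))
    rw [tr_tr] at h3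
    exact ⟨_, _, h3⟩
  · rw [hbi] at h2
    exact ⟨_, _, h2⟩

end WH

namespace WH
open Filter Topology
variable {k : ℕ}

lemma third (hk : 2 ≤ k) (s q : Letter k) : ∃ m : Letter k, m ≠ s ∧ m ≠ q := by
  obtain ⟨m, hm⟩ := exists_third hk s
  by_cases h : m = q
  · refine ⟨linv m, ?_, ?_⟩
    · intro h'; apply hm; rw [← h']; rfl
    · rw [← h]; exact linv_ne m
  · exact ⟨m, fun h' => hm (by rw [h']), h⟩

lemma sub_U_compl {x s : Letter k} (h : x ≠ s) : Sub (U x) (U s)ᶜ :=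
  Sub.of fun _ hu hu' => h (U_disj hu hu')

lemma sub_U {x s : Letter k} (h : Sub (U x) (U s)) : x = s := by
  by_contra hne
  exact h.not_compl (sub_U_compl hne) (U_infinite x)

lemma no_cover (hk : 2 ≤ k) {s q : Letter k} (h : Sub (U s)ᶜ (U q)) : False := by
  obtain ⟨m, h1, h2⟩ := third hk s q
  exact h2 (sub_U ((sub_U_compl h1).trans h))

lemma Sub.refl (S : Set (FG k)) : Sub S S := Sub.of subset_rfl

lemma Sub.compl {S R : Set (FG k)} (h : Sub S R) : Sub Rᶜ Sᶜ := by
  filter_upwards [h] with u hu h1 h2 using h1 (hu h2)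

lemma half_unique (hk : 2 ≤ k) {s y : Letter k} {t : FG k} (h : FE (U s) (tr t (U y))) :
    s = y ∧ t = 1 := by
  by_cases ht : t = 1
  · subst ht; rw [tr_one] at h
    exact ⟨sub_U h.sub, rfl⟩
  exfalso
  by_cases h1 : t⁻¹ ∈ U y
  · have e : (tr t (U y))ᶜ = tr (t * L y) (U (linv y)) := by
      rw [← tr_compl, U_compl, tr_tr]
    have : ∃ q, (tr t (U y))ᶜ ⊆ U q := by
      rw [e]
      by_cases h2 : t * L y = 1
      · exact ⟨linv y, by rw [h2, tr_one]⟩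
      · have h3 : (t * L y)⁻¹ ∉ U (linv y) := by
          rw [mul_inv_rev, ← L_linv]; exact (mem_U_flip _ _).1 h1
        obtain ⟨s, _, hs⟩ := HS_aux h3 h2
        exact ⟨s, hs⟩
    obtain ⟨q, hq⟩ := this
    exact no_cover hk (h.compl.sub.trans (Sub.of hq))
  · obtain ⟨s', h2, h3⟩ := HS_aux h1 ht
    have := sub_U (h.sub.trans (Sub.of h3))
    subst this
    obtain ⟨r, hr⟩ := exists_U (inv_ne_one.2 ht)
    obtain ⟨m, hm1, hm2⟩ := third hk y r
    have h4 : t⁻¹ ∉ U m := fun h => hm2 (U_disj h hr)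
    obtain ⟨s', h5, h6⟩ := HS_aux h4 ht
    have := U_disj h2 h5
    subst this
    have h7 : Sub (tr t (U m)) (tr t (U y)) := (Sub.of h6).trans h.sub
    have h8 : Sub (tr t (U m)) (tr t (U y))ᶜ := (sub_U_compl hm1).tr t
    exact h7.not_compl h8 (tr_freq (U_infinite m))

lemma Sub.map {S R : Set (FG k)} (h : Sub S R) (α : MulAut (FG k)) :
    Sub (α ⁻¹' S) (α ⁻¹' R) :=
  (α.injective.tendsto_cofinite).eventually h

lemma pre_pre (β : MulAut (FG k)) (S : Set (FG k)) :
    (β⁻¹ : MulAut (FG k)) ⁻¹' (β ⁻¹' S) = S := by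
  ext u; simp

lemma Sub.unmap {S R : Set (FG k)} {β : MulAut (FG k)} (h : Sub (β ⁻¹' S) (β ⁻¹' R)) :
    Sub S R := by
  have := h.map β⁻¹
  rwa [pre_pre, pre_pre] at this

lemma Sub.untr {S R : Set (FG k)} {g h : FG k} (H : Sub (WH.tr g S) (WH.tr h R)) :
    Sub S (WH.tr (g⁻¹ * h) R) := by
  have := H.tr g⁻¹
  rwa [tr_tr, tr_tr, inv_mul_cancel, tr_one] at this

lemma rigid (hk : 2 ≤ k) {β : MulAut (FG k)} {G : Letter k → FG k} {φ : Letter k → Letter k}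
    (hF : ∀ z, FE (β ⁻¹' U z) (tr (G z) (U (φ z)))) (hs : ∀ s, ∃ r, φ r = s)
    {z z' : Letter k} (hz : z ≠ z') : G z = G z' := by
  set t := (G z)⁻¹ * G z' with ht
  set y := φ z
  set y' := φ z'
  have hz1 := hF z
  have hz2 := hF z'
  have D : Sub (U y) (tr t (U y'))ᶜ := by
    have h1 : Sub (β ⁻¹' U z) (β ⁻¹' U z')ᶜ := (sub_U_compl hz).map β
    exact ((hz1.symm.sub.trans h1).trans hz2.compl.sub).untr (R := (U y')ᶜ)
  have bk : ∀ {S : Set (FG k)}, Sub S (tr t (U y')) → Sub (tr (G z) S) (tr (G z') (U y')) := by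
    intro S h
    have := h.tr (G z)
    rwa [tr_tr, ht, mul_inv_cancel_left] at this
  have bk2 : ∀ {S : Set (FG k)}, Sub (tr t (U y')) S → Sub (tr (G z') (U y')) (tr (G z) S) := by
    intro S h
    have := h.tr (G z)
    rwa [tr_tr, ht, mul_inv_cancel_left] at this
  have N : ¬ Sub (U y)ᶜ (tr t (U y')) := by
    intro h
    have h1 := bk h
    have h2 : Sub (β ⁻¹' (U z)ᶜ) (β ⁻¹' U z') := (hz1.compl.sub.trans h1).trans hz2.symm.sub
    exact no_cover hk h2.unmap
  suffices t = 1 by rw [ht, inv_mul_eq_one] at this; exact this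
  obtain ⟨s, hA | hB⟩ := HS t y'
  · have hsy : y ≠ s := by
      rintro rfl
      have h1 := (Sub.of hA).trans D
      exact (Sub.refl _).not_compl h1 (tr_freq (U_infinite y'))
    obtain ⟨r, hr⟩ := hs s
    set h := β (G z * (G r)⁻¹) with hh
    have hX : FE (β ⁻¹' (tr h (U r))) (tr (G z) (U s)) := by
      rw [map_tr, hh, MulAut.inv_apply_self]
      have := (hF r).tr (G z * (G r)⁻¹)
      rwa [tr_tr, inv_mul_cancel_right, hr] at this
    have i1 : Sub (U z') (tr h (U r)) :=
      ((hz2.sub.trans (bk2 (Sub.of hA))).trans hX.symm.sub).unmap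
    have i2 : Sub (U z) (tr h (U r))ᶜ :=
      Sub.unmap (β := β) ((hz1.sub.trans ((sub_U_compl hsy).tr (G z))).trans hX.symm.compl.sub)
    obtain ⟨q, hq | hq⟩ := HS h r
    · have := sub_U (i1.trans (Sub.of hq))
      subst this
      have j : Sub (tr (G z) (U s)) (tr (G z') (U y')) :=
        (hX.symm.sub.trans ((Sub.of hq).map β)).trans hz2.sub
      exact (half_unique hk (j.untr.FE (Sub.of hA))).2
    · have := sub_U (i2.trans (Sub.of hq))
      subst this
      have j : Sub (tr (G z) (U s)ᶜ) (tr (G z) (U y)) :=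
        (hX.symm.compl.sub.trans ((Sub.of hq).map β)).trans hz1.sub
      have := j.untr
      rw [inv_mul_cancel, tr_one] at this
      exact (no_cover hk this).elim
  · have := sub_U (D.trans (Sub.of hB))
    subst this
    refine absurd ?_ N
    have := (Sub.of hB).compl
    rwa [compl_compl] at this

theorem letters (hk : 2 ≤ k) {w : FG k} (hw : w ∈ SM k) {α : MulAut (FG k)} (hα : α w = w) :
    ∃ (g : FG k) (ζ : Fin k → Letter k), (∀ i, ∃ j, (ζ j).1 = i) ∧
      ∀ j, α (FreeGroup.of j) = g * L (ζ j) * g⁻¹ := by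
  set β := α⁻¹ with hβ
  have hβw : β w = w := by
    conv_lhs => rw [← hα]
    simp [hβ]
  choose g ζ hg using fun j => images hk hw hβw j
  let φ : Letter k → Letter k := fun z => if z.2 then ζ z.1 else linv (ζ z.1)
  let G : Letter k → FG k := fun z =>
    if z.2 then g z.1 else (α (FreeGroup.of z.1))⁻¹ * g z.1 * L (ζ z.1)
  have hF : ∀ z, FE (β ⁻¹' U z) (tr (G z) (U (φ z))) := by
    rintro ⟨j, b⟩
    cases b
    · have h1 : U (j, false) = tr (FreeGroup.of j)⁻¹ (U (j, true))ᶜ := by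
        rw [U_compl, tr_tr, L_true, inv_mul_cancel, tr_one]; rfl
      have h2 : FE (β ⁻¹' (U (j, true))ᶜ) (tr (g j * L (ζ j)) (U (linv (ζ j)))) := by
        have := (hg j).compl
        rwa [← tr_compl, U_compl, tr_tr] at this
      rw [h1, map_tr]
      have := h2.tr (β⁻¹ (FreeGroup.of j)⁻¹)
      rw [tr_tr] at this
      simpa [φ, G, hβ, mul_assoc] using this
    · exact hg j
  have hinj : Function.Injective fun j => (ζ j).1 := by
    intro j j' hjj
    have : ∃ b t, FE (β ⁻¹' U (j, true)) (tr t (β ⁻¹' U (j', b))) := by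
      have : ∃ b, φ (j', b) = ζ j := by
        by_cases h : ζ j' = ζ j
        · exact ⟨true, by simpa [φ] using h⟩
        · refine ⟨false, ?_⟩
          simp only at hjj
          rcases h1 : ζ j with ⟨a, b⟩
          rcases h2 : ζ j' with ⟨a', b'⟩
          rw [h1, h2] at h hjj
          simp at hjj
          subst hjj
          simp [φ, h2, linv]
          cases b <;> cases b' <;> simp_all
      obtain ⟨b, hb⟩ := this
      refine ⟨b, g j * (G (j', b))⁻¹, ?_⟩
      have h1 := (hF (j', b)).tr (g j * (G (j', b))⁻¹)
      rw [tr_tr, inv_mul_cancel_right, hb] at h1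
      exact (hg j).trans h1.symm
    obtain ⟨b, t, ht⟩ := this
    have e : tr t (β ⁻¹' U (j', b)) = β ⁻¹' (tr (β t) (U (j', b))) := by
      rw [map_tr, MulAut.inv_apply_self]
    rw [e] at ht
    have := ht.map β⁻¹
    rw [pre_pre, pre_pre] at this
    have := (half_unique hk this).1
    simpa using congrArg Prod.fst this
  have hsur : ∀ i, ∃ j, (ζ j).1 = i := Finite.injective_iff_surjective.1 hinj
  have hs : ∀ s, ∃ r, φ r = s := by
    rintro ⟨i, b⟩
    obtain ⟨j, hj⟩ := hsur i
    rcases h1 : ζ j with ⟨a, c⟩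
    rw [h1] at hj
    simp at hj
    subst hj
    by_cases h : c = b
    · exact ⟨(j, true), by simp [φ, h1, h]⟩
    · refine ⟨(j, false), ?_⟩
      simp [φ, h1, linv]
      cases b <;> cases c <;> simp_all
  let z0 : Letter k := (⟨0, by omega⟩, true)
  have hG : ∀ z, G z = G z0 := fun z => by
    by_cases h : z = z0
    · rw [h]
    · exact rigid hk hF hs h
  refine ⟨G z0, ζ, hsur, fun j => ?_⟩
  have h1 : g j = G z0 := hG (j, true)
  have h2 : (α (FreeGroup.of j))⁻¹ * g j * L (ζ j) = G z0 := hG (j, false)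
  rw [h1] at h2
  rw [eq_mul_inv_iff_mul_eq]
  conv_lhs => rw [← h2]
  group

theorem main (hk : 2 ≤ k) {w : FG k} (hw : w ∈ TS k) (hne : w ≠ 1) {α : MulAut (FG k)}
    (hα : α w = w) : ∃ n : ℤ, α = (MulAut.conj w) ^ n := by
  obtain ⟨hSM, hpp, hrel⟩ := hw
  obtain ⟨g, ζ, hsur, hl⟩ := letters hk hSM hα
  set τ : MulAut (FG k) := (MulAut.conj g)⁻¹ * α with hτ
  have hτj : ∀ j, τ (FreeGroup.of j) = L (ζ j) := fun j => by
    rw [hτ, MulAut.mul_apply, hl, ← map_inv, MulAut.conj_apply]; group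
  have hτ1 : τ = 1 := by
    by_contra h
    refine hrel τ ?_ h ?_
    · ext x
      constructor
      · rintro ⟨y, ⟨j, rfl | rfl⟩, rfl⟩
        · rw [hτj]; exact L_mem_letterSet _
        · rw [map_inv, hτj, ← L_linv]; exact L_mem_letterSet _
      · intro hx
        obtain ⟨⟨i, b⟩, rfl⟩ := letterSet_eq hx
        obtain ⟨j, hj⟩ := hsur i
        rcases h1 : ζ j with ⟨a, c⟩
        rw [h1] at hj
        simp at hj
        subst hj
        by_cases h : c = b
        · exact ⟨FreeGroup.of j, ⟨j, Or.inl rfl⟩, by rw [hτj, h1, h]⟩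
        · refine ⟨(FreeGroup.of j)⁻¹, ⟨j, Or.inr rfl⟩, ?_⟩
          rw [map_inv, hτj, ← L_linv, h1]
          congr 1
          cases b <;> cases c <;> simp_all [linv]
    · rw [hτ, MulAut.mul_apply, hα, isConj_iff]
      refine ⟨g, ?_⟩
      rw [← map_inv, MulAut.conj_apply]; group
  have hαg : α = MulAut.conj g := by
    rw [hτ, inv_mul_eq_one] at hτ1; exact hτ1.symm
  have hc : Commute w g := by
    rw [hαg, MulAut.conj_apply, mul_inv_eq_iff_eq_mul] at hα
    exact hα.symm
  obtain ⟨t, m, n, h1, h2⟩ := exists_common hc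
  have hm : m = 1 ∨ m = -1 := by
    by_contra hcon
    apply hpp
    rcases Int.natAbs_eq m with h | h
    · refine ⟨t, m.natAbs, ?_, ?_⟩
      · have : m ≠ 0 := by rintro rfl; simp at h1; exact hne h1
        omega
      · rw [h1]; conv_lhs => rw [h]
        rw [zpow_natCast]
    · refine ⟨t⁻¹, m.natAbs, ?_, ?_⟩
      · have : m ≠ 0 := by rintro rfl; simp at h1; exact hne h1
        omega
      · rw [h1]; conv_lhs => rw [h]
        rw [zpow_neg, zpow_natCast, inv_pow]
  rcases hm with rfl | rfl
  · refine ⟨n, ?_⟩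
    rw [hαg, ← map_zpow, h2, h1, zpow_one]
  · refine ⟨-n, ?_⟩
    rw [hαg, ← map_zpow, h2, h1, ← zpow_mul]; simp

lemma conj_inj (hk : 2 ≤ k) {g : FG k} (h : MulAut.conj g = 1) : g = 1 := by
  have hc : ∀ u, Commute g u := fun u => by
    have := congrArg (fun a : MulAut (FG k) => a u) h
    simp only [MulAut.conj_apply, MulAut.one_apply] at this
    rw [mul_inv_eq_iff_eq_mul] at this
    exact this
  exact comm_two (x := (⟨0, by omega⟩, true)) (y := (⟨1, by omega⟩, true)) (by simp)
    (hc _) (hc _)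

end WH

/-- for nontrivial `w ∈ TS'`, the stabilizer of `w` in `Aut(F_k)` is the
infinite cyclic group generated by the inner automorphism `ad(w) : u ↦ w u w⁻¹`. -/
theorem TS'_stabilizer_cyclic (k : ℕ) (hk : 2 ≤ k) (w : FG k)
    (hw : w ∈ TS' k) (hne : w ≠ 1) :
    (∀ α : MulAut (FG k), α w = w ↔ ∃ n : ℤ, α = (MulAut.conj w) ^ n) ∧
    Function.Injective (fun n : ℤ => (MulAut.conj w) ^ n : ℤ → MulAut (FG k)) := by
  refine ⟨fun α => ⟨fun h => ?_, ?_⟩, ?_⟩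
  · obtain ⟨x, u, hu, rfl⟩ := hw
    have hu1 : u ≠ 1 := by rintro rfl; simp at hne
    have key : ((MulAut.conj x)⁻¹ * α * MulAut.conj x) u = u := by
      rw [MulAut.mul_apply, MulAut.mul_apply, MulAut.conj_apply, h, ← map_inv, MulAut.conj_apply]
      group
    obtain ⟨n, hn⟩ := WH.main hk hu hu1 key
    refine ⟨n, ?_⟩
    rw [map_mul, map_mul, map_inv, conj_zpow, ← hn]
    group
  · rintro ⟨n, rfl⟩
    rw [← map_zpow, MulAut.conj_apply, ← zpow_neg, ← zpow_add_one, ← zpow_add]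
    simp
  · intro n m hnm
    simp only at hnm
    have h1 : MulAut.conj (w ^ (n - m)) = 1 := by
      rw [map_zpow, zpow_sub, hnm, mul_inv_cancel]
    have h2 := WH.conj_inj hk h1
    by_contra h3
    have h4 : n - m ≠ 0 := sub_ne_zero.2 h3
    exact h4 ((IsMulTorsionFree.zpow_eq_one_iff_right hne).1 h2)
end
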